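/- arXiv:2010.05604 — 2 statements merged into one kernel-verified Lean document; each statement's English description precedes it below -/
import Mathlib

section
/- Suppose G is a Finsler-type energy on ℝ^n and Φ defines a regular bounded domain Ω with constant δ₀. Fix p,q ∈ Ω̄ and suppose there exists an H¹ curve γ̄ on [a,b] with γ̄(a) = p, γ̄(b) = q and Φ(γ̄(s)) ≤ 0 for all s. For each δ ∈ (0,δ₀) let γ_δ be a minimizer of J_δ on C_δ. Then, with k₁ := (1/2)∫_a^b G(γ̄,γ̄̇) ds, one has J_δ(γ_δ) ≤ k₁ < +∞ for every δ ∈ (0,δ₀), and (1/2) G(γ_δ(s),γ̇_δ(s)) ≤ k₁/(b−a) + χ_δ(Φ(γ_δ(s))) for every δ ∈ (0,δ₀) and every s ∈ [a,b]. -/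
open MeasureTheory Set Filter RealInnerProductSpace

noncomputable section

/-- Euclidean space `ℝ^n`. -/
abbrev Evec (n : ℕ) := EuclideanSpace ℝ (Fin n)

/-- An `H¹` curve on `[a,b]`: an absolutely continuous curve whose a.e. derivative is
square-integrable, encoded by a choice of (integrable, square-integrable) derivative
together with the fundamental theorem of calculus identity. -/
structure H1Curve (n : ℕ) (a b : ℝ) where
  toFun : ℝ → Evec n
  deriv : ℝ → Evec n
  deriv_integrable : IntegrableOn deriv (Icc a b)
  deriv_sq_integrable : IntegrableOn (fun s => ‖deriv s‖ ^ 2) (Icc a b)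
  eq_add_integral : ∀ t ∈ Icc a b, toFun t = toFun a + ∫ s in a..t, deriv s

/-- The partial differential `d_qG(q,v)` of `G` in the first variable. -/
def dqCLM {n : ℕ} (G : Evec n → Evec n → ℝ) (q v : Evec n) : Evec n →L[ℝ] ℝ :=
  fderiv ℝ (fun z => G z v) q

/-- The partial differential `d_vG(q,v)` of `G` in the second variable. -/
def dvCLM {n : ℕ} (G : Evec n → Evec n → ℝ) (q v : Evec n) : Evec n →L[ℝ] ℝ :=
  fderiv ℝ (fun w => G q w) v

/-- A Finsler-type energy on `ℝ^n` with constants `ℓ ≥ 1` and `α > 0`. -/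
structure IsFinslerEnergy (n : ℕ) (G : Evec n → Evec n → ℝ) (ℓ α : ℝ) : Prop where
  continuous : Continuous fun p : Evec n × Evec n => G p.1 p.2
  smooth : ContDiffOn ℝ 2 (fun p : Evec n × Evec n => G p.1 p.2) {p | p.2 ≠ 0}
  homog : ∀ (q v : Evec n) (lam : ℝ), 0 < lam → G q (lam • v) = lam ^ 2 * G q v
  one_le_ell : 1 ≤ ℓ
  alpha_pos : 0 < α
  lower : ∀ q v, (1 / ℓ) * ‖v‖ ^ 2 ≤ G q v
  upper : ∀ q v, G q v ≤ ℓ * ‖v‖ ^ 2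
  dq_bound : ∀ q v, ‖dqCLM G q v‖ ≤ ℓ * (1 + ‖v‖ ^ 2)
  dv_bound : ∀ q v, ‖dvCLM G q v‖ ≤ ℓ * (1 + ‖v‖)
  vv_convex : ∀ (q v : Evec n), v ≠ 0 → ∀ w : Evec n,
    α * ‖w‖ ^ 2 ≤ fderiv ℝ (fun u => dvCLM G q u w) v w

/-- `Φ` defines a regular bounded domain `Ω = Φ⁻¹((−∞,0))` with constant `δ₀`. -/
structure IsRegularDomain (n : ℕ) (Φ : Evec n → ℝ) (δ₀ : ℝ) : Prop where
  smooth : ContDiff ℝ 2 Φ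
  nonempty : (Φ ⁻¹' Iio 0).Nonempty
  bounded : Bornology.IsBounded (Φ ⁻¹' Iio 0)
  boundary_eq : frontier (Φ ⁻¹' Iio 0) = Φ ⁻¹' {0}
  delta0_pos : 0 < δ₀
  grad_ne_zero : ∀ q : Evec n, |Φ q| ≤ δ₀ → gradient Φ q ≠ 0
  sublevel_compact : ∀ δ ∈ Icc (0:ℝ) δ₀, IsCompact (Φ ⁻¹' Iic δ)

/-- Membership in `Mf`: curves in `Ω̄` with endpoints on `∂Ω`. -/
def MemMf {n : ℕ} (Φ : Evec n → ℝ) (x : H1Curve n 0 1) : Prop :=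
  (∀ s ∈ Icc (0:ℝ) 1, Φ (x.toFun s) ≤ 0) ∧ Φ (x.toFun 0) = 0 ∧ Φ (x.toFun 1) = 0

/-- Membership in `V⁻(x,Mf)`. -/
def MemVminus {n : ℕ} (Φ : Evec n → ℝ) (x ξ : H1Curve n 0 1) : Prop :=
  ⟪gradient Φ (x.toFun 0), ξ.toFun 0⟫ = 0 ∧
  ⟪gradient Φ (x.toFun 1), ξ.toFun 1⟫ = 0 ∧
  ∀ s ∈ Ioo (0:ℝ) 1, Φ (x.toFun s) = 0 → ⟪gradient Φ (x.toFun s), ξ.toFun s⟫ ≤ 0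

/-- Membership in `W⁻(x,Mf)`: as `V⁻` but with strict inequality at interior touching points. -/
def MemWminus {n : ℕ} (Φ : Evec n → ℝ) (x ξ : H1Curve n 0 1) : Prop :=
  MemVminus Φ x ξ ∧
  ∀ s ∈ Ioo (0:ℝ) 1, Φ (x.toFun s) = 0 → ⟪gradient Φ (x.toFun s), ξ.toFun s⟫ < 0

/-- The energy functional `J(x) = (1/2)∫₀¹ G(x,ẋ)`. -/
def energy {n : ℕ} (G : Evec n → Evec n → ℝ) (x : H1Curve n 0 1) : ℝ :=
  (1 / 2) * ∫ s in (0:ℝ)..1, G (x.toFun s) (x.deriv s)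

/-- The differential `dJ(x)[ξ]`. -/
def dJ {n : ℕ} (G : Evec n → Evec n → ℝ) (x ξ : H1Curve n 0 1) : ℝ :=
  (1 / 2) * ∫ s in (0:ℝ)..1,
    (dqCLM G (x.toFun s) (x.deriv s) (ξ.toFun s) + dvCLM G (x.toFun s) (x.deriv s) (ξ.deriv s))

/-- `x` is a `V⁻`-critical curve for `J` on `Mf`. -/
def IsVCritical {n : ℕ} (G : Evec n → Evec n → ℝ) (Φ : Evec n → ℝ) (x : H1Curve n 0 1) : Prop :=
  MemMf Φ x ∧ ∀ ξ : H1Curve n 0 1, MemVminus Φ x ξ → 0 ≤ dJ G x ξ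

/-- The norm `‖ξ‖_*`. -/
def starNorm {n : ℕ} (ξ : H1Curve n 0 1) : ℝ :=
  max ‖ξ.toFun 0‖ ‖ξ.toFun 1‖ + Real.sqrt (∫ s in (0:ℝ)..1, ‖ξ.deriv s‖ ^ 2)

/-- The distance `dist_*`. -/
def starDist {n : ℕ} (x y : H1Curve n 0 1) : ℝ :=
  max ‖x.toFun 0 - y.toFun 0‖ ‖x.toFun 1 - y.toFun 1‖ +
    Real.sqrt (∫ s in (0:ℝ)..1, ‖x.deriv s - y.deriv s‖ ^ 2)

/-- The penalization function `χ_δ`. -/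
def chi (δ t : ℝ) : ℝ := if t ≤ 0 then 0 else t ^ 2 / (δ - t) ^ 2

/-- Membership in `C_δ = C([a,b],p,q,Ω_δ)`. -/
def MemC {n : ℕ} (Φ : Evec n → ℝ) (δ a b : ℝ) (p q : Evec n) (γ : H1Curve n a b) : Prop :=
  (∀ s ∈ Icc a b, Φ (γ.toFun s) < δ) ∧ γ.toFun a = p ∧ γ.toFun b = q

/-- The penalized functional `J_δ`. -/
def Jpen {n : ℕ} (G : Evec n → Evec n → ℝ) (Φ : Evec n → ℝ) (δ a b : ℝ)
    (γ : H1Curve n a b) : ℝ :=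
  (1 / 2) * (∫ s in a..b, G (γ.toFun s) (γ.deriv s)) + ∫ s in a..b, chi δ (Φ (γ.toFun s))

/-- `y` represents the backward parametrization `ℛx` of `x` (on `[0,1]`). -/
def RevRep {n : ℕ} (x y : H1Curve n 0 1) : Prop :=
  (∀ s, y.toFun s = x.toFun (1 - s)) ∧ (∀ s, y.deriv s = -x.deriv (1 - s))

namespace Fins
open scoped Topology
variable {n : ℕ} {G : Evec n → Evec n → ℝ} {ℓ α : ℝ}

/-- the energy as a function on the product -/
def Gp (G : Evec n → Evec n → ℝ) : Evec n × Evec n → ℝ := fun p => G p.1 p.2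

lemma zero_of_zero (hG : IsFinslerEnergy n G ℓ α) (q : Evec n) : G q 0 = 0 := by
  have h1 := hG.lower q 0
  have h2 := hG.upper q 0
  simp at h1 h2
  linarith

lemma nonneg (hG : IsFinslerEnergy n G ℓ α) (q v : Evec n) : 0 ≤ G q v := by
  have := hG.one_le_ell
  exact le_trans (by positivity) (hG.lower q v)

lemma isOpen_ne : IsOpen {p : Evec n × Evec n | p.2 ≠ 0} :=
  isOpen_ne_fun continuous_snd continuous_const

lemma hasFDerivAt_zero (hG : IsFinslerEnergy n G ℓ α) (q : Evec n) :
    HasFDerivAt (Gp G) (0 : Evec n × Evec n →L[ℝ] ℝ) (q, 0) := by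
  have hl := hG.one_le_ell
  rw [hasFDerivAt_iff_isLittleO_nhds_zero]
  have h1 : (fun h : Evec n × Evec n => Gp G ((q, 0) + h) - Gp G (q, 0) -
      (0 : Evec n × Evec n →L[ℝ] ℝ) h) =O[𝓝 0] fun h => ‖h‖ ^ 2 := by
    refine Asymptotics.IsBigO.of_bound ℓ (Eventually.of_forall fun h => ?_)
    have hz := zero_of_zero hG q
    simp only [Gp, Prod.fst_add, Prod.snd_add, zero_add, hz, sub_zero, ContinuousLinearMap.zero_apply]
    rw [Real.norm_of_nonneg (nonneg hG _ _), norm_pow, norm_norm]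
    refine (hG.upper _ _).trans ?_
    have : ‖h.2‖ ≤ ‖h‖ := norm_snd_le h
    gcongr
  refine h1.trans_isLittleO ?_
  have := Asymptotics.isLittleO_norm_pow_id (E' := Evec n × Evec n) (n := 2) (by norm_num)
  exact this

lemma differentiableAt (hG : IsFinslerEnergy n G ℓ α) (p : Evec n × Evec n) :
    DifferentiableAt ℝ (Gp G) p := by
  obtain ⟨q, v⟩ := p
  by_cases hv : v = 0
  · subst hv; exact (hasFDerivAt_zero hG q).differentiableAt
  · exact (hG.smooth.contDiffAt (isOpen_ne.mem_nhds hv)).differentiableAt (by norm_num)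

lemma hasFDerivAt_q (hG : IsFinslerEnergy n G ℓ α) (q v : Evec n) :
    HasFDerivAt (fun z => G z v)
      ((fderiv ℝ (Gp G) (q, v)).comp (ContinuousLinearMap.inl ℝ (Evec n) (Evec n))) q :=
  HasFDerivAt.comp (g := Gp G) (f := fun z => (z, v)) q (differentiableAt hG (q, v)).hasFDerivAt (hasFDerivAt_prodMk_left q v)

lemma hasFDerivAt_v (hG : IsFinslerEnergy n G ℓ α) (q v : Evec n) :
    HasFDerivAt (fun w => G q w)
      ((fderiv ℝ (Gp G) (q, v)).comp (ContinuousLinearMap.inr ℝ (Evec n) (Evec n))) v :=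
  HasFDerivAt.comp (g := Gp G) (f := fun z => (q, z)) v (differentiableAt hG (q, v)).hasFDerivAt (hasFDerivAt_prodMk_right q v)

lemma dq_eq (hG : IsFinslerEnergy n G ℓ α) (q v : Evec n) :
    dqCLM G q v = (fderiv ℝ (Gp G) (q, v)).comp (ContinuousLinearMap.inl ℝ (Evec n) (Evec n)) :=
  (hasFDerivAt_q hG q v).fderiv

lemma dv_eq (hG : IsFinslerEnergy n G ℓ α) (q v : Evec n) :
    dvCLM G q v = (fderiv ℝ (Gp G) (q, v)).comp (ContinuousLinearMap.inr ℝ (Evec n) (Evec n)) :=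
  (hasFDerivAt_v hG q v).fderiv

lemma hasFDerivAt_dq (hG : IsFinslerEnergy n G ℓ α) (q v : Evec n) :
    HasFDerivAt (fun z => G z v) (dqCLM G q v) q := by
  rw [dq_eq hG]; exact hasFDerivAt_q hG q v

lemma hasFDerivAt_dv (hG : IsFinslerEnergy n G ℓ α) (q v : Evec n) :
    HasFDerivAt (fun z => G q z) (dvCLM G q v) v := by
  rw [dv_eq hG]; exact hasFDerivAt_v hG q v

lemma fderiv_apply (hG : IsFinslerEnergy n G ℓ α) (q v x y : Evec n) :
    fderiv ℝ (Gp G) (q, v) (x, y) = dqCLM G q v x + dvCLM G q v y := by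
  rw [dq_eq hG, dv_eq hG]
  simp only [ContinuousLinearMap.comp_apply, ContinuousLinearMap.inl_apply,
    ContinuousLinearMap.inr_apply]
  rw [← map_add]; simp

lemma hasFDerivAt_Gp (hG : IsFinslerEnergy n G ℓ α) (q v : Evec n) :
    HasFDerivAt (Gp G) ((dqCLM G q v).comp (ContinuousLinearMap.fst ℝ _ _) +
      (dvCLM G q v).comp (ContinuousLinearMap.snd ℝ _ _)) (q, v) := by
  convert (differentiableAt hG (q, v)).hasFDerivAt using 1
  ext ⟨x⟩ <;> simp [fderiv_apply hG]

lemma dv_zero (hG : IsFinslerEnergy n G ℓ α) (q : Evec n) : dvCLM G q 0 = 0 := by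
  rw [dv_eq hG, (hasFDerivAt_zero hG q).fderiv]; simp

lemma dq_zero (hG : IsFinslerEnergy n G ℓ α) (q : Evec n) : dqCLM G q 0 = 0 := by
  rw [dq_eq hG, (hasFDerivAt_zero hG q).fderiv]; simp

lemma dq_smul (hG : IsFinslerEnergy n G ℓ α) (q v : Evec n) {c : ℝ} (hc : 0 < c) :
    dqCLM G q (c • v) = c ^ 2 • dqCLM G q v := by
  have h1 := (hasFDerivAt_dq hG q v).const_smul (c ^ 2)
  have h2 := hasFDerivAt_dq hG q (c • v)
  have : (fun z => G z (c • v)) = (c ^ 2) • (fun z => G z v) := by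
    ext z; simp [hG.homog z v c hc]
  rw [this] at h2
  exact h2.unique h1

lemma dv_smul (hG : IsFinslerEnergy n G ℓ α) (q v : Evec n) {c : ℝ} (hc : 0 < c) :
    dvCLM G q (c • v) = c • dvCLM G q v := by
  have h1 := (hasFDerivAt_dv hG q v).const_smul (c ^ 2)
  have h2 := (hasFDerivAt_dv hG q (c • v)).comp v ((hasFDerivAt_id v).const_smul c)
  have : (fun z => G q z) ∘ (HSMul.hSMul c) = (c ^ 2) • (fun z => G q z) := by
    ext z; simp [hG.homog q z c hc]
  rw [this] at h2
  have h3 := h2.unique h1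
  ext w
  have h4 := congrArg (fun f => f w) h3
  simp at h4
  simp
  have : c * (dvCLM G q (c • v)) w = c * (c * dvCLM G q v w) := by rw [h4]; ring
  exact mul_left_cancel₀ hc.ne' this

lemma euler (hG : IsFinslerEnergy n G ℓ α) (q v : Evec n) :
    dvCLM G q v v = 2 * G q v := by
  have h1 : HasDerivAt (fun t : ℝ => G q (t • v)) (dvCLM G q v v) 1 := by
    have h2 : HasDerivAt (fun t : ℝ => t • v) v 1 := by
      simpa using (hasDerivAt_id (1:ℝ)).smul_const v
    have h3 := hasFDerivAt_dv hG q ((1:ℝ) • v)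
    have h4 := h3.comp_hasDerivAt (1:ℝ) h2
    rw [one_smul] at h4
    exact h4
  have h2 : HasDerivAt (fun t : ℝ => t ^ 2 * G q v) (2 * G q v) 1 := by
    simpa using (hasDerivAt_pow 2 (1:ℝ)).mul_const (G q v)
  have h3 : (fun t : ℝ => G q (t • v)) =ᶠ[𝓝 1] fun t => t ^ 2 * G q v := by
    filter_upwards [lt_mem_nhds (zero_lt_one (α := ℝ))] with t ht
    exact hG.homog q v t ht
  exact h1.unique (h2.congr_of_eventuallyEq h3)

lemma dq_norm (hG : IsFinslerEnergy n G ℓ α) (q v : Evec n) :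
    ‖dqCLM G q v‖ ≤ ℓ * ‖v‖ ^ 2 := by
  have hl := hG.one_le_ell
  refine le_of_forall_pos_le_add fun ε hε => ?_
  set c := Real.sqrt (ℓ / ε) with hc
  have hc0 : 0 < c := Real.sqrt_pos.2 (by positivity)
  have hc2 : c ^ 2 = ℓ / ε := Real.sq_sqrt (by positivity)
  have h := hG.dq_bound q (c • v)
  rw [dq_smul hG q v hc0, norm_smul, norm_smul, mul_pow] at h
  simp only [Real.norm_eq_abs, sq_abs, hc2] at h
  rw [abs_of_pos (by positivity)] at h
  have h5 : ℓ / ε * ‖dqCLM G q v‖ ≤ ℓ / ε * (ℓ * ‖v‖ ^ 2 + ε) := by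
    refine h.trans (le_of_eq ?_)
    field_simp
    ring
  exact le_of_mul_le_mul_left h5 (by positivity)

lemma continuousAt_fderiv (hG : IsFinslerEnergy n G ℓ α) {p : Evec n × Evec n} (hp : p.2 ≠ 0) :
    ContinuousAt (fderiv ℝ (Gp G)) p :=
  (hG.smooth.continuousOn_fderiv_of_isOpen isOpen_ne (by norm_num)).continuousAt
    (isOpen_ne.mem_nhds hp)

lemma continuous_dq (hG : IsFinslerEnergy n G ℓ α) :
    Continuous fun p : Evec n × Evec n => dqCLM G p.1 p.2 := by
  rw [continuous_iff_continuousAt]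
  rintro ⟨q, v⟩
  by_cases hv : v = 0
  · subst hv
    rw [ContinuousAt, dq_zero hG q]
    refine squeeze_zero_norm (a := fun p : Evec n × Evec n => ℓ * ‖p.2‖ ^ 2)
      (fun p => dq_norm hG _ _) ?_
    have : Continuous fun p : Evec n × Evec n => ℓ * ‖p.2‖ ^ 2 := by fun_prop
    simpa using this.tendsto (q, 0)
  · have h1 : (fun p : Evec n × Evec n => dqCLM G p.1 p.2) = fun p =>
        (fderiv ℝ (Gp G) p).comp (ContinuousLinearMap.inl ℝ (Evec n) (Evec n)) := by
      ext1 p; exact dq_eq hG p.1 p.2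
    rw [h1]
    exact (continuousAt_fderiv hG hv).clm_comp continuousAt_const

lemma continuous_dv_left (hG : IsFinslerEnergy n G ℓ α) (v : Evec n) :
    Continuous fun q : Evec n => dvCLM G q v := by
  by_cases hv : v = 0
  · subst hv
    simp only [dv_zero hG]
    exact continuous_const
  · rw [continuous_iff_continuousAt]
    intro q
    have h1 : (fun q : Evec n => dvCLM G q v) = fun q =>
        (fderiv ℝ (Gp G) (q, v)).comp (ContinuousLinearMap.inr ℝ (Evec n) (Evec n)) := by
      ext1 p; exact dv_eq hG p v
    rw [h1]
    have : ContinuousAt (fun q => fderiv ℝ (Gp G) (q, v)) q :=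
      ContinuousAt.comp (g := fderiv ℝ (Gp G)) (f := fun q => (q, v))
        (continuousAt_fderiv hG (p := (q, v)) hv) (by fun_prop)
    exact this.clm_comp continuousAt_const

/-- differentiability of the momentum map off zero -/
lemma differentiableAt_dv (hG : IsFinslerEnergy n G ℓ α) (q v : Evec n) (hv : v ≠ 0) :
    DifferentiableAt ℝ (fun u => dvCLM G q u) v := by
  have h1 : (fun u : Evec n => dvCLM G q u) = fun u =>
        (fderiv ℝ (Gp G) (q, u)).comp (ContinuousLinearMap.inr ℝ (Evec n) (Evec n)) := by
      ext1 p; exact dv_eq hG q p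
  rw [h1]
  have h2 : DifferentiableAt ℝ (fderiv ℝ (Gp G)) (q, v) :=
    ((hG.smooth.contDiffAt (isOpen_ne.mem_nhds (x := (q, v)) hv)).fderiv_right
      (m := 1) (by norm_num)).differentiableAt (by norm_num)
  have h3 : DifferentiableAt ℝ (fun u => fderiv ℝ (Gp G) (q, u)) v :=
    DifferentiableAt.comp (g := fderiv ℝ (Gp G)) (f := fun u => (q, u)) v h2 (by fun_prop)
  exact h3.clm_comp (differentiableAt_const _)

lemma two_G_ge (hG : IsFinslerEnergy n G ℓ α) (q v : Evec n) :
    α * ‖v‖ ^ 2 ≤ 2 * G q v := by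
  by_cases hv : v = 0
  · subst hv; simp [zero_of_zero hG q]
  · refine (hG.vv_convex q v hv v).trans (le_of_eq ?_)
    have hd : DifferentiableAt ℝ (fun u => dvCLM G q u v) v :=
      (differentiableAt_dv hG q v hv).clm_apply (differentiableAt_const _)
    have h2 : HasDerivAt (fun t : ℝ => t • v) v 1 := by
      simpa using (hasDerivAt_id (1:ℝ)).smul_const v
    have h1 : HasDerivAt (fun t : ℝ => dvCLM G q (t • v) v)
        (fderiv ℝ (fun u => dvCLM G q u v) v v) 1 := by
      have h3 : HasFDerivAt (fun u => dvCLM G q u v) (fderiv ℝ (fun u => dvCLM G q u v) v)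
        ((1:ℝ) • v) := by simpa using hd.hasFDerivAt
      exact h3.comp_hasDerivAt (1:ℝ) h2
    have h4 : HasDerivAt (fun t : ℝ => t * dvCLM G q v v) (2 * G q v) 1 := by
      simpa [euler hG] using (hasDerivAt_id (1:ℝ)).mul_const (dvCLM G q v v)
    have h3 : (fun t : ℝ => dvCLM G q (t • v) v) =ᶠ[𝓝 1] fun t => t * dvCLM G q v v := by
      filter_upwards [lt_mem_nhds (zero_lt_one (α := ℝ))] with t ht
      rw [dv_smul hG q v ht]; simp
    exact h1.unique (h4.congr_of_eventuallyEq h3)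

lemma strong_mono (hG : IsFinslerEnergy n G ℓ α) (q v₁ v₂ : Evec n) :
    α * ‖v₁ - v₂‖ ^ 2 ≤ (dvCLM G q v₁ - dvCLM G q v₂) (v₁ - v₂) := by
  have hα := hG.alpha_pos
  set w := v₁ - v₂ with hw
  by_cases h0 : ∃ t ∈ Icc (0:ℝ) 1, v₂ + t • w = 0
  · obtain ⟨t, ht, h⟩ := h0
    have e2 : v₂ = t • (-w) := by rw [smul_neg]; exact eq_neg_of_add_eq_zero_left h
    have e1 : v₁ = (1 - t) • w := by
      have : v₁ = v₂ + w := by rw [hw]; abel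
      rw [this, e2, sub_smul, smul_neg, one_smul]; abel
    have d1 : dvCLM G q v₁ w = (1 - t) * (2 * G q w) := by
      rcases eq_or_lt_of_le (sub_nonneg.2 ht.2) with h | h
      · rw [e1, ← h]; simp [dv_zero hG]
      · rw [e1, dv_smul hG q w h]; simp [euler hG]
    have d2 : dvCLM G q v₂ w = - (t * (2 * G q (-w))) := by
      rcases eq_or_lt_of_le ht.1 with h | h
      · rw [e2, ← h]; simp [dv_zero hG]
      · rw [e2, dv_smul hG q (-w) h, ← euler hG q (-w)]; simp
    rw [ContinuousLinearMap.sub_apply, d1, d2]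
    have g1 := two_G_ge hG q w
    have g2 := two_G_ge hG q (-w)
    rw [norm_neg] at g2
    nlinarith [mul_le_mul_of_nonneg_left g1 (sub_nonneg.2 ht.2), mul_le_mul_of_nonneg_left g2 ht.1]
  · push Not at h0
    have hd : ∀ t ∈ Icc (0:ℝ) 1, HasDerivAt (fun t : ℝ => dvCLM G q (v₂ + t • w) w)
        (fderiv ℝ (fun u => dvCLM G q u w) (v₂ + t • w) w) t := by
      intro t ht
      have h2 : HasDerivAt (fun t : ℝ => v₂ + t • w) w t := by
        simpa using ((hasDerivAt_id t).smul_const w).const_add v₂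
      have h3 := ((differentiableAt_dv hG q _ (h0 t ht)).clm_apply
        (differentiableAt_const w)).hasFDerivAt
      exact h3.comp_hasDerivAt t h2
    have := (convex_Icc (0:ℝ) 1).mul_sub_le_image_sub_of_le_deriv
      (f := fun t : ℝ => dvCLM G q (v₂ + t • w) w)
      (fun t ht => (hd t ht).continuousAt.continuousWithinAt)
      (fun t ht => (hd t (interior_subset ht)).differentiableAt.differentiableWithinAt)
      (C := α * ‖w‖ ^ 2)
      (fun t ht => by
        rw [(hd t (interior_subset ht)).deriv]
        exact hG.vv_convex q _ (h0 t (interior_subset ht)) w)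
      0 (by simp) 1 (by simp) zero_le_one
    have e : v₂ + w = v₁ := by rw [hw]; abel
    simpa [e] using this

lemma norm_sub_le (hG : IsFinslerEnergy n G ℓ α) (q v₁ v₂ : Evec n) :
    α * ‖v₁ - v₂‖ ≤ ‖dvCLM G q v₁ - dvCLM G q v₂‖ := by
  have h := (strong_mono hG q v₁ v₂).trans ((le_abs_self _).trans
    ((dvCLM G q v₁ - dvCLM G q v₂).le_opNorm (v₁ - v₂)))
  rcases eq_or_lt_of_le (norm_nonneg (v₁ - v₂)) with h0 | h0
  · rw [← h0]; simp
  · refine le_of_mul_le_mul_right ?_ h0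
    nlinarith

/-- existence of a velocity with given momentum, in Legendre form -/
lemma exists_legendre (hG : IsFinslerEnergy n G ℓ α) (q : Evec n) (P : Evec n →L[ℝ] ℝ) :
    ∃ v : Evec n, (1 / 2 : ℝ) • dvCLM G q v = P ∧
      ∀ w, P w - (1 / 2) * G q w ≤ P v - (1 / 2) * G q v := by
  have hl := hG.one_le_ell
  have hl0 : 0 < ℓ := by linarith
  have hc : Continuous fun w => (1 / 2) * G q w - P w := by
    have : Continuous fun w => G q w := hG.continuous.comp (by fun_prop : Continuous fun w : Evec n => (q, w))
    fun_prop
  have ht : Tendsto (fun w => (1 / 2) * G q w - P w) (cocompact (Evec n)) atTop := by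
    have h1 : ∀ w, (‖w‖ * ((1 / (2 * ℓ)) * ‖w‖ - ‖P‖)) ≤ (1 / 2) * G q w - P w := by
      intro w
      have h1 := hG.lower q w
      have h2 := (le_abs_self _).trans (P.le_opNorm w)
      have h3 : ‖w‖ * ((1 / (2 * ℓ)) * ‖w‖ - ‖P‖) = 1 / 2 * (1 / ℓ * ‖w‖ ^ 2) - ‖P‖ * ‖w‖ := by
        field_simp
      rw [h3]; linarith
    refine tendsto_atTop_mono h1 ?_
    have h4 : Tendsto (fun x : ℝ => x * ((1 / (2 * ℓ)) * x - ‖P‖)) atTop atTop := by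
      refine tendsto_id.atTop_mul_atTop₀ ?_
      refine tendsto_atTop_add_const_right _ (-‖P‖) ?_
      exact tendsto_id.const_mul_atTop (by positivity)
    exact h4.comp (tendsto_norm_cocompact_atTop)
  obtain ⟨v, hv⟩ := hc.exists_forall_le ht
  refine ⟨v, ?_, fun w => by have := hv w; linarith⟩
  have hm : IsLocalMin (fun w => (1 / 2) * G q w - P w) v := Eventually.of_forall hv
  have hd : HasFDerivAt (fun w => (1 / 2) * G q w - P w) ((1 / 2 : ℝ) • dvCLM G q v - P) v :=
    ((hasFDerivAt_dv hG q v).const_mul (1 / 2)).sub P.hasFDerivAt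
  exact sub_eq_zero.1 (hm.hasFDerivAt_eq_zero hd)

end Fins

namespace Fins
open scoped Topology

/-- derivative of the penalization -/
def chi' (δ t : ℝ) : ℝ := 2 * max t 0 * δ / (δ - max t 0) ^ 3

lemma chi_nonneg (δ t : ℝ) : 0 ≤ chi δ t := by
  unfold chi; split_ifs <;> positivity

lemma hasDerivAt_frac {δ t : ℝ} (ht : t < δ) :
    HasDerivAt (fun t => t ^ 2 / (δ - t) ^ 2) (2 * t * δ / (δ - t) ^ 3) t := by
  have h0 : δ - t ≠ 0 := by linarith
  have h1 : HasDerivAt (fun t : ℝ => t ^ 2) (2 * t) t := by simpa using hasDerivAt_pow 2 t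
  have h2 : HasDerivAt (fun t : ℝ => (δ - t) ^ 2) (-(2 * (δ - t))) t := by
    have h := ((hasDerivAt_id t).const_sub δ).fun_pow 2
    simp only [id] at h
    have e : ((2:ℕ):ℝ) * (δ - t) ^ (2 - 1) * -1 = -(2 * (δ - t)) := by norm_num
    rw [← e]; exact h
  have e : 2 * t * δ / (δ - t) ^ 3 =
      (2 * t * (δ - t) ^ 2 - t ^ 2 * -(2 * (δ - t))) / ((δ - t) ^ 2) ^ 2 := by
    rw [div_eq_div_iff (pow_ne_zero 3 h0) (pow_ne_zero 2 (pow_ne_zero 2 h0))]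
    ring
  rw [e]; exact h1.div h2 (pow_ne_zero 2 h0)

lemma hasDerivAt_chi {δ t : ℝ} (hδ : 0 < δ) (ht : t < δ) :
    HasDerivAt (chi δ) (chi' δ t) t := by
  rcases lt_trichotomy t 0 with h | h | h
  · have e : chi δ =ᶠ[𝓝 t] fun _ => 0 := by
      filter_upwards [gt_mem_nhds h] with s hs
      simp [chi, hs.le]
    have : chi' δ t = 0 := by simp [chi', max_eq_right h.le]
    rw [this]
    exact (hasDerivAt_const t (0:ℝ)).congr_of_eventuallyEq e
  · subst h
    have e0 : chi' δ 0 = 0 := by simp [chi']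
    rw [e0]
    have h1 : HasDerivWithinAt (chi δ) 0 (Iic 0) 0 :=
      (hasDerivWithinAt_const (0:ℝ) (Iic 0) (0:ℝ)).congr (fun s hs => by simp [chi, mem_Iic.1 hs])
        (by simp [chi])
    have h2 : HasDerivWithinAt (chi δ) 0 (Ici 0) 0 := by
      have := (hasDerivAt_frac ht).hasDerivWithinAt (s := Ici 0)
      simp only [mul_zero, zero_mul, zero_div] at this
      refine this.congr (fun s hs => ?_) (by simp [chi])
      rcases eq_or_lt_of_le (mem_Ici.1 hs) with h | h
      · rw [← h]; simp [chi]
      · simp [chi, h]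
    have := h1.union h2
    rw [Iic_union_Ici] at this
    rwa [hasDerivWithinAt_univ] at this
  · have e : chi δ =ᶠ[𝓝 t] fun t => t ^ 2 / (δ - t) ^ 2 := by
      filter_upwards [lt_mem_nhds h] with s hs
      simp [chi, hs]
    have : chi' δ t = 2 * t * δ / (δ - t) ^ 3 := by simp [chi', max_eq_left h.le]
    rw [this]
    exact (hasDerivAt_frac ht).congr_of_eventuallyEq e

lemma continuousOn_chi' {δ : ℝ} (hδ : 0 < δ) : ContinuousOn (chi' δ) (Iio δ) := by
  unfold chi'
  refine ContinuousOn.div (by fun_prop) (by fun_prop) fun t ht => ?_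
  have : max t 0 < δ := max_lt ht hδ
  exact pow_ne_zero 3 (by linarith)

variable {n : ℕ}

/-- differential of the penalization term -/
def dX (Φ : Evec n → ℝ) (δ : ℝ) (q : Evec n) : Evec n →L[ℝ] ℝ := chi' δ (Φ q) • fderiv ℝ Φ q

lemma hasFDerivAt_X {Φ : Evec n → ℝ} {δ : ℝ} (hΦ : ContDiff ℝ 2 Φ) (hδ : 0 < δ) {q : Evec n}
    (hq : Φ q < δ) : HasFDerivAt (fun q => chi δ (Φ q)) (dX Φ δ q) q :=
  (hasDerivAt_chi hδ hq).comp_hasFDerivAt q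
    (hΦ.differentiable (by norm_num) q).hasFDerivAt

lemma continuousOn_dX {Φ : Evec n → ℝ} {δ : ℝ} (hΦ : ContDiff ℝ 2 Φ) (hδ : 0 < δ) :
    ContinuousOn (dX Φ δ) (Φ ⁻¹' Iio δ) := by
  have h1 : ContinuousOn (fun q => chi' δ (Φ q)) (Φ ⁻¹' Iio δ) :=
    (continuousOn_chi' hδ).comp hΦ.continuous.continuousOn (fun x hx => hx)
  exact h1.smul (hΦ.continuous_fderiv (by norm_num)).continuousOn

/-- a continuous function touched from below at each point by a function with zero derivative
is constant: monotone half -/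
lemma mono_of_touch {f : ℝ → ℝ} {a b : ℝ} (hf : ContinuousOn f (Icc a b))
    (h : ∀ s ∈ Icc a b, ∃ A : ℝ → ℝ, A s = f s ∧ (∀ t ∈ Icc a b, A t ≤ f t) ∧
      HasDerivWithinAt A 0 (Icc a b) s) : ∀ t ∈ Icc a b, f a ≤ f t := by
  intro t ht
  refine le_of_forall_pos_le_add fun ε hε => ?_
  have hc : ∃ c > 0, c * (t - a) ≤ ε := by
    refine ⟨ε / (t - a + 1), ?_, ?_⟩
    · have := ht.1; apply div_pos hε; linarith
    · have := ht.1
      rw [div_mul_eq_mul_div, div_le_iff₀ (by linarith)]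
      nlinarith
  obtain ⟨c, hc0, hc⟩ := hc
  have := image_le_of_liminf_slope_right_lt_deriv_boundary (f := fun x => - f x) (f' := fun _ => 0)
    (a := a) (b := b) hf.neg ?_ (B := fun x => - f a + c * (x - a)) (B' := fun _ => c) (by simp)
    (fun x => by simpa using (((hasDerivAt_id x).sub_const a).const_mul c).const_add (-f a))
    (fun _ _ _ => hc0) ht
  · linarith
  · intro x hx r hr
    obtain ⟨A, hA1, hA2, hA3⟩ := h x (Ico_subset_Icc_self hx)
    have h1 : HasDerivWithinAt A 0 (Ioi x) x := by
      refine hA3.mono_of_mem_nhdsWithin ?_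
      filter_upwards [Ioo_mem_nhdsGT hx.2] with y hy
      exact ⟨hx.1.trans hy.1.le, hy.2.le⟩
    have h2 := h1.neg
    rw [neg_zero, hasDerivWithinAt_iff_tendsto_slope' (by simp)] at h2
    refine Eventually.frequently ?_
    filter_upwards [h2.eventually (gt_mem_nhds hr), Ioo_mem_nhdsGT hx.2] with y hy1 hy2
    refine lt_of_le_of_lt ?_ hy1
    rw [slope_def_field, slope_def_field]
    have h3 := hA2 y ⟨hx.1.trans hy2.1.le, hy2.2.le⟩
    have h4 : 0 < y - x := by linarith [hy2.1]
    simp only [Pi.neg_apply]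
    rw [hA1]
    gcongr

lemma const_of_touch {f : ℝ → ℝ} {a b : ℝ} (hf : ContinuousOn f (Icc a b))
    (h : ∀ s ∈ Icc a b, ∃ A : ℝ → ℝ, A s = f s ∧ (∀ t ∈ Icc a b, A t ≤ f t) ∧
      HasDerivWithinAt A 0 (Icc a b) s) : ∀ t ∈ Icc a b, f t = f a := by
  intro t ht
  refine le_antisymm ?_ (mono_of_touch hf h t ht)
  have hm : MapsTo (fun x => a + b - x) (Icc a b) (Icc a b) :=
    fun x hx => ⟨by linarith [hx.2], by linarith [hx.1]⟩
  have hm2 : MapsTo (fun x => a + t - x) (Icc a t) (Icc a b) :=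
    fun x hx => ⟨by linarith [hx.2], by linarith [hx.1, ht.2]⟩
  have := mono_of_touch (f := fun x => f (a + t - x)) (a := a) (b := t)
    (hf.comp (by fun_prop) hm2) ?_ t ⟨ht.1, le_rfl⟩
  · simpa using this
  · intro s hs
    obtain ⟨A, hA1, hA2, hA3⟩ := h _ (hm2 hs)
    refine ⟨fun x => A (a + t - x), hA1, fun x hx => hA2 _ (hm2 hx), ?_⟩
    have h1 : HasDerivWithinAt (fun x => a + t - x) (-1) (Icc a t) s :=
      ((hasDerivAt_id s).const_sub (a + t)).hasDerivWithinAt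
    have h2 := hA3.scomp s h1 hm2
    rw [smul_zero] at h2
    exact h2

/-- du Bois-Reymond lemma -/
lemma duBois {a b : ℝ} (hab : a < b) {f u : ℝ → ℝ} (hf : IntegrableOn f (Icc a b))
    (hu : MemLp u 2 (volume.restrict (Icc a b)))
    (H : ∀ g : ℝ → ℝ, MemLp g 2 (volume.restrict (Icc a b)) → ∫ s in a..b, g s = 0 →
      ∫ s in a..b, (f s * (∫ r in a..s, g r) + u s * g s) = 0) :
    ∃ c : ℝ, ∀ᵐ s ∂(volume.restrict (Icc a b)), u s = c + ∫ r in a..s, f r := by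
  set m : ℝ → ℝ := fun s => ∫ r in a..s, f r with hm
  have hIoc : ∀ {h : ℝ → ℝ}, IntegrableOn h (Icc a b) → IntervalIntegrable h volume a b := by
    intro h hh
    rw [intervalIntegrable_iff_integrableOn_Ioc_of_le hab.le]
    exact hh.mono_set Ioc_subset_Icc_self
  have hmc : ContinuousOn m (Icc a b) := by
    have := intervalIntegral.continuousOn_primitive_interval (a := a) (b := b) (f := f) (μ := volume)
      (by rwa [uIcc_of_le hab.le])
    rwa [uIcc_of_le hab.le] at this
  have hmL : MemLp m 2 (volume.restrict (Icc a b)) := by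
    obtain ⟨C, hC⟩ := isCompact_Icc.exists_bound_of_continuousOn hmc
    exact MemLp.of_bound (hmc.aestronglyMeasurable measurableSet_Icc) C
      ((ae_restrict_iff' measurableSet_Icc).2 (Eventually.of_forall hC))
  set c : ℝ := (∫ s in a..b, (u s - m s)) / (b - a) with hc
  set g : ℝ → ℝ := fun s => u s - m s - c with hg
  have hgL : MemLp g 2 (volume.restrict (Icc a b)) := (hu.sub hmL).sub (memLp_const c)
  have hint : ∀ {h : ℝ → ℝ}, MemLp h 2 (volume.restrict (Icc a b)) → IntegrableOn h (Icc a b) :=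
    fun hh => hh.integrable (by norm_num)
  have hmul : ∀ {h k : ℝ → ℝ}, MemLp h 2 (volume.restrict (Icc a b)) →
      MemLp k 2 (volume.restrict (Icc a b)) → IntervalIntegrable (fun s => h s * k s) volume a b :=
    fun hh hk => hIoc (hh.integrable_mul hk)
  have hg0 : ∫ s in a..b, g s = 0 := by
    have h2 : ∫ s in a..b, g s = (∫ s in a..b, (u s - m s)) - ∫ s in a..b, c :=
      intervalIntegral.integral_sub (hIoc (hint (hu.sub hmL))) intervalIntegrable_const
    have h3 : b - a ≠ 0 := sub_ne_zero.2 hab.ne'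
    rw [h2, intervalIntegral.integral_const, hc, smul_eq_mul, mul_div_cancel₀ _ h3, sub_self]
  have h1 := H g hgL hg0
  have hgi := hIoc (hint hgL)
  have hfi := hIoc hf
  set φ : ℝ → ℝ := fun s => ∫ r in a..s, g r with hφ
  have acm := hfi.absolutelyContinuousOnInterval_intervalIntegral (c := a) (by simp)
  have acφ := hgi.absolutelyContinuousOnInterval_intervalIntegral (c := a) (by simp)
  have hparts := acm.integral_deriv_mul_eq_sub acφ
  have hφc := acφ.continuousOn
  have e1 : ∫ s in a..b, (f s * φ s + m s * g s) = 0 := by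
    have : ∫ s in a..b, (f s * φ s + m s * g s) = m b * φ b - m a * φ a := by
      rw [hm, hφ, ← hparts]
      apply intervalIntegral.integral_congr_ae
      filter_upwards [hfi.ae_hasDerivAt_integral, hgi.ae_hasDerivAt_integral] with x hx1 hx2 hx
      have hx' := uIoc_subset_uIcc hx
      rw [(hx1 hx' a (by simp)).deriv, (hx2 hx' a (by simp)).deriv]
    rw [this, hφ, hm]; simp [hg0]
  have hfφ : IntervalIntegrable (fun s => f s * φ s) volume a b := hfi.mul_continuousOn hφc
  rw [intervalIntegral.integral_add hfφ (hmul hmL hgL)] at e1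
  rw [intervalIntegral.integral_add hfφ (hmul hu hgL)] at h1
  have e2 : ∫ s in a..b, g s * g s = 0 := by
    have : ∀ s, g s * g s = u s * g s - m s * g s - c * g s := by intro s; simp only [hg]; ring
    simp_rw [this]
    rw [intervalIntegral.integral_sub ((hmul hu hgL).sub (hmul hmL hgL)) (hgi.const_mul c),
      intervalIntegral.integral_sub (hmul hu hgL) (hmul hmL hgL), intervalIntegral.integral_const_mul, hg0]
    linarith
  rw [intervalIntegral.integral_of_le hab.le, ← integral_Icc_eq_integral_Ioc] at e2
  rw [integral_eq_zero_iff_of_nonneg (fun s => mul_self_nonneg _) (hgL.integrable_mul hgL)] at e2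
  refine ⟨c, ?_⟩
  filter_upwards [e2] with s hs
  have : g s = 0 := by simpa using hs
  simp only [hg] at this
  linarith

end Fins

namespace Fins
open scoped Topology
variable {n : ℕ} {G : Evec n → Evec n → ℝ} {ℓ α : ℝ} {a b : ℝ}

lemma memLp_deriv (γ : H1Curve n a b) : MemLp γ.deriv 2 (volume.restrict (Icc a b)) :=
  (memLp_two_iff_integrable_sq_norm γ.deriv_integrable.aestronglyMeasurable).2
    γ.deriv_sq_integrable

lemma continuousOn_prim {E : Type*} [NormedAddCommGroup E] [NormedSpace ℝ E] (hab : a ≤ b)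
    {f : ℝ → E} (hf : IntegrableOn f (Icc a b)) :
    ContinuousOn (fun t => ∫ s in a..t, f s) (Icc a b) := by
  have := intervalIntegral.continuousOn_primitive_interval (a := a) (b := b) (f := f) (μ := volume)
      (by rwa [uIcc_of_le hab])
  rwa [uIcc_of_le hab] at this

lemma continuousOn_curve (hab : a ≤ b) (γ : H1Curve n a b) : ContinuousOn γ.toFun (Icc a b) :=
  ((continuousOn_prim hab γ.deriv_integrable).const_add (γ.toFun a)).congr
    fun t ht => γ.eq_add_integral t ht

/-- varied curve -/
def vary (γ : H1Curve n a b) (g : ℝ → ℝ) (hg : MemLp g 2 (volume.restrict (Icc a b)))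
    (w : Evec n) (ε : ℝ) : H1Curve n a b where
  toFun t := γ.toFun t + ε • ((∫ s in a..t, g s) • w)
  deriv s := γ.deriv s + ε • (g s • w)
  deriv_integrable := γ.deriv_integrable.add
    (((hg.integrable (by norm_num)).smul_const w).smul ε)
  deriv_sq_integrable := by
    have h1 : MemLp (fun s => g s • w) 2 (volume.restrict (Icc a b)) := by
      have := hg.norm
      refine MemLp.of_le_mul (c := ‖w‖) hg (hg.aestronglyMeasurable.smul_const w) ?_
      filter_upwards with s
      rw [norm_smul, mul_comm]
    have h2 : MemLp (fun s => γ.deriv s + ε • (g s • w)) 2 (volume.restrict (Icc a b)) :=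
      (memLp_deriv γ).add (h1.const_smul ε)
    exact (memLp_two_iff_integrable_sq_norm h2.aestronglyMeasurable).1 h2
  eq_add_integral := by
    intro t ht
    have hsub : uIoc a t ⊆ Icc a b := by
      rw [uIoc_of_le ht.1]; exact fun x hx => ⟨hx.1.le, hx.2.trans ht.2⟩
    have i1 : IntervalIntegrable γ.deriv volume a t := by
      rw [intervalIntegrable_iff]; exact γ.deriv_integrable.mono_set hsub
    have i2 : IntervalIntegrable g volume a t := by
      rw [intervalIntegrable_iff]
      exact (show IntegrableOn g (Icc a b) volume from
        MemLp.integrable (q := 2) (by norm_num) hg).mono_set hsub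
    have i3 : IntervalIntegrable (fun s => g s • w) volume a t := by
      rw [intervalIntegrable_iff] at i2 ⊢
      exact Integrable.smul_const i2 w
    rw [intervalIntegral.integral_add (g := fun s => ε • g s • w) i1 (i3.smul ε), γ.eq_add_integral t ht,
      intervalIntegral.integral_smul, intervalIntegral.integral_smul_const]
    simp [add_assoc]

lemma aesm_fderiv (hG : IsFinslerEnergy n G ℓ α) {μ : Measure ℝ} {x xd : ℝ → Evec n}
    (hx : AEStronglyMeasurable x μ) (hxd : AEStronglyMeasurable xd μ) :
    AEStronglyMeasurable (fun s => fderiv ℝ (Gp G) (x s, xd s)) μ := by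
  have h := measurable_fderiv ℝ (Gp G)
  have h2 : AEMeasurable (fun s => (x s, xd s)) μ := (hx.prodMk hxd).aemeasurable
  exact (h.comp_aemeasurable h2).aestronglyMeasurable

lemma aesm_dq (hG : IsFinslerEnergy n G ℓ α) {μ : Measure ℝ} {x xd : ℝ → Evec n}
    (hx : AEStronglyMeasurable x μ) (hxd : AEStronglyMeasurable xd μ) :
    AEStronglyMeasurable (fun s => dqCLM G (x s) (xd s)) μ := by
  simp_rw [dq_eq hG]
  have hc : Continuous fun L : (Evec n × Evec n →L[ℝ] ℝ) =>
    L.comp (ContinuousLinearMap.inl ℝ (Evec n) (Evec n)) := by fun_prop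
  exact hc.comp_aestronglyMeasurable (aesm_fderiv hG hx hxd)

lemma aesm_dv (hG : IsFinslerEnergy n G ℓ α) {μ : Measure ℝ} {x xd : ℝ → Evec n}
    (hx : AEStronglyMeasurable x μ) (hxd : AEStronglyMeasurable xd μ) :
    AEStronglyMeasurable (fun s => dvCLM G (x s) (xd s)) μ := by
  simp_rw [dv_eq hG]
  have hc : Continuous fun L : (Evec n × Evec n →L[ℝ] ℝ) =>
    L.comp (ContinuousLinearMap.inr ℝ (Evec n) (Evec n)) := by fun_prop
  exact hc.comp_aestronglyMeasurable (aesm_fderiv hG hx hxd)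

lemma integrable_dq (hG : IsFinslerEnergy n G ℓ α) {μ : Measure ℝ} [IsFiniteMeasure μ]
    {x xd : ℝ → Evec n} (hx : AEStronglyMeasurable x μ) (hxd : MemLp xd 2 μ) :
    Integrable (fun s => dqCLM G (x s) (xd s)) μ := by
  have h1 := ((memLp_two_iff_integrable_sq_norm hxd.aestronglyMeasurable).1 hxd).const_mul ℓ
  exact h1.mono' (aesm_dq hG hx hxd.aestronglyMeasurable)
    (Eventually.of_forall fun s => dq_norm hG _ _)

lemma memLp_dv (hG : IsFinslerEnergy n G ℓ α) {μ : Measure ℝ} [IsFiniteMeasure μ]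
    {x xd : ℝ → Evec n} (hx : AEStronglyMeasurable x μ) (hxd : MemLp xd 2 μ) (w : Evec n) :
    MemLp (fun s => dvCLM G (x s) (xd s) w) 2 μ := by
  have hl := hG.one_le_ell
  have h0 : MemLp (fun s => (1:ℝ) + ‖xd s‖) 2 μ := (memLp_const (1:ℝ)).add hxd.norm
  have h1 : MemLp (fun s => ℓ * ‖w‖ * (1 + ‖xd s‖)) 2 μ := h0.const_mul (ℓ * ‖w‖)
  have h2 : AEStronglyMeasurable (fun s => dvCLM G (x s) (xd s) w) μ := by
    have hc : Continuous fun L : (Evec n →L[ℝ] ℝ) => L w := by fun_prop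
    exact hc.comp_aestronglyMeasurable (aesm_dv hG hx hxd.aestronglyMeasurable)
  refine MemLp.mono' (f := fun s => dvCLM G (x s) (xd s) w) h1 h2
    (Eventually.of_forall fun s => ?_)
  · refine (ContinuousLinearMap.le_opNorm _ _).trans ?_
    have := mul_le_mul_of_nonneg_right (hG.dv_bound (x s) (xd s)) (norm_nonneg w)
    linarith

lemma aesm_G (hG : IsFinslerEnergy n G ℓ α) {μ : Measure ℝ} {x xd : ℝ → Evec n}
    (hx : AEStronglyMeasurable x μ) (hxd : AEStronglyMeasurable xd μ) :
    AEStronglyMeasurable (fun s => G (x s) (xd s)) μ :=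
  hG.continuous.comp_aestronglyMeasurable (hx.prodMk hxd)

lemma integrable_G (hG : IsFinslerEnergy n G ℓ α) {μ : Measure ℝ}
    {x xd : ℝ → Evec n} (hx : AEStronglyMeasurable x μ) (hxd : MemLp xd 2 μ) :
    Integrable (fun s => G (x s) (xd s)) μ := by
  have h1 := ((memLp_two_iff_integrable_sq_norm hxd.aestronglyMeasurable).1 hxd).const_mul ℓ
  refine h1.mono' (aesm_G hG hx hxd.aestronglyMeasurable) (Eventually.of_forall fun s => ?_)
  rw [Real.norm_of_nonneg (nonneg hG _ _)]
  exact hG.upper _ _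

lemma firstVar_G (hG : IsFinslerEnergy n G ℓ α) {μ : Measure ℝ} [IsFiniteMeasure μ]
    {x xd η ηd : ℝ → Evec n} (hx : AEStronglyMeasurable x μ) (hxd : MemLp xd 2 μ)
    (hη : AEStronglyMeasurable η μ) {C : ℝ} (hC : ∀ᵐ s ∂μ, ‖η s‖ ≤ C) (hηd : MemLp ηd 2 μ) :
    Integrable (fun s => dqCLM G (x s) (xd s) (η s) + dvCLM G (x s) (xd s) (ηd s)) μ ∧
    HasDerivAt (fun ε : ℝ => ∫ s, G (x s + ε • η s) (xd s + ε • ηd s) ∂μ)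
      (∫ s, (dqCLM G (x s) (xd s) (η s) + dvCLM G (x s) (xd s) (ηd s)) ∂μ) 0 := by
  have hl := hG.one_le_ell
  have hN : MemLp (fun s => ‖xd s‖ + ‖ηd s‖) 2 μ := hxd.norm.add hηd.norm
  have hN1 : Integrable (fun s => ‖xd s‖ + ‖ηd s‖) μ := hN.integrable (by norm_num)
  have hN2 : Integrable (fun s => (‖xd s‖ + ‖ηd s‖) ^ 2) μ := hN.integrable_sq
  have key := hasDerivAt_integral_of_dominated_loc_of_deriv_le (μ := μ) (𝕜 := ℝ)
    (s := Metric.ball (0:ℝ) 1) (x₀ := 0)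
    (F := fun ε s => G (x s + ε • η s) (xd s + ε • ηd s))
    (F' := fun ε s => dqCLM G (x s + ε • η s) (xd s + ε • ηd s) (η s) +
      dvCLM G (x s + ε • η s) (xd s + ε • ηd s) (ηd s))
    (bound := fun s => ℓ * (1 + (‖xd s‖ + ‖ηd s‖) ^ 2) * C +
      ℓ * ((‖xd s‖ + ‖ηd s‖) + (‖xd s‖ + ‖ηd s‖) ^ 2))
    (Metric.ball_mem_nhds _ one_pos)
    (Eventually.of_forall fun ε => aesm_G hG (hx.add (hη.const_smul ε))
      (hxd.aestronglyMeasurable.add (hηd.aestronglyMeasurable.const_smul ε)))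
    (by simpa using integrable_G hG hx hxd)
    ?_ ?_ ?_ ?_
  · simpa using key
  · simp only [zero_smul, add_zero]
    have hc : Continuous fun p : (Evec n →L[ℝ] ℝ) × Evec n => p.1 p.2 := by fun_prop
    exact (hc.comp_aestronglyMeasurable ((aesm_dq hG hx hxd.aestronglyMeasurable).prodMk hη)).add
      (hc.comp_aestronglyMeasurable ((aesm_dv hG hx hxd.aestronglyMeasurable).prodMk
        hηd.aestronglyMeasurable))
  · filter_upwards [hC] with s hs ε hε
    have hε1 : ‖ε‖ ≤ 1 := by simpa using (mem_ball_zero_iff.1 hε).le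
    have hv : ‖xd s + ε • ηd s‖ ≤ ‖xd s‖ + ‖ηd s‖ := by
      refine (norm_add_le _ _).trans ?_
      rw [norm_smul]
      have := mul_le_mul_of_nonneg_right hε1 (norm_nonneg (ηd s))
      linarith
    set N := ‖xd s‖ + ‖ηd s‖ with hNdef
    have hN0 : 0 ≤ N := by positivity
    have hηN : ‖ηd s‖ ≤ N := by rw [hNdef]; linarith [norm_nonneg (xd s)]
    refine (norm_add_le _ _).trans (add_le_add ?_ ?_)
    · refine (ContinuousLinearMap.le_opNorm _ _).trans ?_
      have h1 := hG.dq_bound (x s + ε • η s) (xd s + ε • ηd s)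
      have h2 : ‖dqCLM G (x s + ε • η s) (xd s + ε • ηd s)‖ ≤ ℓ * (1 + N ^ 2) := by
        refine h1.trans ?_
        gcongr
      exact mul_le_mul h2 hs (norm_nonneg _) (by positivity)
    · refine (ContinuousLinearMap.le_opNorm _ _).trans ?_
      have h1 := hG.dv_bound (x s + ε • η s) (xd s + ε • ηd s)
      have h2 : ‖dvCLM G (x s + ε • η s) (xd s + ε • ηd s)‖ ≤ ℓ * (1 + N) := by
        refine h1.trans ?_
        gcongr
      refine (mul_le_mul h2 hηN (norm_nonneg _) (by positivity)).trans (le_of_eq ?_)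
      ring
  · exact ((((integrable_const (1:ℝ)).add hN2).const_mul ℓ).mul_const C).add
      ((hN1.add hN2).const_mul ℓ)
  · filter_upwards with s ε _
    have h1 : HasDerivAt (fun ε : ℝ => (x s + ε • η s, xd s + ε • ηd s)) (η s, ηd s) ε := by
      have e1 : HasDerivAt (fun ε : ℝ => x s + ε • η s) (η s) ε := by
        simpa using ((hasDerivAt_id ε).smul_const (η s)).const_add (x s)
      have e2 : HasDerivAt (fun ε : ℝ => xd s + ε • ηd s) (ηd s) ε := by
        simpa using ((hasDerivAt_id ε).smul_const (ηd s)).const_add (xd s)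
      exact e1.prodMk e2
    have h2 := (hasFDerivAt_Gp hG (x s + ε • η s) (xd s + ε • ηd s)).comp_hasDerivAt ε h1
    exact h2

/-- A tube around the curve stays in the domain. -/
lemma firstVar_X {Φ : Evec n → ℝ} {δ : ℝ} (hΦ : ContDiff ℝ 2 Φ) (hδ : 0 < δ)
    {x η : ℝ → Evec n} (hx : ContinuousOn x (Icc a b)) (hη : ContinuousOn η (Icc a b))
    (hxδ : ∀ s ∈ Icc a b, Φ (x s) < δ) :
    (∀ᶠ ε : ℝ in 𝓝 0, ∀ s ∈ Icc a b, Φ (x s + ε • η s) < δ) ∧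
    HasDerivAt (fun ε : ℝ => ∫ s in Icc a b, chi δ (Φ (x s + ε • η s)))
      (∫ s in Icc a b, dX Φ δ (x s) (η s)) 0 := by
  have hU : IsOpen (Φ ⁻¹' Iio δ) := isOpen_Iio.preimage hΦ.continuous
  have hK : IsCompact (x '' Icc a b) := isCompact_Icc.image_of_continuousOn hx
  obtain ⟨r, hr, hrU⟩ := hK.exists_cthickening_subset_open hU
    (by rintro _ ⟨s, hs, rfl⟩; exact hxδ s hs)
  obtain ⟨C, hC⟩ := isCompact_Icc.exists_bound_of_continuousOn hη
  obtain ⟨D, hD⟩ := hK.cthickening (r := r) |>.exists_bound_of_continuousOn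
    ((continuousOn_dX hΦ hδ).mono hrU)
  set C' := max C 0 with hC'
  have hC'0 : 0 ≤ C' := le_max_right _ _
  set ρ := r / (C' + 1) with hρ
  have hρ0 : 0 < ρ := by positivity
  have tube : ∀ ε ∈ Metric.ball (0:ℝ) ρ, ∀ s ∈ Icc a b,
      x s + ε • η s ∈ Metric.cthickening r (x '' Icc a b) := by
    intro ε hε s hs
    refine Metric.mem_cthickening_of_dist_le _ (x s) r _ (mem_image_of_mem x hs) ?_
    rw [dist_eq_norm, add_sub_cancel_left, norm_smul]
    have h1 : ‖ε‖ ≤ ρ := (mem_ball_zero_iff.1 hε).le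
    have h2 : ‖η s‖ ≤ C' + 1 := (hC s hs).trans ((le_max_left _ _).trans (by linarith))
    calc ‖ε‖ * ‖η s‖ ≤ ρ * (C' + 1) := mul_le_mul h1 h2 (norm_nonneg _) hρ0.le
      _ = r := by rw [hρ]; field_simp
  have hXc : ContinuousOn (fun q => chi δ (Φ q)) (Φ ⁻¹' Iio δ) :=
    fun q hq => (hasFDerivAt_X hΦ hδ hq).continuousAt.continuousWithinAt
  refine ⟨?_, ?_⟩
  · filter_upwards [Metric.ball_mem_nhds (0:ℝ) hρ0] with ε hε s hs
    exact hrU (tube ε hε s hs)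
  have key := hasDerivAt_integral_of_dominated_loc_of_deriv_le
    (μ := volume.restrict (Icc a b)) (𝕜 := ℝ)
    (s := Metric.ball (0:ℝ) ρ) (x₀ := 0)
    (F := fun ε s => chi δ (Φ (x s + ε • η s)))
    (F' := fun ε s => dX Φ δ (x s + ε • η s) (η s))
    (bound := fun s => D * C')
    (Metric.ball_mem_nhds _ hρ0)
    ?_ ?_ ?_ ?_ ?_ ?_
  · simpa using key.2
  · filter_upwards [Metric.ball_mem_nhds (0:ℝ) hρ0] with ε hε
    refine ContinuousOn.aestronglyMeasurable ?_ measurableSet_Icc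
    exact hXc.comp (hx.add (hη.const_smul ε)) (fun s hs => hrU (tube ε hε s hs))
  · refine ContinuousOn.integrableOn_Icc ?_
    simp only [zero_smul, add_zero]
    exact hXc.comp hx hxδ
  · simp only [zero_smul, add_zero]
    refine ContinuousOn.aestronglyMeasurable ?_ measurableSet_Icc
    exact ((continuousOn_dX hΦ hδ).comp hx hxδ).clm_apply hη
  · refine (ae_restrict_iff' measurableSet_Icc).2 (Eventually.of_forall fun s hs ε hε => ?_)
    refine (ContinuousLinearMap.le_opNorm _ _).trans ?_
    have h1 := hD _ (tube ε hε s hs)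
    exact mul_le_mul h1 ((hC s hs).trans (le_max_left _ _)) (norm_nonneg _)
      ((norm_nonneg _).trans h1)
  · exact integrable_const _
  · refine (ae_restrict_iff' measurableSet_Icc).2 (Eventually.of_forall fun s hs ε hε => ?_)
    have e1 : HasDerivAt (fun ε : ℝ => x s + ε • η s) (η s) ε := by
      simpa using ((hasDerivAt_id ε).smul_const (η s)).const_add (x s)
    exact (hasFDerivAt_X hΦ hδ (hrU (tube ε hε s hs))).comp_hasDerivAt ε e1

end Fins

namespace Fins
open scoped Topology
variable {n : ℕ} {G : Evec n → Evec n → ℝ} {ℓ α : ℝ} {a b : ℝ}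

lemma ii_Icc {E : Type*} [NormedAddCommGroup E] [NormedSpace ℝ E] (hab : a ≤ b) (f : ℝ → E) :
    ∫ s in a..b, f s = ∫ s in Icc a b, f s := by
  rw [intervalIntegral.integral_of_le hab, ← integral_Icc_eq_integral_Ioc]

/-- weak Euler-Lagrange equation -/
lemma weakEL (hG : IsFinslerEnergy n G ℓ α) {Φ : Evec n → ℝ} {δ : ℝ} (hΦ : ContDiff ℝ 2 Φ)
    (hδ : 0 < δ) (hab : a < b) {p q : Evec n} (γ : H1Curve n a b) (hγ : MemC Φ δ a b p q γ)
    (hmin : ∀ y : H1Curve n a b, MemC Φ δ a b p q y → Jpen G Φ δ a b γ ≤ Jpen G Φ δ a b y)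
    (w : Evec n) (g : ℝ → ℝ) (hg : MemLp g 2 (volume.restrict (Icc a b)))
    (hg0 : ∫ s in a..b, g s = 0) :
    ∫ s in a..b, ((((1 / 2 : ℝ) • dqCLM G (γ.toFun s) (γ.deriv s) + dX Φ δ (γ.toFun s)) w) *
      (∫ r in a..s, g r) + ((1 / 2) * dvCLM G (γ.toFun s) (γ.deriv s) w) * g s) = 0 := by
  have hgi : IntegrableOn g (Icc a b) := hg.integrable (by norm_num)
  have hφ := continuousOn_prim hab.le hgi
  set φ : ℝ → ℝ := fun s => ∫ r in a..s, g r with hφdef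
  have hx := continuousOn_curve hab.le γ
  have hη : ContinuousOn (fun s => φ s • w) (Icc a b) := hφ.smul continuousOn_const
  obtain ⟨C, hC⟩ := isCompact_Icc.exists_bound_of_continuousOn hη
  have hηd : MemLp (fun s => g s • w) 2 (volume.restrict (Icc a b)) := by
    refine MemLp.of_le_mul (c := ‖w‖) hg (hg.aestronglyMeasurable.smul_const w) ?_
    filter_upwards with s
    rw [norm_smul, mul_comm]
  obtain ⟨hAi, hA⟩ := firstVar_G hG (hx.aestronglyMeasurable measurableSet_Icc) (memLp_deriv γ)
    (hη.aestronglyMeasurable measurableSet_Icc)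
    ((ae_restrict_iff' measurableSet_Icc).2 (Eventually.of_forall hC)) hηd
  obtain ⟨hev, hB⟩ := firstVar_X hΦ hδ hx hη hγ.1
  have hJ := (hA.const_mul (1 / 2)).add hB
  have hJeq : ∀ ε : ℝ, Jpen G Φ δ a b (vary γ g hg w ε) =
      (1 / 2) * (∫ s in Icc a b, G (γ.toFun s + ε • φ s • w) (γ.deriv s + ε • g s • w)) +
        ∫ s in Icc a b, chi δ (Φ (γ.toFun s + ε • φ s • w)) := by
    intro ε
    rw [Jpen, ii_Icc hab.le, ii_Icc hab.le]; rfl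
  have hJ0 : Jpen G Φ δ a b γ = Jpen G Φ δ a b (vary γ g hg w 0) := by
    simp [Jpen, vary]
  have hloc : IsLocalMin (fun ε : ℝ =>
      (1 / 2) * (∫ s in Icc a b, G (γ.toFun s + ε • φ s • w) (γ.deriv s + ε • g s • w)) +
        ∫ s in Icc a b, chi δ (Φ (γ.toFun s + ε • φ s • w))) 0 := by
    filter_upwards [hev] with ε hε
    rw [← hJeq, ← hJeq, ← hJ0]
    refine hmin _ ⟨hε, ?_, ?_⟩
    · simp [vary, hγ.2.1]
    · simp [vary, hγ.2.2, hg0]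
  have h0 := hloc.hasDerivAt_eq_zero hJ
  have hBi : IntegrableOn (fun s => dX Φ δ (γ.toFun s) (φ s • w)) (Icc a b) :=
    (((continuousOn_dX hΦ hδ).comp hx hγ.1).clm_apply hη).integrableOn_Icc
  rw [ii_Icc hab.le, ← h0, ← integral_const_mul, ← integral_add (hAi.const_mul (1 / 2)) hBi]
  refine integral_congr_ae (Eventually.of_forall fun s => ?_)
  simp
  ring

/-- Du Bois-Reymond form of the Euler-Lagrange equation -/
lemma strongEL (hG : IsFinslerEnergy n G ℓ α) {Φ : Evec n → ℝ} {δ : ℝ} (hΦ : ContDiff ℝ 2 Φ)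
    (hδ : 0 < δ) (hab : a < b) {p q : Evec n} (γ : H1Curve n a b) (hγ : MemC Φ δ a b p q γ)
    (hmin : ∀ y : H1Curve n a b, MemC Φ δ a b p q y → Jpen G Φ δ a b γ ≤ Jpen G Φ δ a b y) :
    IntegrableOn (fun s => (1 / 2 : ℝ) • dqCLM G (γ.toFun s) (γ.deriv s) + dX Φ δ (γ.toFun s))
      (Icc a b) ∧
    ∃ c : Evec n →L[ℝ] ℝ, ∀ᵐ s ∂(volume.restrict (Icc a b)),
      (1 / 2 : ℝ) • dvCLM G (γ.toFun s) (γ.deriv s) = c +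
        ∫ r in a..s, ((1 / 2 : ℝ) • dqCLM G (γ.toFun r) (γ.deriv r) + dX Φ δ (γ.toFun r)) := by
  have hx := continuousOn_curve hab.le γ
  have hxm := hx.aestronglyMeasurable (μ := volume) measurableSet_Icc
  have hFi : IntegrableOn (fun s => (1 / 2 : ℝ) • dqCLM G (γ.toFun s) (γ.deriv s) +
      dX Φ δ (γ.toFun s)) (Icc a b) := by
    have h1 : IntegrableOn (fun s => (1 / 2 : ℝ) • dqCLM G (γ.toFun s) (γ.deriv s)) (Icc a b) :=
      (integrable_dq hG hxm (memLp_deriv γ)).smul (1 / 2 : ℝ)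
    exact h1.add (((continuousOn_dX hΦ hδ).comp hx hγ.1).integrableOn_Icc)
  refine ⟨hFi, ?_⟩
  set F : ℝ → (Evec n →L[ℝ] ℝ) := fun s => (1 / 2 : ℝ) • dqCLM G (γ.toFun s) (γ.deriv s) +
      dX Φ δ (γ.toFun s) with hF
  have hw : ∀ w : Evec n, ∃ c : ℝ, ∀ᵐ s ∂(volume.restrict (Icc a b)),
      (1 / 2) * dvCLM G (γ.toFun s) (γ.deriv s) w = c + ∫ r in a..s, F r w := by
    intro w
    refine duBois hab (f := fun s => F s w)
      (u := fun s => (1 / 2) * dvCLM G (γ.toFun s) (γ.deriv s) w) ?_ ?_ ?_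
    · exact ContinuousLinearMap.integrable_comp (ContinuousLinearMap.apply ℝ ℝ w) hFi
    · exact (memLp_dv hG hxm (memLp_deriv γ) w).const_mul (1 / 2)
    · intro g hg hg0
      exact weakEL hG hΦ hδ hab γ hγ hmin w g hg hg0
  choose c hc using fun i : Fin n => hw (EuclideanSpace.basisFun (Fin n) ℝ i)
  refine ⟨∑ i, c i • EuclideanSpace.proj i, ?_⟩
  have hall := ae_all_iff.2 hc
  filter_upwards [hall, ae_restrict_mem measurableSet_Icc] with s hs hsI
  have hFs : IntervalIntegrable F volume a s := by
    rw [intervalIntegrable_iff, uIoc_of_le hsI.1]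
    exact hFi.mono_set (fun x hx => ⟨hx.1.le, hx.2.trans hsI.2⟩)
  have hlin : ((1 / 2 : ℝ) • dvCLM G (γ.toFun s) (γ.deriv s)).toLinearMap =
      (∑ i, c i • EuclideanSpace.proj i + ∫ r in a..s, F r : Evec n →L[ℝ] ℝ).toLinearMap := by
    refine (EuclideanSpace.basisFun (Fin n) ℝ).toBasis.ext fun i => ?_
    have := hs i
    simp only [OrthonormalBasis.coe_toBasis, ContinuousLinearMap.coe_coe]
    rw [ContinuousLinearMap.smul_apply, smul_eq_mul, this, ContinuousLinearMap.add_apply,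
      ContinuousLinearMap.intervalIntegral_apply hFs]
    congr 1
    simp [ContinuousLinearMap.sum_apply, Finset.sum_apply, EuclideanSpace.basisFun_apply, Pi.single_apply]
  ext1 v
  exact congrArg (fun L => L v) hlin

end Fins

namespace Fins
open scoped Topology
variable {n : ℕ} {G : Evec n → Evec n → ℝ} {ℓ α : ℝ} {a b : ℝ}

lemma hasDerivWithinAt_prim {E : Type*} [NormedAddCommGroup E] [NormedSpace ℝ E] [CompleteSpace E]
    (hab : a ≤ b) {f y : ℝ → E} (hf : ContinuousOn f (Icc a b))
    (hy : ∀ t ∈ Icc a b, y t = y a + ∫ s in a..t, f s) {s : ℝ} (hs : s ∈ Icc a b) :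
    HasDerivWithinAt y (f s) (Icc a b) s := by
  set f' : ℝ → E := IccExtend hab ((Icc a b).restrict f) with hf'
  have hc : Continuous f' := (continuousOn_iff_continuous_restrict.1 hf).Icc_extend'
  have he : ∀ t ∈ Icc a b, f' t = f t := fun t ht => by
    rw [hf', IccExtend_of_mem hab _ ht]; rfl
  have h1 : HasDerivAt (fun t => y a + ∫ s in a..t, f' s) (f' s) s :=
    (hc.integral_hasStrictDerivAt a s).hasDerivAt.const_add (y a)
  rw [he s hs] at h1
  have h2 : ∀ t ∈ Icc a b, y t = y a + ∫ s in a..t, f' s := by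
    intro t ht
    rw [hy t ht]
    congr 1
    refine intervalIntegral.integral_congr fun r hr => ?_
    rw [uIcc_of_le ht.1] at hr
    exact (he r ⟨hr.1, hr.2.trans ht.2⟩).symm
  exact h1.hasDerivWithinAt.congr h2 (h2 s hs)

lemma main (hG : IsFinslerEnergy n G ℓ α) {Φ : Evec n → ℝ} {δ : ℝ} (hΦ : ContDiff ℝ 2 Φ)
    (hδ : 0 < δ) (hab : a < b) {p q : Evec n} (γ : H1Curve n a b) (hγ : MemC Φ δ a b p q γ)
    (hmin : ∀ y : H1Curve n a b, MemC Φ δ a b p q y → Jpen G Φ δ a b γ ≤ Jpen G Φ δ a b y) :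
    ∃ v : ℝ → Evec n,
        ContinuousOn v (Icc a b) ∧
        (∀ t ∈ Icc a b, γ.toFun t = γ.toFun a + ∫ s in a..t, v s) ∧
        ∀ s ∈ Icc a b,
          (1 / 2) * G (γ.toFun s) (v s) ≤
            Jpen G Φ δ a b γ / (b - a) + chi δ (Φ (γ.toFun s)) := by
  obtain ⟨hFi, c, hc⟩ := strongEL hG hΦ hδ hab γ hγ hmin
  have hα := hG.alpha_pos
  have hx := continuousOn_curve hab.le γ
  set F : ℝ → (Evec n →L[ℝ] ℝ) := fun s => (1 / 2 : ℝ) • dqCLM G (γ.toFun s) (γ.deriv s) +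
      dX Φ δ (γ.toFun s) with hF
  set P : ℝ → (Evec n →L[ℝ] ℝ) := fun t => c + ∫ r in a..t, F r with hP
  have hPc : ContinuousOn P (Icc a b) := (continuousOn_prim hab.le hFi).const_add c
  choose v hv1 hv2 using fun t => exists_legendre hG (γ.toFun t) (P t)
  have hv1' : ∀ t, dvCLM G (γ.toFun t) (v t) = (2:ℝ) • P t := fun t => by
    rw [← hv1 t, smul_smul]; norm_num
  -- continuity of the velocity
  have hvc : ContinuousOn v (Icc a b) := by
    intro t₀ ht₀
    rw [ContinuousWithinAt, tendsto_iff_norm_sub_tendsto_zero]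
    have hb : ∀ t, ‖v t - v t₀‖ ≤
        α⁻¹ * ‖(2:ℝ) • P t - dvCLM G (γ.toFun t) (v t₀)‖ := by
      intro t
      have := norm_sub_le hG (γ.toFun t) (v t) (v t₀)
      rw [hv1' t] at this
      rw [← div_eq_inv_mul, le_div_iff₀ hα]
      linarith
    refine squeeze_zero (fun t => norm_nonneg _) hb ?_
    have h1 : ContinuousWithinAt (fun t => α⁻¹ * ‖(2:ℝ) • P t - dvCLM G (γ.toFun t) (v t₀)‖)
        (Icc a b) t₀ := by
      have h2 : ContinuousWithinAt (fun t => dvCLM G (γ.toFun t) (v t₀)) (Icc a b) t₀ :=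
        (continuous_dv_left hG (v t₀)).continuousAt.comp_continuousWithinAt (hx t₀ ht₀)
      exact (((hPc t₀ ht₀).const_smul (2:ℝ)).sub h2).norm.const_mul α⁻¹
    have h3 := h1.tendsto
    rw [hv1' t₀, sub_self, norm_zero, mul_zero] at h3
    exact h3
  -- a.e. equality
  have hae : ∀ᵐ s ∂(volume.restrict (Icc a b)), γ.deriv s = v s := by
    filter_upwards [hc] with s hs
    have h1 := norm_sub_le hG (γ.toFun s) (γ.deriv s) (v s)
    have h2 : dvCLM G (γ.toFun s) (γ.deriv s) = (2:ℝ) • P s := by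
      rw [hP]; simp only; rw [← hs, smul_smul]; norm_num
    rw [h2, hv1' s, sub_self, norm_zero] at h1
    have h3 : ‖γ.deriv s - v s‖ ≤ 0 := by nlinarith [norm_nonneg (γ.deriv s - v s)]
    exact sub_eq_zero.1 (norm_le_zero_iff.1 h3)
  have hcongr : ∀ {E : Type} [NormedAddCommGroup E] [NormedSpace ℝ E] (H : ℝ → Evec n → E),
      ∀ t ∈ Icc a b, ∫ s in a..t, H s (γ.deriv s) = ∫ s in a..t, H s (v s) := by
    intro E _ _ H t ht
    refine intervalIntegral.integral_congr_ae ?_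
    rw [ae_restrict_iff' measurableSet_Icc] at hae
    filter_upwards [hae] with s hs hs2
    rw [uIoc_of_le ht.1] at hs2
    rw [hs ⟨hs2.1.le, hs2.2.trans ht.2⟩]
  have hγv : ∀ t ∈ Icc a b, γ.toFun t = γ.toFun a + ∫ s in a..t, v s := by
    intro t ht
    rw [γ.eq_add_integral t ht, hcongr (fun _ w => w) t ht]
  set F2 : ℝ → (Evec n →L[ℝ] ℝ) := fun s => (1 / 2 : ℝ) • dqCLM G (γ.toFun s) (v s) +
      dX Φ δ (γ.toFun s) with hF2
  have hF2c : ContinuousOn F2 (Icc a b) := by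
    have h1 : ContinuousOn (fun s => dqCLM G (γ.toFun s) (v s)) (Icc a b) :=
      (continuous_dq hG).comp_continuousOn (hx.prodMk hvc)
    exact (h1.const_smul (1 / 2 : ℝ)).add ((continuousOn_dX hΦ hδ).comp hx hγ.1)
  have hPF2 : ∀ t ∈ Icc a b, P t = P a + ∫ s in a..t, F2 s := by
    intro t ht
    have e : P a = c := by simp [hP]
    rw [e, ← hcongr (fun s w => (1 / 2 : ℝ) • dqCLM G (γ.toFun s) w + dX Φ δ (γ.toFun s)) t ht]
  have hXc : ContinuousOn (fun s => chi δ (Φ (γ.toFun s))) (Icc a b) := by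
    have : ContinuousOn (fun q => chi δ (Φ q)) (Φ ⁻¹' Iio δ) :=
      fun q hq => (hasFDerivAt_X hΦ hδ hq).continuousAt.continuousWithinAt
    exact this.comp hx hγ.1
  have hGc : ContinuousOn (fun s => G (γ.toFun s) (v s)) (Icc a b) :=
    hG.continuous.comp_continuousOn (hx.prodMk hvc)
  set en : ℝ → ℝ := fun t => (1 / 2) * G (γ.toFun t) (v t) - chi δ (Φ (γ.toFun t)) with hen
  have henc : ContinuousOn en (Icc a b) := (hGc.const_mul (1 / 2)).sub hXc
  have hPv : ∀ t, P t (v t) = G (γ.toFun t) (v t) := by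
    intro t
    have h1 := euler hG (γ.toFun t) (v t)
    rw [hv1' t] at h1
    simp at h1
    exact h1
  have hconst : ∀ t ∈ Icc a b, en t = en a := by
    refine const_of_touch henc fun s hs => ?_
    refine ⟨fun t => P t (v s) - (1 / 2) * G (γ.toFun t) (v s) - chi δ (Φ (γ.toFun t)), ?_, ?_, ?_⟩
    · simp only [hen, hPv]; ring
    · intro t ht
      have h1 := hv2 t (v s)
      rw [hPv t] at h1
      simp only [hen]
      linarith
    · have d1 : HasDerivWithinAt P (F2 s) (Icc a b) s := hasDerivWithinAt_prim hab.le hF2c hPF2 hs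
      have d2 : HasDerivWithinAt γ.toFun (v s) (Icc a b) s :=
        hasDerivWithinAt_prim hab.le hvc hγv hs
      have d3 : HasDerivWithinAt (fun t => P t (v s)) (F2 s (v s)) (Icc a b) s := by
        have := d1.clm_apply (hasDerivWithinAt_const s (Icc a b) (v s))
        simpa using this
      have d4 : HasDerivWithinAt (fun t => G (γ.toFun t) (v s))
          (dqCLM G (γ.toFun s) (v s) (v s)) (Icc a b) s :=
        (hasFDerivAt_dq hG (γ.toFun s) (v s)).comp_hasDerivWithinAt s d2
      have d5 : HasDerivWithinAt (fun t => chi δ (Φ (γ.toFun t)))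
          (dX Φ δ (γ.toFun s) (v s)) (Icc a b) s :=
        (hasFDerivAt_X hΦ hδ (hγ.1 s hs)).comp_hasDerivWithinAt s d2
      have d6 := (d3.sub (d4.const_mul (1 / 2))).sub d5
      have e : F2 s (v s) - 1 / 2 * dqCLM G (γ.toFun s) (v s) (v s) -
          dX Φ δ (γ.toFun s) (v s) = 0 := by
        simp [hF2]
      rw [e] at d6
      exact d6
  refine ⟨v, hvc, hγv, fun s hs => ?_⟩
  have hba : 0 < b - a := sub_pos.2 hab
  have hIen : (b - a) * en a ≤ Jpen G Φ δ a b γ := by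
    have h1 : ∫ t in a..b, en t = (b - a) * en a := by
      have : ∫ t in a..b, en t = ∫ t in a..b, en a :=
        intervalIntegral.integral_congr fun t ht => hconst t (by rwa [uIcc_of_le hab.le] at ht)
      rw [this, intervalIntegral.integral_const, smul_eq_mul]
    have i1 : IntervalIntegrable (fun t => (1 / 2) * G (γ.toFun t) (v t)) volume a b :=
      (ContinuousOn.intervalIntegrable (by rw [uIcc_of_le hab.le]; exact hGc.const_mul (1 / 2)))
    have i2 : IntervalIntegrable (fun t => chi δ (Φ (γ.toFun t))) volume a b :=
      (ContinuousOn.intervalIntegrable (by rw [uIcc_of_le hab.le]; exact hXc))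
    have h2 : ∫ t in a..b, en t = (1 / 2) * (∫ t in a..b, G (γ.toFun t) (v t)) -
        ∫ t in a..b, chi δ (Φ (γ.toFun t)) := by
      rw [← intervalIntegral.integral_const_mul]
      exact intervalIntegral.integral_sub i1 i2
    have h3 : 0 ≤ ∫ t in a..b, chi δ (Φ (γ.toFun t)) :=
      intervalIntegral.integral_nonneg hab.le fun t _ => chi_nonneg _ _
    rw [← h1, h2, Jpen, hcongr (fun s w => G (γ.toFun s) w) b ⟨hab.le, le_rfl⟩]
    linarith
  have h4 : en s ≤ Jpen G Φ δ a b γ / (b - a) := by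
    rw [hconst s hs, le_div_iff₀ hba]; linarith
  simp only [hen] at h4
  linarith

lemma Jpen_bar {Φ : Evec n → ℝ} {δ : ℝ} (hab : a ≤ b) (γ : H1Curve n a b)
    (h : ∀ s ∈ Icc a b, Φ (γ.toFun s) ≤ 0) :
    Jpen G Φ δ a b γ = (1 / 2) * ∫ s in a..b, G (γ.toFun s) (γ.deriv s) := by
  have : ∫ s in a..b, chi δ (Φ (γ.toFun s)) = ∫ s in a..b, (0:ℝ) :=
    intervalIntegral.integral_congr fun t ht => by
      rw [uIcc_of_le hab] at ht
      simp [chi, h t ht]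
  rw [Jpen, this]; simp

end Fins

/-- Uniform bound on the penalized minimizers: if `γ̄` joins `p` to `q` inside `Ω̄` and
`k₁ = (1/2)∫_a^b G(γ̄,γ̄')`, then `J_δ(γ_δ) ≤ k₁` for every `δ ∈ (0,δ₀)`, and (with the
continuous representative `v` of the derivative of the minimizer)
`(1/2)G(γ_δ(s),γ̇_δ(s)) ≤ k₁/(b−a) + χ_δ(Φ(γ_δ(s)))` for all `s ∈ [a,b]`. -/
theorem stmt_8 {n : ℕ} (G : Evec n → Evec n → ℝ) (ℓ α : ℝ)
    (hG : IsFinslerEnergy n G ℓ α)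
    (Φ : Evec n → ℝ) (δ₀ : ℝ) (hΦ : IsRegularDomain n Φ δ₀)
    (a b : ℝ) (h0a : 0 ≤ a) (hab : a < b) (hb1 : b ≤ 1)
    (p q : Evec n)
    (γbar : H1Curve n a b)
    (hγbar : (∀ s ∈ Icc a b, Φ (γbar.toFun s) ≤ 0) ∧ γbar.toFun a = p ∧ γbar.toFun b = q)
    (k₁ : ℝ) (hk₁ : k₁ = (1 / 2) * ∫ s in a..b, G (γbar.toFun s) (γbar.deriv s))
    (γ : ℝ → H1Curve n a b)
    (hmin : ∀ δ ∈ Ioo (0:ℝ) δ₀, MemC Φ δ a b p q (γ δ) ∧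
      ∀ y : H1Curve n a b, MemC Φ δ a b p q y → Jpen G Φ δ a b (γ δ) ≤ Jpen G Φ δ a b y) :
    ∀ δ ∈ Ioo (0:ℝ) δ₀,
      Jpen G Φ δ a b (γ δ) ≤ k₁ ∧
      ∃ v : ℝ → Evec n,
        ContinuousOn v (Icc a b) ∧
        (∀ t ∈ Icc a b, (γ δ).toFun t = (γ δ).toFun a + ∫ s in a..t, v s) ∧
        ∀ s ∈ Icc a b,
          (1 / 2) * G ((γ δ).toFun s) (v s) ≤ k₁ / (b - a) + chi δ (Φ ((γ δ).toFun s)) := by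
  intro δ hδ
  obtain ⟨hmem, hle⟩ := hmin δ hδ
  have hJ : Jpen G Φ δ a b (γ δ) ≤ k₁ := by
    rw [hk₁, ← Fins.Jpen_bar (δ := δ) hab.le γbar hγbar.1]
    exact hle γbar ⟨fun s hs => (hγbar.1 s hs).trans_lt hδ.1, hγbar.2⟩
  refine ⟨hJ, ?_⟩
  obtain ⟨v, hv1, hv2, hv3⟩ := Fins.main hG hΦ.smooth hδ.1 hab (γ δ) hmem hle
  refine ⟨v, hv1, hv2, fun s hs => (hv3 s hs).trans ?_⟩
  have hba : 0 < b - a := sub_pos.2 hab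
  gcongr

end
end

section
/- Suppose G is a Finsler-type energy on ℝ^n and Φ defines a regular bounded domain Ω with constant δ₀. Fix p,q ∈ Ω̄, assume there is an H¹ curve from p to q with values in Ω̄, and for each δ ∈ (0,δ₀) let γ_δ be a minimizer of J_δ on C_δ. Define λ_δ(s) := −χ'_δ(Φ(γ_δ(s))) for s ∈ [a,b]. Then there exists δ₁ ∈ (0,δ₀) such that sup_{δ ∈ (0,δ₁)} ‖λ_δ‖_{L^∞} = sup_{δ ∈ (0,δ₁)} max_{s ∈ [a,b]} |λ_δ(s)| < +∞. -/
open MeasureTheory Set Filter RealInnerProductSpace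

noncomputable section

section Aux
open Topology


namespace IsFinslerEnergy

variable {n : ℕ} {G : Evec n → Evec n → ℝ} {ℓ α : ℝ}

lemma ell_pos (hG : IsFinslerEnergy n G ℓ α) : 0 < ℓ := lt_of_lt_of_le one_pos hG.one_le_ell

lemma nonneg (hG : IsFinslerEnergy n G ℓ α) (q v : Evec n) : 0 ≤ G q v := by
  have := hG.lower q v
  have h2 := hG.ell_pos
  have : 0 ≤ (1 / ℓ) * ‖v‖ ^ 2 := by positivity
  linarith

lemma isOpen_ne : IsOpen {p : Evec n × Evec n | p.2 ≠ 0} :=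
  isOpen_ne_fun continuous_snd continuous_const

lemma differentiableAt (hG : IsFinslerEnergy n G ℓ α) (q v : Evec n) :
    DifferentiableAt ℝ (fun p : Evec n × Evec n => G p.1 p.2) (q, v) := by
  by_cases hv : v = 0
  · subst hv
    have : HasFDerivAt (fun p : Evec n × Evec n => G p.1 p.2)
        (0 : Evec n × Evec n →L[ℝ] ℝ) (q, 0) := by
      have hz : G q 0 = 0 := by
        have h1 := hG.upper q 0
        have h2 := hG.nonneg q 0
        simp at h1
        linarith
      rw [hasFDerivAt_iff_isLittleO_nhds_zero]
      have h1 : (fun h : Evec n × Evec n => G ((q, (0 : Evec n)) + h).1 ((q, (0 : Evec n)) + h).2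
          - G q 0 - (0 : Evec n × Evec n →L[ℝ] ℝ) h) =O[𝓝 0] fun h => ‖h‖ ^ 2 := by
        refine Asymptotics.IsBigO.of_bound ℓ (Eventually.of_forall fun h => ?_)
        have h1 := hG.upper (q + h.1) h.2
        have h2 := hG.nonneg (q + h.1) h.2
        have h3 : ‖h.2‖ ≤ ‖h‖ := norm_snd_le h
        have h4 := hG.ell_pos
        simp only [Prod.fst_add, Prod.snd_add, hz, zero_add, sub_zero,
          _root_.zero_apply, norm_pow, norm_norm]
        rw [Real.norm_of_nonneg h2]
        refine h1.trans ?_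
        gcongr
      refine h1.trans_isLittleO ?_
      have : (fun h : Evec n × Evec n => ‖h‖ ^ 2) =o[𝓝 0] fun h => h := by
        simpa using Asymptotics.isLittleO_norm_pow_id (E' := Evec n × Evec n) one_lt_two
      exact this
    exact this.differentiableAt
  · exact (hG.smooth.contDiffAt (isOpen_ne.mem_nhds hv)).differentiableAt (by norm_num)

lemma dq_eq (hG : IsFinslerEnergy n G ℓ α) (q v : Evec n) :
    HasFDerivAt (fun z => G z v) ((fderiv ℝ (fun p : Evec n × Evec n => G p.1 p.2) (q, v)).comp
      (ContinuousLinearMap.inl ℝ _ _)) q :=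
  HasFDerivAt.comp (g := fun p : Evec n × Evec n => G p.1 p.2) (f := fun e => (e, v)) q
    (hG.differentiableAt q v).hasFDerivAt (hasFDerivAt_prodMk_left (𝕜 := ℝ) q v)

lemma dv_eq (hG : IsFinslerEnergy n G ℓ α) (q v : Evec n) :
    HasFDerivAt (fun z => G q z) ((fderiv ℝ (fun p : Evec n × Evec n => G p.1 p.2) (q, v)).comp
      (ContinuousLinearMap.inr ℝ _ _)) v :=
  HasFDerivAt.comp (g := fun p : Evec n × Evec n => G p.1 p.2) v
    (hG.differentiableAt q v).hasFDerivAt (hasFDerivAt_prodMk_right q v)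

lemma dqCLM_eq (hG : IsFinslerEnergy n G ℓ α) (q v : Evec n) :
    dqCLM G q v = (fderiv ℝ (fun p : Evec n × Evec n => G p.1 p.2) (q, v)).comp
      (ContinuousLinearMap.inl ℝ _ _) := (hG.dq_eq q v).fderiv

lemma dvCLM_eq (hG : IsFinslerEnergy n G ℓ α) (q v : Evec n) :
    dvCLM G q v = (fderiv ℝ (fun p : Evec n × Evec n => G p.1 p.2) (q, v)).comp
      (ContinuousLinearMap.inr ℝ _ _) := (hG.dv_eq q v).fderiv

lemma hasFDerivAt_dq (hG : IsFinslerEnergy n G ℓ α) (q v : Evec n) :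
    HasFDerivAt (fun z => G z v) (dqCLM G q v) q := by
  rw [hG.dqCLM_eq]; exact hG.dq_eq q v

lemma hasFDerivAt_dv (hG : IsFinslerEnergy n G ℓ α) (q v : Evec n) :
    HasFDerivAt (fun z => G q z) (dvCLM G q v) v := by
  rw [hG.dvCLM_eq]; exact hG.dv_eq q v

lemma hasFDerivAt (hG : IsFinslerEnergy n G ℓ α) (q v : Evec n) :
    HasFDerivAt (fun p : Evec n × Evec n => G p.1 p.2)
      ((dqCLM G q v).comp (ContinuousLinearMap.fst ℝ _ _) +
        (dvCLM G q v).comp (ContinuousLinearMap.snd ℝ _ _)) (q, v) := by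
  have : ((dqCLM G q v).comp (ContinuousLinearMap.fst ℝ _ _) +
        (dvCLM G q v).comp (ContinuousLinearMap.snd ℝ _ _))
      = fderiv ℝ (fun p : Evec n × Evec n => G p.1 p.2) (q, v) := by
    rw [hG.dqCLM_eq, hG.dvCLM_eq]
    ext x <;> simp [show ((0 : Evec n), (0 : Evec n)) = 0 from rfl]
  rw [this]
  exact (hG.differentiableAt q v).hasFDerivAt

lemma contDiffOn_fderiv (hG : IsFinslerEnergy n G ℓ α) :
    ContDiffOn ℝ 1 (fderiv ℝ (fun p : Evec n × Evec n => G p.1 p.2)) {p | p.2 ≠ 0} :=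
  hG.smooth.fderiv_of_isOpen isOpen_ne (by norm_num)

lemma contDiffOn_dv (hG : IsFinslerEnergy n G ℓ α) :
    ContDiffOn ℝ 1 (fun p : Evec n × Evec n => dvCLM G p.1 p.2) {p | p.2 ≠ 0} := by
  have h := hG.contDiffOn_fderiv
  have : (fun p : Evec n × Evec n => dvCLM G p.1 p.2) = fun p =>
      (fderiv ℝ (fun p : Evec n × Evec n => G p.1 p.2) p).comp
      (ContinuousLinearMap.inr ℝ _ _) := by
    funext p; exact hG.dvCLM_eq p.1 p.2
  rw [this]
  exact h.clm_comp contDiffOn_const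

lemma dv_smul (hG : IsFinslerEnergy n G ℓ α) (q v : Evec n) {c : ℝ} (hc : 0 < c) :
    dvCLM G q (c • v) = c • dvCLM G q v := by
  have h1 : HasFDerivAt (fun w => G q (c • w)) ((dvCLM G q (c • v)).comp
      (c • ContinuousLinearMap.id ℝ (Evec n))) v := by
    have := (hG.hasFDerivAt_dv q (c • v))
    exact this.comp v ((hasFDerivAt_id v).const_smul c)
  have h2 : HasFDerivAt (fun w => G q (c • w)) (c ^ 2 • dvCLM G q v) v := by
    have : (fun w => G q (c • w)) = fun w => c ^ 2 • G q w := by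
      funext w; rw [hG.homog q w c hc]; rfl
    rw [this]
    exact (hG.hasFDerivAt_dv q v).const_smul (c ^ 2)
  have h3 := h1.unique h2
  ext w
  have h4 := congrArg (fun L => L w) h3
  simp at h4 ⊢
  have : c * (dvCLM G q (c • v) w) = c * (c * dvCLM G q v w) := by rw [h4]; ring
  exact mul_left_cancel₀ hc.ne' this

lemma dq_smul (hG : IsFinslerEnergy n G ℓ α) (q v : Evec n) {c : ℝ} (hc : 0 < c) :
    dqCLM G q (c • v) = c ^ 2 • dqCLM G q v := by
  have h1 := hG.hasFDerivAt_dq q (c • v)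
  have h2 : HasFDerivAt (fun w => G w (c • v)) (c ^ 2 • dqCLM G q v) q := by
    have : (fun w => G w (c • v)) = fun w => c ^ 2 • G w v := by
      funext w; rw [hG.homog w v c hc]; rfl
    rw [this]
    exact (hG.hasFDerivAt_dq q v).const_smul (c ^ 2)
  exact h1.unique h2

lemma dv_norm_le (hG : IsFinslerEnergy n G ℓ α) (q v : Evec n) :
    ‖dvCLM G q v‖ ≤ ℓ * ‖v‖ := by
  have key : ∀ c : ℝ, 0 < c → ‖dvCLM G q v‖ ≤ ℓ * c + ℓ * ‖v‖ := by
    intro c hc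
    have h := hG.dv_bound q (c⁻¹ • v)
    rw [hG.dv_smul q v (inv_pos.2 hc), norm_smul, norm_smul, Real.norm_of_nonneg (inv_pos.2 hc).le] at h
    have h2 := mul_le_mul_of_nonneg_left h hc.le
    rw [← mul_assoc, mul_inv_cancel₀ hc.ne', one_mul] at h2
    calc _ ≤ _ := h2
      _ = ℓ * c + ℓ * ‖v‖ * (c * c⁻¹) := by ring
      _ = _ := by rw [mul_inv_cancel₀ hc.ne', mul_one]
  refine le_of_forall_pos_le_add fun ε hε => ?_
  have := key (ε / ℓ) (div_pos hε hG.ell_pos)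
  rw [mul_div_cancel₀ _ hG.ell_pos.ne'] at this
  linarith

lemma dq_norm_le (hG : IsFinslerEnergy n G ℓ α) (q v : Evec n) :
    ‖dqCLM G q v‖ ≤ ℓ * ‖v‖ ^ 2 := by
  have key : ∀ c : ℝ, 0 < c → ‖dqCLM G q v‖ ≤ ℓ * c ^ 2 + ℓ * ‖v‖ ^ 2 := by
    intro c hc
    have h := hG.dq_bound q (c⁻¹ • v)
    rw [hG.dq_smul q v (inv_pos.2 hc), norm_smul, norm_smul, Real.norm_of_nonneg (inv_pos.2 hc).le,
      Real.norm_of_nonneg (by positivity)] at h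
    have h2 := mul_le_mul_of_nonneg_left h (sq_nonneg c)
    have h3 : c * c⁻¹ = 1 := mul_inv_cancel₀ hc.ne'
    rw [← mul_assoc, ← mul_pow, h3, one_pow, one_mul] at h2
    calc _ ≤ _ := h2
      _ = ℓ * c ^ 2 + ℓ * ‖v‖ ^ 2 * (c * c⁻¹) ^ 2 := by ring
      _ = _ := by rw [h3]; ring
  refine le_of_forall_pos_le_add fun ε hε => ?_
  have := key (√(ε / ℓ)) (Real.sqrt_pos.2 (div_pos hε hG.ell_pos))
  rw [Real.sq_sqrt (div_pos hε hG.ell_pos).le, mul_div_cancel₀ _ hG.ell_pos.ne'] at this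
  linarith

lemma continuous_dv (hG : IsFinslerEnergy n G ℓ α) :
    Continuous (fun p : Evec n × Evec n => dvCLM G p.1 p.2) := by
  rw [continuous_iff_continuousAt]
  rintro ⟨q, v⟩
  by_cases hv : v = 0
  · subst hv
    have h0 : dvCLM G q 0 = 0 := by
      have := hG.dv_norm_le q 0
      simpa using this
    rw [ContinuousAt, h0]
    refine squeeze_zero_norm (a := fun p : Evec n × Evec n => ℓ * ‖p.2‖)
      (fun p => hG.dv_norm_le p.1 p.2) ?_
    have : Continuous fun p : Evec n × Evec n => ℓ * ‖p.2‖ := by fun_prop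
    simpa using this.tendsto (q, 0)
  · exact (hG.contDiffOn_dv.contDiffAt (isOpen_ne.mem_nhds hv)).continuousAt

lemma continuous_dq (hG : IsFinslerEnergy n G ℓ α) :
    Continuous (fun p : Evec n × Evec n => dqCLM G p.1 p.2) := by
  rw [continuous_iff_continuousAt]
  rintro ⟨q, v⟩
  by_cases hv : v = 0
  · subst hv
    have h0 : dqCLM G q 0 = 0 := by
      have := hG.dq_norm_le q 0
      simpa using this
    rw [ContinuousAt, h0]
    refine squeeze_zero_norm (a := fun p : Evec n × Evec n => ℓ * ‖p.2‖ ^ 2)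
      (fun p => hG.dq_norm_le p.1 p.2) ?_
    have : Continuous fun p : Evec n × Evec n => ℓ * ‖p.2‖ ^ 2 := by fun_prop
    simpa using this.tendsto (q, 0)
  · have h := (hG.contDiffOn_fderiv.contDiffAt (isOpen_ne.mem_nhds (x := (q, v)) hv)).continuousAt
    have : (fun p : Evec n × Evec n => dqCLM G p.1 p.2) = fun p =>
      (fderiv ℝ (fun p : Evec n × Evec n => G p.1 p.2) p).comp
      (ContinuousLinearMap.inl ℝ _ _) := by
      funext p; exact hG.dqCLM_eq p.1 p.2
    rw [this]
    exact h.clm_comp continuousAt_const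

/-- Euler's identity. -/
lemma euler (hG : IsFinslerEnergy n G ℓ α) (q v : Evec n) :
    dvCLM G q v v = 2 * G q v := by
  have h1 : HasDerivAt (fun t : ℝ => G q (t • v)) (dvCLM G q v v) 1 := by
    have h := hG.hasFDerivAt_dv q ((1 : ℝ) • v)
    have h2 : HasDerivAt (fun t : ℝ => t • v) ((1 : ℝ) • v) 1 := (hasDerivAt_id 1).smul_const v
    have := h.comp_hasDerivAt (1 : ℝ) h2
    simpa [Function.comp_def] using this
  have h2 : HasDerivAt (fun t : ℝ => G q (t • v)) (2 * G q v) 1 := by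
    have h : HasDerivAt (fun t : ℝ => t ^ 2 * G q v) (2 * G q v) 1 := by
      simpa using (hasDerivAt_pow 2 (1 : ℝ)).mul_const (G q v)
    refine h.congr_of_eventuallyEq ?_
    filter_upwards [lt_mem_nhds (zero_lt_one (α := ℝ))] with t ht
    exact hG.homog q v t ht
  exact h1.unique h2

/-- strong monotonicity along segments whose interior avoids the origin -/
lemma mono_aux (hG : IsFinslerEnergy n G ℓ α) (q v w : Evec n)
    (h0 : ∀ t ∈ Ioo (0 : ℝ) 1, w + t • (v - w) ≠ 0) :
    α * ‖v - w‖ ^ 2 ≤ (dvCLM G q v - dvCLM G q w) (v - w) := by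
  set d := v - w with hd
  set h : ℝ → ℝ := fun t => dvCLM G q (w + t • d) d with hh
  have hcont : Continuous h := by
    have : Continuous fun t : ℝ => dvCLM G q (w + t • d) :=
      hG.continuous_dv.comp (by fun_prop : Continuous fun t : ℝ => (q, w + t • d))
    exact this.clm_apply continuous_const
  have hder : ∀ t ∈ Ioo (0 : ℝ) 1,
      HasDerivAt h (fderiv ℝ (fun u => dvCLM G q u d) (w + t • d) d) t := by
    intro t ht
    have h1 : DifferentiableAt ℝ (fun u => dvCLM G q u d) (w + t • d) := by
      have h2 : DifferentiableAt ℝ (fun p : Evec n × Evec n => dvCLM G p.1 p.2) (q, w + t • d) :=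
        (hG.contDiffOn_dv.contDiffAt (isOpen_ne.mem_nhds (h0 t ht))).differentiableAt (by norm_num)
      have h3 : DifferentiableAt ℝ (fun u => dvCLM G q u) (w + t • d) :=
        (h2.comp (w + t • d) (hasFDerivAt_prodMk_right q (w + t • d)).differentiableAt)
      exact h3.clm_apply (differentiableAt_const _)
    have h2 : HasDerivAt (fun t : ℝ => w + t • d) d t := by
      simpa using ((hasDerivAt_id t).smul_const d).const_add w
    exact h1.hasFDerivAt.comp_hasDerivAt t h2
  obtain ⟨t, ht, hs⟩ := exists_hasDerivAt_eq_slope h _ zero_lt_one hcont.continuousOn hder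
  have h3 := hG.vv_convex q (w + t • d) (h0 t ht) d
  rw [hs] at h3
  simpa [hh, hd] using h3

lemma strong_mono (hG : IsFinslerEnergy n G ℓ α) (q v w : Evec n) :
    α * ‖v - w‖ ^ 2 ≤ (dvCLM G q v - dvCLM G q w) (v - w) := by
  by_cases h : ∀ t ∈ Ioo (0 : ℝ) 1, w + t • (v - w) ≠ 0
  · exact hG.mono_aux q v w h
  push Not at h
  obtain ⟨t, ht, h⟩ := h
  set d := v - w with hd
  have hw : w = -(t • d) := eq_neg_of_add_eq_zero_left h
  have hv : v = (1 - t) • d := by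
    have : v = d + w := by rw [hd]; abel
    calc v = d + w := this
      _ = d + -(t • d) := by congr 1
      _ = _ := by rw [sub_smul, one_smul]; abel
  by_cases hd0 : d = 0
  · rw [hd0]; simp
  have z : dvCLM G q 0 = 0 := by
      have := hG.dv_norm_le q 0
      simpa using this
  have h1 := hG.mono_aux q v 0 (by
    intro s hs
    rw [hv, zero_add, sub_zero]
    simp only [ne_eq, smul_eq_zero, not_or]
    exact ⟨hs.1.ne', by linarith [ht.2], hd0⟩)
  have h2 := hG.mono_aux q w 0 (by
    intro s hs
    rw [hw, zero_add, sub_zero]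
    simp only [ne_eq, smul_eq_zero, not_or, neg_eq_zero]
    exact ⟨hs.1.ne', ht.1.ne', hd0⟩)
  rw [sub_zero, z, sub_zero] at h1 h2
  have e1 : dvCLM G q v v = (1 - t) * dvCLM G q v d := by
    nth_rw 2 [hv]; simp
  have e2 : dvCLM G q w w = - (t * dvCLM G q w d) := by
    nth_rw 2 [hw]; simp
  have n1 : ‖v‖ = (1 - t) * ‖d‖ := by
    rw [hv, norm_smul, Real.norm_of_nonneg (by linarith [ht.2])]
  have n2 : ‖w‖ = t * ‖d‖ := by
    rw [hw, norm_neg, norm_smul, Real.norm_of_nonneg ht.1.le]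
  rw [e1, n1] at h1
  rw [e2, n2] at h2
  have h1' : α * (1 - t) * ‖d‖ ^ 2 ≤ dvCLM G q v d := by
    have : 0 < 1 - t := by linarith [ht.2]
    refine le_of_mul_le_mul_left ?_ this
    linarith
  have h2' : α * t * ‖d‖ ^ 2 ≤ - dvCLM G q w d := by
    refine le_of_mul_le_mul_left ?_ ht.1
    linarith
  rw [_root_.sub_apply]
  linarith

lemma dv_inj (hG : IsFinslerEnergy n G ℓ α) (q v w : Evec n) (h : dvCLM G q v = dvCLM G q w) :
    v = w := by
  have h1 := hG.strong_mono q v w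
  rw [h, sub_self, _root_.zero_apply] at h1
  have h2 : ‖v - w‖ ^ 2 ≤ 0 := by
    by_contra h3
    push Not at h3
    have := mul_pos hG.alpha_pos h3
    linarith
  have h3 : ‖v - w‖ = 0 := by nlinarith [norm_nonneg (v - w)]
  exact sub_eq_zero.1 (norm_eq_zero.1 h3)

lemma dist_le (hG : IsFinslerEnergy n G ℓ α) (q v w : Evec n) :
    α * ‖v - w‖ ≤ ‖dvCLM G q v - dvCLM G q w‖ := by
  have h1 := hG.strong_mono q v w
  have h2 := (le_abs_self _).trans ((dvCLM G q v - dvCLM G q w).le_opNorm (v - w))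
  by_cases h : v = w
  · subst h; simp
  have h3 : 0 < ‖v - w‖ := norm_pos_iff.2 (sub_ne_zero.2 h)
  refine le_of_mul_le_mul_right ?_ h3
  linarith

lemma convex_ineq (hG : IsFinslerEnergy n G ℓ α) (q v w : Evec n) :
    G q w + dvCLM G q w (v - w) ≤ G q v := by
  set d := v - w with hd
  have hder : ∀ t : ℝ, HasDerivAt (fun t : ℝ => G q (w + t • d)) (dvCLM G q (w + t • d) d) t := by
    intro t
    have h2 : HasDerivAt (fun t : ℝ => w + t • d) d t := by
      simpa using ((hasDerivAt_id t).smul_const d).const_add w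
    exact (hG.hasFDerivAt_dv q (w + t • d)).comp_hasDerivAt t h2
  obtain ⟨t, ht, hs⟩ := exists_hasDerivAt_eq_slope (fun t : ℝ => G q (w + t • d)) _ zero_lt_one
    (fun t _ => (hder t).continuousAt.continuousWithinAt) (fun t _ => hder t)
  have h3 := hG.strong_mono q (w + t • d) w
  have h4 : 0 ≤ (dvCLM G q (w + t • d) - dvCLM G q w) (w + t • d - w) :=
    le_trans (by have := hG.alpha_pos; positivity) h3
  rw [add_sub_cancel_left, map_smul, smul_eq_mul, _root_.sub_apply] at h4
  have h5 : 0 ≤ dvCLM G q (w + t • d) d - dvCLM G q w d := nonneg_of_mul_nonneg_right h4 ht.1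
  rw [hs] at h5
  simp [hd] at h5 ⊢
  linarith

lemma dv_surj (hG : IsFinslerEnergy n G ℓ α) (q : Evec n) (P : Evec n →L[ℝ] ℝ) :
    ∃ v, dvCLM G q v = P := by
  have hc : Continuous fun v => G q v - P v :=
    (hG.continuous.comp (by fun_prop : Continuous fun v : Evec n => (q, v))).sub P.continuous
  have hco : Tendsto (fun v => G q v - P v) (cocompact (Evec n)) atTop := by
    have h1 : Tendsto (fun v : Evec n => ‖v‖) (cocompact (Evec n)) atTop := tendsto_norm_cocompact_atTop
    have h2 : Tendsto (fun x : ℝ => x * (1 / ℓ * x + (-‖P‖))) atTop atTop := by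
      refine tendsto_id.atTop_mul_atTop₀ ?_
      refine tendsto_atTop_add_const_right _ _ ?_
      exact tendsto_id.const_mul_atTop (by have := hG.ell_pos; positivity)
    refine tendsto_atTop_mono (fun v => ?_) (h2.comp h1)
    have h3 := hG.lower q v
    have h4 := (le_abs_self _).trans (P.le_opNorm v)
    simp only [Function.comp]
    nlinarith
  obtain ⟨v, hv⟩ := hc.exists_forall_le hco
  refine ⟨v, ?_⟩
  have h1 : HasFDerivAt (fun v => G q v - P v) (dvCLM G q v - P) v :=
    (hG.hasFDerivAt_dv q v).sub P.hasFDerivAt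
  have h2 : IsLocalMin (fun v => G q v - P v) v := Eventually.of_forall hv
  exact sub_eq_zero.1 (h2.hasFDerivAt_eq_zero h1)

/-- Uniform bounds for the second derivatives on compact sets. -/
lemma hess_bound (hG : IsFinslerEnergy n G ℓ α) {K : Set (Evec n)} (hK : IsCompact K) :
    ∃ L : ℝ, 0 ≤ L ∧ ∀ q ∈ K, ∀ v : Evec n, v ≠ 0 → ∀ ξ η : Evec n,
      ‖fderiv ℝ (fun p : Evec n × Evec n => dvCLM G p.1 p.2) (q, v) (ξ, η)‖
        ≤ L * (‖v‖ * ‖ξ‖ + ‖η‖) := by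
  set D := fderiv ℝ (fun p : Evec n × Evec n => dvCLM G p.1 p.2) with hD
  have hcont : ContinuousOn D {p | p.2 ≠ 0} :=
    hG.contDiffOn_dv.continuousOn_fderiv_of_isOpen isOpen_ne (le_refl _)
  have hcomp : IsCompact (K ×ˢ Metric.sphere (0 : Evec n) 1) := hK.prod (isCompact_sphere _ _)
  obtain ⟨L, hL⟩ := hcomp.exists_bound_of_continuousOn (f := D) (hcont.mono (by
    rintro ⟨q, v⟩ ⟨_, hv⟩
    have hv1 : ‖v‖ = 1 := by simpa using hv
    intro h
    rw [show v = 0 from h, norm_zero] at hv1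
    exact zero_ne_one hv1))
  refine ⟨max L 0, le_max_right _ _, ?_⟩
  intro q hq v hv ξ η
  have hn : 0 < ‖v‖ := norm_pos_iff.2 hv
  set u : Evec n := ‖v‖⁻¹ • v with hu
  have hun : ‖u‖ = 1 := by rw [hu, norm_smul, norm_inv, norm_norm, inv_mul_cancel₀ hn.ne']
  have hu0 : u ≠ 0 := by intro h; rw [h, norm_zero] at hun; exact zero_ne_one hun
  have hdiff : ∀ w : Evec n, w ≠ 0 → HasFDerivAt (fun p : Evec n × Evec n => dvCLM G p.1 p.2)
      (D (q, w)) (q, w) := fun w hw =>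
    ((hG.contDiffOn_dv.contDiffAt (isOpen_ne.mem_nhds hw)).differentiableAt
      (by norm_num)).hasFDerivAt
  set S : Evec n × Evec n →L[ℝ] Evec n × Evec n :=
    (ContinuousLinearMap.fst ℝ _ _).prod (‖v‖⁻¹ • ContinuousLinearMap.snd ℝ _ _) with hS
  have hSv : S (q, v) = (q, u) := by simp [hS, hu]
  have h1 : HasFDerivAt (fun p : Evec n × Evec n => dvCLM G (S p).1 (S p).2)
      ((D (q, u)).comp S) (q, v) := by
    have h := hdiff u hu0
    rw [← hSv] at h
    have h' := HasFDerivAt.comp (q, v) h S.hasFDerivAt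
    rw [hSv] at h'
    exact h'
  have h2 : HasFDerivAt (fun p : Evec n × Evec n => dvCLM G (S p).1 (S p).2)
      (‖v‖⁻¹ • D (q, v)) (q, v) := by
    have : (fun p : Evec n × Evec n => dvCLM G (S p).1 (S p).2) =
        fun p => ‖v‖⁻¹ • dvCLM G p.1 p.2 := by
      funext p
      simp only [hS, ContinuousLinearMap.prod_apply, ContinuousLinearMap.coe_fst',
        _root_.smul_apply, ContinuousLinearMap.coe_snd']
      exact hG.dv_smul p.1 p.2 (inv_pos.2 hn)
    rw [this]
    exact (hdiff v hv).const_smul (‖v‖⁻¹ : ℝ)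
  have h3 := congrArg (fun L => L (ξ, η)) (h1.unique h2)
  simp only [ContinuousLinearMap.comp_apply, _root_.smul_apply] at h3
  have h4 : D (q, v) (ξ, η) = ‖v‖ • D (q, u) (S (ξ, η)) := by
    rw [h3, smul_smul, mul_inv_cancel₀ hn.ne', one_smul]
  rw [h4, norm_smul, norm_norm]
  have h5 := (D (q, u)).le_opNorm (S (ξ, η))
  have h6 : ‖D (q, u)‖ ≤ max L 0 := (hL (q, u) ⟨hq, by simpa using hun⟩).trans (le_max_left _ _)
  have h7 : ‖S (ξ, η)‖ ≤ ‖ξ‖ + ‖v‖⁻¹ * ‖η‖ := by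
    simp only [hS, ContinuousLinearMap.prod_apply, ContinuousLinearMap.coe_fst',
        _root_.smul_apply, ContinuousLinearMap.coe_snd', Prod.norm_def, norm_smul,
        norm_inv, norm_norm]
    refine max_le ?_ ?_
    · have : 0 ≤ ‖v‖⁻¹ * ‖η‖ := by positivity
      linarith
    · linarith [norm_nonneg ξ]
  calc ‖v‖ * ‖D (q, u) (S (ξ, η))‖ ≤ ‖v‖ * (max L 0 * (‖ξ‖ + ‖v‖⁻¹ * ‖η‖)) := by
        gcongr
        exact h5.trans (mul_le_mul h6 h7 (norm_nonneg _) (le_max_right _ _))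
    _ = max L 0 * (‖v‖ * ‖ξ‖ + (‖v‖ * ‖v‖⁻¹) * ‖η‖) := by ring
    _ = _ := by rw [mul_inv_cancel₀ hn.ne', one_mul]

end IsFinslerEnergy


/-- explicit derivative of `chi` -/
def dchi (δ t : ℝ) : ℝ := 2 * δ * max t 0 / (δ - max t 0) ^ 3

lemma chi_eq (δ t : ℝ) : chi δ t = (max t 0) ^ 2 / (δ - max t 0) ^ 2 := by
  unfold chi
  split_ifs with h
  · simp [max_eq_right h]
  · rw [max_eq_left (not_le.1 h).le]

lemma chi_nonneg (δ t : ℝ) : 0 ≤ chi δ t := by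
  rw [chi_eq]; positivity

lemma hasDerivAt_chi {δ t : ℝ} (hδ : 0 < δ) (ht : t < δ) : HasDerivAt (chi δ) (dchi δ t) t := by
  have hpos : ∀ t, t < δ → HasDerivAt (fun t => t ^ 2 / (δ - t) ^ 2) (2 * δ * t / (δ - t) ^ 3) t := by
    intro t ht
    have h0 : δ - t ≠ 0 := by linarith
    have h1 : HasDerivAt (fun t : ℝ => t ^ 2) (2 * t) t := by simpa using hasDerivAt_pow 2 t
    have h2 : HasDerivAt (fun t : ℝ => (δ - t) ^ 2) (2 * (δ - t) * (-1)) t := by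
      have := ((hasDerivAt_id t).const_sub δ).fun_pow 2
      simpa using this
    have h3 := h1.div h2 (pow_ne_zero 2 h0)
    refine h3.congr_deriv ?_
    field_simp
    ring
  rcases lt_trichotomy t 0 with h | h | h
  · have : HasDerivAt (fun _ : ℝ => (0 : ℝ)) (dchi δ t) t := by
      simp only [dchi, max_eq_right h.le]
      simpa using hasDerivAt_const t (0 : ℝ)
    refine this.congr_of_eventuallyEq ?_
    filter_upwards [gt_mem_nhds h] with s hs
    simp [chi, hs.le]
  · subst h
    have h1 := hpos 0 hδ
    have e : dchi δ 0 = 0 := by simp [dchi]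
    rw [e]
    simp only [mul_zero, zero_div] at h1
    rw [hasDerivAt_iff_isLittleO] at h1 ⊢
    refine Asymptotics.IsBigO.trans_isLittleO (Asymptotics.IsBigO.of_bound 1 ?_) h1
    refine Eventually.of_forall fun s => ?_
    have e0 : chi δ 0 = 0 := by simp [chi]
    rw [e0]
    by_cases h : s ≤ 0
    · have : chi δ s = 0 := by simp [chi, h]
      rw [this]
      simp
      positivity
    · simp [chi, h]
  · have := hpos t ht
    have e : dchi δ t = 2 * δ * t / (δ - t) ^ 3 := by rw [dchi, max_eq_left h.le]
    rw [e]
    refine this.congr_of_eventuallyEq ?_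
    filter_upwards [lt_mem_nhds h] with s hs
    simp [chi, hs]

lemma dchi_nonneg {δ t : ℝ} (hδ : 0 < δ) (ht : t < δ) : 0 ≤ dchi δ t := by
  unfold dchi
  have : 0 < δ - max t 0 := by simp [ht, hδ]
  positivity

lemma dchi_mono {δ s t : ℝ} (hδ : 0 < δ) (ht : t < δ) (hst : s ≤ t) : dchi δ s ≤ dchi δ t := by
  unfold dchi
  have : 0 < δ - max t 0 := by simp [ht, hδ]
  gcongr

lemma chi_mono {δ s t : ℝ} (hδ : 0 < δ) (ht : t < δ) (hst : s ≤ t) : chi δ s ≤ chi δ t := by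
  rw [chi_eq, chi_eq]
  have : 0 < δ - max t 0 := by simp [ht, hδ]
  gcongr

lemma chi_le_dchi {δ t : ℝ} (hδ : 0 < δ) (ht : t < δ) : chi δ t ≤ δ / 2 * dchi δ t := by
  rw [chi_eq, dchi]
  set m := max t 0
  have hm0 : 0 ≤ m := le_max_right _ _
  have h : 0 < δ - m := by simp [m, ht, hδ]
  have : δ / 2 * (2 * δ * m / (δ - m) ^ 3) = (δ ^ 2 * m / (δ - m)) / (δ - m) ^ 2 := by
    field_simp
  rw [this]
  gcongr
  rw [le_div_iff₀ h]
  nlinarith [mul_nonneg hm0 h.le, mul_nonneg (mul_nonneg hm0 h.le) h.le, mul_nonneg (mul_nonneg hm0 hm0) hm0, mul_nonneg hm0 hm0, mul_nonneg (mul_nonneg hm0 hm0) h.le]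

lemma continuousOn_dchi {δ : ℝ} (hδ : 0 < δ) : ContinuousOn (dchi δ) (Iio δ) := by
  unfold dchi
  refine ContinuousOn.div (by fun_prop) (by fun_prop) ?_
  intro t ht
  have : 0 < δ - max t 0 := by simp [mem_Iio.1 ht, hδ]
  positivity

lemma continuousOn_chi {δ : ℝ} (hδ : 0 < δ) : ContinuousOn (chi δ) (Iio δ) :=
  fun _ ht => (hasDerivAt_chi hδ ht).continuousAt.continuousWithinAt

/-- Integration by parts for indefinite integrals. -/
lemma ibp {a b : ℝ} {f g : ℝ → ℝ} (hf : IntervalIntegrable f volume a b)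
    (hg : IntervalIntegrable g volume a b) (h0 : ∫ s in a..b, g s = 0) :
    ∫ s in a..b, f s * (∫ t in a..s, g t) = - ∫ s in a..b, (∫ t in a..s, f t) * g s := by
  have hF := hf.absolutelyContinuousOnInterval_intervalIntegral (c := a) (by simp)
  have hH := hg.absolutelyContinuousOnInterval_intervalIntegral (c := a) (by simp)
  have h := hF.integral_mul_deriv_eq_deriv_mul hH
  have hFd := hf.ae_hasDerivAt_integral
  have hHd := hg.ae_hasDerivAt_integral
  have e1 : ∫ s in a..b, (∫ t in a..s, f t) * deriv (fun x => ∫ t in a..x, g t) s =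
      ∫ s in a..b, (∫ t in a..s, f t) * g s := by
    refine intervalIntegral.integral_congr_ae ?_
    filter_upwards [hHd] with s hs hsm
    rw [(hs (uIoc_subset_uIcc hsm) a (by simp)).deriv]
  have e2 : ∫ s in a..b, deriv (fun x => ∫ t in a..x, f t) s * (∫ t in a..s, g t) =
      ∫ s in a..b, f s * (∫ t in a..s, g t) := by
    refine intervalIntegral.integral_congr_ae ?_
    filter_upwards [hFd] with s hs hsm
    rw [(hs (uIoc_subset_uIcc hsm) a (by simp)).deriv]
  rw [e1, e2, h0] at h
  simp at h
  linarith

/-- du Bois-Reymond. -/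
lemma duBoisReymond {a b : ℝ} (hab : a < b) {A Q : ℝ → ℝ} (hA : IntegrableOn A (Icc a b))
    (hQ : IntegrableOn Q (Icc a b))
    (h : ∀ ψ : ℝ → ℝ, Measurable ψ → (∃ C, ∀ s, |ψ s| ≤ C) → ∫ s in a..b, ψ s = 0 →
      ∫ s in a..b, (Q s * (∫ t in a..s, ψ t) + A s * ψ s) = 0) :
    ∃ c : ℝ, ∀ᵐ s ∂(volume.restrict (Icc a b)), A s = c + ∫ t in a..s, Q t := by
  have hAi : IntervalIntegrable A volume a b := (intervalIntegrable_iff_integrableOn_Icc_of_le hab.le).2 hA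
  have hQi : IntervalIntegrable Q volume a b := (intervalIntegrable_iff_integrableOn_Icc_of_le hab.le).2 hQ
  have hRc : ContinuousOn (fun s => ∫ t in a..s, Q t) (Icc a b) := by
    have := intervalIntegral.continuousOn_primitive_interval (a := a) (b := b) (f := Q) (μ := volume)
      (by rwa [uIcc_of_le hab.le])
    rwa [uIcc_of_le hab.le] at this
  have hRi : IntervalIntegrable (fun s => ∫ t in a..s, Q t) volume a b :=
    ContinuousOn.intervalIntegrable_of_Icc hab.le hRc
  set m : ℝ → ℝ := fun s => A s - ∫ t in a..s, Q t with hm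
  have hmi : IntervalIntegrable m volume a b := hAi.sub hRi
  set c : ℝ := (b - a)⁻¹ * ∫ s in a..b, m s with hc
  have hba : b - a ≠ 0 := by linarith
  -- mean zero tests
  have key : ∀ ψ : ℝ → ℝ, Measurable ψ → (∃ C, ∀ s, |ψ s| ≤ C) → ∫ s in a..b, ψ s = 0 →
      ∫ s in a..b, m s * ψ s = 0 := by
    intro ψ hψm ⟨C, hC⟩ hψ0
    have hψi : IntervalIntegrable ψ volume a b := by
      refine (intervalIntegrable_const (c := C)).mono_fun hψm.aestronglyMeasurable ?_
      exact Eventually.of_forall fun s => (hC s).trans (le_abs_self C)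
    have hAψ : IntervalIntegrable (fun s => A s * ψ s) volume a b := by
      refine (hAi.norm.const_mul C).mono_fun (hAi.aestronglyMeasurable_restrict_uIoc.mul
        hψm.aestronglyMeasurable) ?_
      refine Eventually.of_forall fun s => ?_
      have h1 := hC s
      have h2 : 0 ≤ C := (abs_nonneg _).trans h1
      simp only [norm_mul, Real.norm_eq_abs, abs_abs, abs_of_nonneg h2]
      rw [mul_comm]; gcongr
    have hψc : ContinuousOn (fun s => ∫ t in a..s, ψ t) (uIcc a b) :=
      intervalIntegral.continuousOn_primitive_interval' hψi (by simp)
    have hQψ : IntervalIntegrable (fun s => Q s * ∫ t in a..s, ψ t) volume a b :=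
      hQi.mul_continuousOn hψc
    have hRψ : IntervalIntegrable (fun s => (∫ t in a..s, Q t) * ψ s) volume a b :=
      hψi.continuousOn_mul (by rwa [uIcc_of_le hab.le])
    have h1 := h ψ hψm ⟨C, hC⟩ hψ0
    rw [intervalIntegral.integral_add hQψ hAψ, ibp hQi hψi hψ0] at h1
    simp only [hm, sub_mul]
    rw [intervalIntegral.integral_sub hAψ hRψ]
    linarith
  have key2 : ∀ S : Set ℝ, MeasurableSet S → ∫ s in Icc a b ∩ S, (m s - c) = 0 := by
    intro S hS
    set ψ0 : ℝ → ℝ := S.indicator (fun _ => 1) with hψ0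
    have hψ0m : Measurable ψ0 := measurable_const.indicator hS
    have hψ0b : ∀ s, |ψ0 s| ≤ 1 := by
      intro s; rw [hψ0]; by_cases hs : s ∈ S <;> simp [hs]
    have hψ0i : IntervalIntegrable ψ0 volume a b := by
      refine (intervalIntegrable_const (c := (1 : ℝ))).mono_fun hψ0m.aestronglyMeasurable ?_
      exact Eventually.of_forall fun s => (hψ0b s).trans (le_abs_self 1)
    set k : ℝ := (b - a)⁻¹ * ∫ s in a..b, ψ0 s with hk
    have hzero : ∫ s in a..b, (ψ0 s - k) = 0 := by
      rw [intervalIntegral.integral_sub hψ0i intervalIntegrable_const, intervalIntegral.integral_const,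
        hk, smul_eq_mul, ← mul_assoc, mul_inv_cancel₀ hba]
      ring
    have h1 := key (fun s => ψ0 s - k) (hψ0m.sub_const k) ⟨1 + |k|, fun s => by
      have := abs_sub (ψ0 s) k
      linarith [hψ0b s]⟩ hzero
    have hmψ : IntervalIntegrable (fun s => m s * ψ0 s) volume a b := by
      refine hmi.norm.mono_fun (hmi.aestronglyMeasurable_restrict_uIoc.mul
        hψ0m.aestronglyMeasurable) ?_
      refine Eventually.of_forall fun s => ?_
      have h1 := hψ0b s
      simp only [norm_mul, Real.norm_eq_abs, abs_abs]
      nlinarith [abs_nonneg (m s)]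
    simp only [mul_sub] at h1
    rw [intervalIntegral.integral_sub hmψ (hmi.mul_const k), intervalIntegral.integral_mul_const] at h1
    have h2 : ∫ s in a..b, (m s - c) * ψ0 s = 0 := by
      simp only [sub_mul]
      rw [intervalIntegral.integral_sub hmψ (hψ0i.const_mul c), intervalIntegral.integral_const_mul]
      have : (∫ s in a..b, m s) * k = c * ∫ s in a..b, ψ0 s := by rw [hk, hc]; ring
      linarith
    rw [intervalIntegral.integral_of_le hab.le, ← integral_Icc_eq_integral_Ioc] at h2
    rw [← setIntegral_indicator hS, ← h2]
    congr 1
    funext s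
    by_cases hs : s ∈ S <;> simp [hψ0, hs]
  have hIntg : Integrable (fun s => m s - c) (volume.restrict (Icc a b)) := by
    have := (intervalIntegrable_iff_integrableOn_Icc_of_le hab.le).1
      (hmi.sub (intervalIntegrable_const (c := c)))
    exact this
  have hae := hIntg.ae_eq_zero_of_forall_setIntegral_eq_zero (by
    intro S hS _
    rw [Measure.restrict_restrict hS, inter_comm]
    exact key2 S hS)
  refine ⟨c, ?_⟩
  filter_upwards [hae] with s hs
  simp only [hm, Pi.zero_apply] at hs
  linarith


section EL
variable {n : ℕ} {G : Evec n → Evec n → ℝ} {ℓ α : ℝ} {Φ : Evec n → ℝ} {a b δ : ℝ}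

lemma H1Curve.continuousOn (hab : a ≤ b) (γ : H1Curve n a b) : ContinuousOn γ.toFun (Icc a b) := by
  have h1 : ContinuousOn (fun t => γ.toFun a + ∫ s in a..t, γ.deriv s) (Icc a b) := by
    have := intervalIntegral.continuousOn_primitive_interval (a := a) (b := b) (f := γ.deriv)
      (μ := volume) (by rw [uIcc_of_le hab]; exact γ.deriv_integrable)
    rw [uIcc_of_le hab] at this
    exact continuousOn_const.add this
  exact h1.congr γ.eq_add_integral

lemma H1Curve.aesm (hab : a ≤ b) (γ : H1Curve n a b) :
    AEStronglyMeasurable (fun s => (γ.toFun s, γ.deriv s)) (volume.restrict (Icc a b)) :=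
  ((γ.continuousOn hab).aestronglyMeasurable measurableSet_Icc).prodMk
    γ.deriv_integrable.aestronglyMeasurable

lemma integrable_G (hG : IsFinslerEnergy n G ℓ α) (hab : a ≤ b) (γ : H1Curve n a b) :
    IntegrableOn (fun s => G (γ.toFun s) (γ.deriv s)) (Icc a b) := by
  refine Integrable.mono' (γ.deriv_sq_integrable.const_mul ℓ)
    (hG.continuous.comp_aestronglyMeasurable (γ.aesm hab)) ?_
  refine Eventually.of_forall fun s => ?_
  rw [Real.norm_of_nonneg (hG.nonneg _ _)]
  exact hG.upper _ _

lemma continuousOn_chiΦ (hΦ : ContDiff ℝ 2 Φ) (hδ : 0 < δ) {γ : ℝ → Evec n} {S : Set ℝ}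
    (hγ : ContinuousOn γ S) (h : ∀ s ∈ S, Φ (γ s) < δ) :
    ContinuousOn (fun s => chi δ (Φ (γ s))) S :=
  (continuousOn_chi hδ).comp (hΦ.continuous.comp_continuousOn hγ) h

lemma continuousOn_dchiΦ (hΦ : ContDiff ℝ 2 Φ) (hδ : 0 < δ) {γ : ℝ → Evec n} {S : Set ℝ}
    (hγ : ContinuousOn γ S) (h : ∀ s ∈ S, Φ (γ s) < δ) :
    ContinuousOn (fun s => dchi δ (Φ (γ s)) • fderiv ℝ Φ (γ s)) S :=
  ((continuousOn_dchi hδ).comp (hΦ.continuous.comp_continuousOn hγ) h).smul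
    ((hΦ.continuous_fderiv (by norm_num)).comp_continuousOn hγ)

lemma integrable_chi (hΦ : ContDiff ℝ 2 Φ) (hδ : 0 < δ) (hab : a ≤ b) (γ : H1Curve n a b)
    (h : ∀ s ∈ Icc a b, Φ (γ.toFun s) < δ) :
    IntegrableOn (fun s => chi δ (Φ (γ.toFun s))) (Icc a b) :=
  (continuousOn_chiΦ hΦ hδ (γ.continuousOn hab) h).integrableOn_Icc

lemma Jpen_eq (hG : IsFinslerEnergy n G ℓ α) (hΦ : ContDiff ℝ 2 Φ) (hδ : 0 < δ) (hab : a ≤ b)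
    (γ : H1Curve n a b) (h : ∀ s ∈ Icc a b, Φ (γ.toFun s) < δ) :
    Jpen G Φ δ a b γ = ∫ s in Icc a b,
      ((1 / 2) * G (γ.toFun s) (γ.deriv s) + chi δ (Φ (γ.toFun s))) := by
  rw [integral_add ((integrable_G hG hab γ).const_mul _) (integrable_chi hΦ hδ hab γ h),
    integral_const_mul, Jpen, intervalIntegral.integral_of_le hab, intervalIntegral.integral_of_le hab,
    integral_Icc_eq_integral_Ioc, integral_Icc_eq_integral_Ioc]

/-- The force term in the Euler-Lagrange equation. -/
def Qf (G : Evec n → Evec n → ℝ) (Φ : Evec n → ℝ) (δ : ℝ) (q v : Evec n) : Evec n →L[ℝ] ℝ :=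
  (1 / 2 : ℝ) • dqCLM G q v + dchi δ (Φ q) • fderiv ℝ Φ q

lemma integrable_Qf (hG : IsFinslerEnergy n G ℓ α) (hΦ : ContDiff ℝ 2 Φ) (hδ : 0 < δ) (hab : a ≤ b)
    (γ : H1Curve n a b) (h : ∀ s ∈ Icc a b, Φ (γ.toFun s) < δ) :
    IntegrableOn (fun s => Qf G Φ δ (γ.toFun s) (γ.deriv s)) (Icc a b) := by
  refine Integrable.add ?_ (continuousOn_dchiΦ hΦ hδ (γ.continuousOn hab) h).integrableOn_Icc
  refine Integrable.smul (1 / 2 : ℝ) ?_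
  refine Integrable.mono' (γ.deriv_sq_integrable.const_mul ℓ)
    (hG.continuous_dq.comp_aestronglyMeasurable (γ.aesm hab)) ?_
  exact Eventually.of_forall fun s => hG.dq_norm_le _ _

lemma integrable_dv (hG : IsFinslerEnergy n G ℓ α) (hab : a ≤ b) (γ : H1Curve n a b) :
    IntegrableOn (fun s => (1 / 2 : ℝ) • dvCLM G (γ.toFun s) (γ.deriv s)) (Icc a b) := by
  refine Integrable.smul (1 / 2 : ℝ) ?_
  refine Integrable.mono' (γ.deriv_integrable.norm.const_mul ℓ)
    (hG.continuous_dv.comp_aestronglyMeasurable (γ.aesm hab)) ?_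
  exact Eventually.of_forall fun s => hG.dv_norm_le _ _

/-- The perturbed curve. -/
def pert (γ : H1Curve n a b) (ψ : ℝ → ℝ) (hψm : Measurable ψ) (C : ℝ)
    (hC : ∀ s, |ψ s| ≤ C) (e : Evec n) (ε : ℝ) : H1Curve n a b where
  toFun s := γ.toFun s + ε • ((∫ t in a..s, ψ t) • e)
  deriv s := γ.deriv s + ε • (ψ s • e)
  deriv_integrable := by
    refine γ.deriv_integrable.add (Integrable.smul ε ?_)
    refine Integrable.smul_const ?_ e
    refine Integrable.mono' (integrable_const C) hψm.aestronglyMeasurable ?_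
    exact Eventually.of_forall hC
  deriv_sq_integrable := by
    have hm : AEStronglyMeasurable (fun s => γ.deriv s + ε • (ψ s • e)) (volume.restrict (Icc a b)) :=
      γ.deriv_integrable.aestronglyMeasurable.add
        ((hψm.aestronglyMeasurable.smul_const e).const_smul ε)
    refine Integrable.mono' ((γ.deriv_sq_integrable.const_mul 2).add
      (integrable_const (2 * (|ε| * (C * ‖e‖)) ^ 2))) (hm.norm.pow 2) ?_
    refine Eventually.of_forall fun s => ?_
    simp only [norm_pow, norm_norm, Pi.add_apply]
    have h1 := norm_add_le (γ.deriv s) (ε • (ψ s • e))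
    have h2 : ‖ε • (ψ s • e)‖ ≤ |ε| * (C * ‖e‖) := by
      rw [norm_smul, norm_smul, Real.norm_eq_abs, Real.norm_eq_abs]
      have := hC s
      gcongr
    have h3 : ‖γ.deriv s + ε • (ψ s • e)‖ ≤ ‖γ.deriv s‖ + |ε| * (C * ‖e‖) := by linarith
    have h4 : ‖γ.deriv s + ε • (ψ s • e)‖ ^ 2 ≤ (‖γ.deriv s‖ + |ε| * (C * ‖e‖)) ^ 2 := by gcongr
    nlinarith [sq_nonneg (‖γ.deriv s‖ - |ε| * (C * ‖e‖))]
  eq_add_integral t ht := by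
    have hi : IntervalIntegrable γ.deriv volume a t :=
      (intervalIntegrable_iff_integrableOn_Icc_of_le ht.1).2
        (γ.deriv_integrable.mono_set (Icc_subset_Icc_right ht.2))
    have hψi : IntervalIntegrable ψ volume a t := by
      refine (intervalIntegrable_const (c := C)).mono_fun hψm.aestronglyMeasurable ?_
      exact Eventually.of_forall fun s => (hC s).trans (le_abs_self C)
    have hj : IntervalIntegrable (fun s => ε • (ψ s • e)) volume a t := by
      exact ((intervalIntegrable_iff.1 hψi).smul_const e |>.smul ε |> intervalIntegrable_iff.2)
    rw [intervalIntegral.integral_add hi hj, intervalIntegral.integral_smul,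
      intervalIntegral.integral_smul_const, γ.eq_add_integral t ht]
    simp
    abel

lemma first_variation (hG : IsFinslerEnergy n G ℓ α) (hΦ : ContDiff ℝ 2 Φ) (hδ : 0 < δ)
    (hab : a < b) {p q : Evec n} (γ : H1Curve n a b) (hγ : MemC Φ δ a b p q γ)
    (hmin : ∀ y : H1Curve n a b, MemC Φ δ a b p q y → Jpen G Φ δ a b γ ≤ Jpen G Φ δ a b y)
    (ψ : ℝ → ℝ) (hψm : Measurable ψ) (C : ℝ) (hC : ∀ s, |ψ s| ≤ C)
    (h0 : ∫ s in a..b, ψ s = 0) (e : Evec n) :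
    ∫ s in a..b, (Qf G Φ δ (γ.toFun s) (γ.deriv s) e * (∫ t in a..s, ψ t)
      + ((1 / 2 : ℝ) • dvCLM G (γ.toFun s) (γ.deriv s)) e * ψ s) = 0 := by
  set X : ℝ → ℝ := fun s => ∫ t in a..s, ψ t with hX
  have hC0 : 0 ≤ C := (abs_nonneg _).trans (hC 0)
  set CX : ℝ := C * (b - a) with hCX
  have hCX0 : 0 ≤ CX := mul_nonneg hC0 (by linarith)
  have hXb : ∀ s ∈ Icc a b, |X s| ≤ CX := by
    intro s hs
    have := intervalIntegral.norm_integral_le_of_norm_le_const (a := a) (b := s) (f := ψ) (C := C)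
      (fun x _ => hC x)
    rw [abs_of_nonneg (by linarith [hs.1])] at this
    refine this.trans ?_
    rw [hCX]
    have := hs.2
    gcongr
  have hγc := γ.continuousOn hab.le
  -- tubular neighbourhood
  have hKc : IsCompact (γ.toFun '' Icc a b) := isCompact_Icc.image_of_continuousOn hγc
  have hUo : IsOpen {x | Φ x < δ} := isOpen_lt hΦ.continuous continuous_const
  obtain ⟨r, hr, hsub⟩ := hKc.exists_cthickening_subset_open hUo (by
    rintro _ ⟨s, hs, rfl⟩; exact hγ.1 s hs)
  have hK' : IsCompact (Metric.cthickening r (γ.toFun '' Icc a b)) := hKc.cthickening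
  obtain ⟨M0, hM0⟩ := hK'.exists_bound_of_continuousOn
    (f := fun x => dchi δ (Φ x) • fderiv ℝ Φ x)
    (((continuousOn_dchi hδ).comp hΦ.continuous.continuousOn (fun x hx => hsub hx)).smul
      (hΦ.continuous_fderiv (by norm_num)).continuousOn)
  set ε0 : ℝ := min 1 (r / (CX * ‖e‖ + 1)) with hε0
  have hd : 0 < CX * ‖e‖ + 1 := by positivity
  have hε0p : 0 < ε0 := lt_min one_pos (div_pos hr hd)
  set y : ℝ → H1Curve n a b := pert γ ψ hψm C hC e with hy
  have hytf : ∀ ε s, (y ε).toFun s = γ.toFun s + ε • (X s • e) := fun _ _ => rfl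
  have hyd : ∀ ε s, (y ε).deriv s = γ.deriv s + ε • (ψ s • e) := fun _ _ => rfl
  have hmemK : ∀ ε ∈ Metric.ball (0 : ℝ) ε0, ∀ s ∈ Icc a b,
      (y ε).toFun s ∈ Metric.cthickening r (γ.toFun '' Icc a b) := by
    intro ε hε s hs
    refine Metric.mem_cthickening_of_dist_le _ (γ.toFun s) _ _ (mem_image_of_mem _ hs) ?_
    rw [hytf, dist_eq_norm, add_sub_cancel_left, norm_smul, norm_smul, Real.norm_eq_abs,
      Real.norm_eq_abs]
    have h1 : |ε| ≤ r / (CX * ‖e‖ + 1) := by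
      have : |ε| < ε0 := by simpa using hε
      exact this.le.trans (min_le_right _ _)
    calc |ε| * (|X s| * ‖e‖) ≤ r / (CX * ‖e‖ + 1) * (CX * ‖e‖ + 1) := by
          have := hXb s hs
          gcongr
          calc |X s| * ‖e‖ ≤ CX * ‖e‖ := by gcongr
            _ ≤ _ := by linarith
      _ = r := by field_simp
  have hyC : ∀ ε ∈ Metric.ball (0 : ℝ) ε0, MemC Φ δ a b p q (y ε) := by
    intro ε hε
    refine ⟨fun s hs => hsub (hmemK ε hε s hs), ?_, ?_⟩
    · rw [hytf]; simp [hX, hγ.2.1]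
    · rw [hytf]; simp [hX, h0, hγ.2.2]
  set μ := volume.restrict (Icc a b) with hμ
  set F : ℝ → ℝ → ℝ := fun ε s =>
    (1 / 2) * G ((y ε).toFun s) ((y ε).deriv s) + chi δ (Φ ((y ε).toFun s)) with hF
  set F' : ℝ → ℝ → ℝ := fun ε s =>
    (1 / 2) * (dqCLM G ((y ε).toFun s) ((y ε).deriv s) (X s • e)
      + dvCLM G ((y ε).toFun s) ((y ε).deriv s) (ψ s • e))
      + dchi δ (Φ ((y ε).toFun s)) * fderiv ℝ Φ ((y ε).toFun s) (X s • e) with hF'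
  have hFint : ∀ ε ∈ Metric.ball (0 : ℝ) ε0, Integrable (F ε) μ := fun ε hε =>
    ((integrable_G hG hab.le (y ε)).const_mul _).add (integrable_chi hΦ hδ hab.le (y ε) (hyC ε hε).1)
  have hball : Metric.ball (0 : ℝ) ε0 ∈ 𝓝 (0 : ℝ) := Metric.ball_mem_nhds _ hε0p
  have h0ball : (0 : ℝ) ∈ Metric.ball (0 : ℝ) ε0 := Metric.mem_ball_self hε0p
  have hy0t : ∀ s, (y 0).toFun s = γ.toFun s := fun s => by rw [hytf]; simp
  have hy0d : ∀ s, (y 0).deriv s = γ.deriv s := fun s => by rw [hyd]; simp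
  have hF'0 : ∀ s, F' 0 s = Qf G Φ δ (γ.toFun s) (γ.deriv s) e * X s
      + ((1 / 2 : ℝ) • dvCLM G (γ.toFun s) (γ.deriv s)) e * ψ s := by
    intro s
    simp only [hF', hy0t, hy0d, Qf, map_smul, smul_eq_mul, _root_.add_apply, _root_.smul_apply]
    ring
  have hXc : ContinuousOn X (Icc a b) := by
    have hψi : IntervalIntegrable ψ volume a b := by
      refine (intervalIntegrable_const (c := C)).mono_fun hψm.aestronglyMeasurable ?_
      exact Eventually.of_forall fun s => (hC s).trans (le_abs_self C)
    have := intervalIntegral.continuousOn_primitive_interval' hψi (a := a) (by simp)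
    rwa [uIcc_of_le hab.le] at this
  have hF'meas : AEStronglyMeasurable (F' 0) μ := by
    have : F' 0 = fun s => Qf G Φ δ (γ.toFun s) (γ.deriv s) e * X s
      + ((1 / 2 : ℝ) • dvCLM G (γ.toFun s) (γ.deriv s)) e * ψ s := funext hF'0
    rw [this]
    have h1 : AEStronglyMeasurable (fun s => Qf G Φ δ (γ.toFun s) (γ.deriv s) e) μ :=
      (integrable_Qf hG hΦ hδ hab.le γ hγ.1).aestronglyMeasurable.apply_continuousLinearMap e
    have h2 : AEStronglyMeasurable
        (fun s => ((1 / 2 : ℝ) • dvCLM G (γ.toFun s) (γ.deriv s)) e) μ :=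
      (integrable_dv hG hab.le γ).aestronglyMeasurable.apply_continuousLinearMap e
    exact (h1.mul (hXc.aestronglyMeasurable measurableSet_Icc)).add
      (h2.mul hψm.aestronglyMeasurable)
  set bd : ℝ → ℝ := fun s => (1 / 2) * (ℓ * (‖γ.deriv s‖ + C * ‖e‖) ^ 2 * (CX * ‖e‖)
    + ℓ * (‖γ.deriv s‖ + C * ‖e‖) * (C * ‖e‖)) + M0 * (CX * ‖e‖) with hbd
  have hbdi : Integrable bd μ := by
    have i1 : Integrable (fun s => ‖γ.deriv s‖) μ := γ.deriv_integrable.norm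
    have i2 : Integrable (fun s => ‖γ.deriv s‖ ^ 2) μ := γ.deriv_sq_integrable
    have i3 : Integrable (fun s => (‖γ.deriv s‖ + C * ‖e‖) ^ 2) μ := by
      have : (fun s => (‖γ.deriv s‖ + C * ‖e‖) ^ 2) = fun s =>
          ‖γ.deriv s‖ ^ 2 + (2 * (C * ‖e‖)) * ‖γ.deriv s‖ + (C * ‖e‖) ^ 2 := by
        funext s; ring
      rw [this]
      exact (i2.add (i1.const_mul _)).add (integrable_const _)
    have i4 : Integrable (fun s => ‖γ.deriv s‖ + C * ‖e‖) μ := i1.add (integrable_const _)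
    exact ((((i3.const_mul ℓ).mul_const _).add ((i4.const_mul ℓ).mul_const _)).const_mul _).add
      (integrable_const _)
  have hbound : ∀ᵐ s ∂μ, ∀ ε ∈ Metric.ball (0 : ℝ) ε0, ‖F' ε s‖ ≤ bd s := by
    filter_upwards [ae_restrict_mem measurableSet_Icc] with s hs ε hε
    have hε1 : |ε| ≤ 1 := by
      have : |ε| < ε0 := by simpa using hε
      exact this.le.trans (min_le_left _ _)
    have nX : ‖X s • e‖ ≤ CX * ‖e‖ := by
      rw [norm_smul]; have := hXb s hs; gcongr; exact this
    have nψ : ‖ψ s • e‖ ≤ C * ‖e‖ := by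
      rw [norm_smul]; have := hC s; gcongr; exact this
    have ny : ‖(y ε).deriv s‖ ≤ ‖γ.deriv s‖ + C * ‖e‖ := by
      rw [hyd]
      refine (norm_add_le _ _).trans ?_
      rw [norm_smul, Real.norm_eq_abs]
      have : |ε| * ‖ψ s • e‖ ≤ 1 * (C * ‖e‖) := by gcongr
      linarith
    have hl := hG.ell_pos
    have b1 : ‖dqCLM G ((y ε).toFun s) ((y ε).deriv s) (X s • e)‖
        ≤ ℓ * (‖γ.deriv s‖ + C * ‖e‖) ^ 2 * (CX * ‖e‖) := by
      refine (ContinuousLinearMap.le_opNorm _ _).trans ?_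
      have := hG.dq_norm_le ((y ε).toFun s) ((y ε).deriv s)
      gcongr
      refine this.trans ?_
      gcongr
    have b2 : ‖dvCLM G ((y ε).toFun s) ((y ε).deriv s) (ψ s • e)‖
        ≤ ℓ * (‖γ.deriv s‖ + C * ‖e‖) * (C * ‖e‖) := by
      refine (ContinuousLinearMap.le_opNorm _ _).trans ?_
      have := hG.dv_norm_le ((y ε).toFun s) ((y ε).deriv s)
      gcongr
      refine this.trans ?_
      gcongr
    have b3 : ‖dchi δ (Φ ((y ε).toFun s)) * fderiv ℝ Φ ((y ε).toFun s) (X s • e)‖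
        ≤ M0 * (CX * ‖e‖) := by
      have h1 := hM0 _ (hmemK ε hε s hs)
      have h2 := ContinuousLinearMap.le_opNorm
        (dchi δ (Φ ((y ε).toFun s)) • fderiv ℝ Φ ((y ε).toFun s)) (X s • e)
      rw [_root_.smul_apply, smul_eq_mul] at h2
      refine h2.trans ?_
      have := (norm_nonneg _).trans h1
      gcongr
    refine (norm_add_le _ _).trans (add_le_add ?_ b3)
    rw [norm_mul, Real.norm_of_nonneg (by norm_num : (0 : ℝ) ≤ 1 / 2)]
    gcongr
    exact (norm_add_le _ _).trans (add_le_add b1 b2)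
  have hdiff : ∀ᵐ s ∂μ, ∀ ε ∈ Metric.ball (0 : ℝ) ε0, HasDerivAt (F · s) (F' ε s) ε := by
    filter_upwards [ae_restrict_mem measurableSet_Icc] with s hs ε hε
    have d1 : HasDerivAt (fun ε => (y ε).toFun s) (X s • e) ε := by
      have : (fun ε => (y ε).toFun s) = fun ε => γ.toFun s + ε • (X s • e) := by
        funext ε; exact hytf ε s
      rw [this]
      simpa using ((hasDerivAt_id ε).smul_const (X s • e)).const_add (γ.toFun s)
    have d2 : HasDerivAt (fun ε => (y ε).deriv s) (ψ s • e) ε := by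
      have : (fun ε => (y ε).deriv s) = fun ε => γ.deriv s + ε • (ψ s • e) := by
        funext ε; exact hyd ε s
      rw [this]
      simpa using ((hasDerivAt_id ε).smul_const (ψ s • e)).const_add (γ.deriv s)
    have d3 : HasDerivAt (fun ε => G ((y ε).toFun s) ((y ε).deriv s))
        (dqCLM G ((y ε).toFun s) ((y ε).deriv s) (X s • e)
          + dvCLM G ((y ε).toFun s) ((y ε).deriv s) (ψ s • e)) ε := by
      have := (hG.hasFDerivAt ((y ε).toFun s) ((y ε).deriv s)).comp_hasDerivAt ε (d1.prodMk d2)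
      simpa [Function.comp_def] using this
    have d4 : HasDerivAt (fun ε => chi δ (Φ ((y ε).toFun s)))
        (dchi δ (Φ ((y ε).toFun s)) * fderiv ℝ Φ ((y ε).toFun s) (X s • e)) ε := by
      have h1 : HasDerivAt (fun ε => Φ ((y ε).toFun s)) (fderiv ℝ Φ ((y ε).toFun s) (X s • e)) ε :=
        ((hΦ.differentiable (by norm_num)) _).hasFDerivAt.comp_hasDerivAt ε d1
      exact (hasDerivAt_chi hδ ((hyC ε hε).1 s hs)).comp ε h1
    exact (d3.const_mul (1 / 2)).add d4
  have hmain := (hasDerivAt_integral_of_dominated_loc_of_deriv_le hball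
    (by filter_upwards [hball] with ε hε using (hFint ε hε).aestronglyMeasurable)
    (hFint 0 h0ball) hF'meas hbound hbdi hdiff).2
  have hlm : IsLocalMin (fun ε => ∫ s, F ε s ∂μ) 0 := by
    filter_upwards [hball] with ε hε
    have e1 := Jpen_eq hG hΦ hδ hab.le (y ε) (hyC ε hε).1
    have e0 := Jpen_eq hG hΦ hδ hab.le γ hγ.1
    have e2 : ∫ s, F 0 s ∂μ = Jpen G Φ δ a b γ := by
      rw [e0]; simp only [hF, hy0t, hy0d, hμ]
    have e3 : ∫ s, F ε s ∂μ = Jpen G Φ δ a b (y ε) := by rw [e1]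
    rw [e2, e3]
    exact hmin _ (hyC ε hε)
  have hz := hlm.hasDerivAt_eq_zero hmain
  rw [intervalIntegral.integral_of_le hab.le, ← integral_Icc_eq_integral_Ioc, ← hz]
  congr 1
  funext s
  exact (hF'0 s).symm

lemma euler_lagrange (hG : IsFinslerEnergy n G ℓ α) (hΦ : ContDiff ℝ 2 Φ) (hδ : 0 < δ)
    (hab : a < b) {p q : Evec n} (γ : H1Curve n a b) (hγ : MemC Φ δ a b p q γ)
    (hmin : ∀ y : H1Curve n a b, MemC Φ δ a b p q y → Jpen G Φ δ a b γ ≤ Jpen G Φ δ a b y) :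
    ∃ c : Evec n →L[ℝ] ℝ, ∀ᵐ s ∂(volume.restrict (Icc a b)),
      (1 / 2 : ℝ) • dvCLM G (γ.toFun s) (γ.deriv s) =
        c + ∫ t in a..s, Qf G Φ δ (γ.toFun t) (γ.deriv t) := by
  have hQ := integrable_Qf hG hΦ hδ hab.le γ hγ.1
  have hA := integrable_dv hG hab.le γ
  have h1 : ∀ i : Fin n, ∃ c : ℝ, ∀ᵐ s ∂(volume.restrict (Icc a b)),
      ((1 / 2 : ℝ) • dvCLM G (γ.toFun s) (γ.deriv s)) (EuclideanSpace.single i 1) = c +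
        ∫ t in a..s, Qf G Φ δ (γ.toFun t) (γ.deriv t) (EuclideanSpace.single i 1) := by
    intro i
    refine duBoisReymond hab ?_ ?_ ?_
    · exact ContinuousLinearMap.integrable_comp (ContinuousLinearMap.apply ℝ ℝ _) hA
    · exact ContinuousLinearMap.integrable_comp (ContinuousLinearMap.apply ℝ ℝ _) hQ
    · rintro ψ hψm ⟨C, hC⟩ h0
      exact first_variation hG hΦ hδ hab γ hγ hmin ψ hψm C hC h0 _
  choose c hc using h1
  refine ⟨∑ i, c i • (EuclideanSpace.proj i : Evec n →L[ℝ] ℝ), ?_⟩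
  rw [← ae_all_iff] at hc
  filter_upwards [hc, ae_restrict_mem measurableSet_Icc] with s hs hsm
  have hi : IntervalIntegrable (fun t => Qf G Φ δ (γ.toFun t) (γ.deriv t)) volume a s :=
    (intervalIntegrable_iff_integrableOn_Icc_of_le hsm.1).2
        (hQ.mono_set (Icc_subset_Icc_right hsm.2))
  have hb := (EuclideanSpace.basisFun (Fin n) ℝ).toBasis
  refine ContinuousLinearMap.coe_injective ((EuclideanSpace.basisFun (Fin n) ℝ).toBasis.ext ?_)
  intro i
  have h2 := hs i
  simp only [OrthonormalBasis.coe_toBasis, EuclideanSpace.basisFun_apply,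
    ContinuousLinearMap.coe_coe, _root_.add_apply]
  rw [h2, ContinuousLinearMap.intervalIntegral_apply hi]
  congr 1
  simp [_root_.sum_apply]
end EL


lemma hasDerivWithinAt_primitive {F : Type*} [NormedAddCommGroup F] [NormedSpace ℝ F]
    [CompleteSpace F] {a b : ℝ} (hab : a ≤ b) {f u : ℝ → F} (hf : ContinuousOn f (Icc a b))
    (u0 : F) (hu : ∀ t ∈ Icc a b, u t = u0 + ∫ s in a..t, f s) {t : ℝ} (ht : t ∈ Icc a b) :
    HasDerivWithinAt u (f t) (Icc a b) t := by
  set g : ℝ → F := IccExtend hab ((Icc a b).restrict f) with hg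
  have hgc : Continuous g := (continuousOn_iff_continuous_domRestrict.1 hf).Icc_extend'
  have hgf : ∀ s ∈ Icc a b, g s = f s := fun s hs => by
    rw [hg, IccExtend_of_mem _ _ hs]; rfl
  have h1 : HasDerivAt (fun t => u0 + ∫ s in a..t, g s) (g t) t :=
    (hgc.integral_hasStrictDerivAt a t).hasDerivAt.const_add u0
  rw [hgf t ht] at h1
  have h2 : ∀ t ∈ Icc a b, u t = u0 + ∫ s in a..t, g s := by
    intro t ht
    rw [hu t ht]
    congr 1
    refine intervalIntegral.integral_congr fun s hs => ?_
    rw [uIcc_of_le ht.1] at hs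
    exact (hgf s ⟨hs.1, hs.2.trans ht.2⟩).symm
  exact h1.hasDerivWithinAt.congr h2 (h2 t ht)

lemma le_of_support {a b : ℝ} (hab : a ≤ b) {e : ℝ → ℝ} (he : ContinuousOn e (Icc a b))
    (h : ∀ s ∈ Icc a b, ∃ g : ℝ → ℝ, HasDerivWithinAt g 0 (Icc a b) s ∧ g s = 0 ∧
      ∀ t ∈ Icc a b, g t ≤ e t - e s) : e a ≤ e b := by
  have := image_le_of_liminf_slope_right_le_deriv_boundary (f := fun s => - e s) (a := a) (b := b)
    he.neg (B := fun _ => - e a) (B' := fun _ => 0) le_rfl continuousOn_const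
    (fun x _ => hasDerivWithinAt_const _ _ _) (by
      intro x hx r hr
      obtain ⟨g, hg, hg0, hge⟩ := h x ⟨hx.1, hx.2.le⟩
      have h1 : HasDerivWithinAt g 0 (Ioo x b) x :=
        hg.mono (fun y hy => ⟨hx.1.trans hy.1.le, hy.2.le⟩)
      rw [hasDerivWithinAt_iff_tendsto_slope' (by simp), nhdsWithin_Ioo_eq_nhdsGT hx.2] at h1
      have h2 : ∀ᶠ z in 𝓝[>] x, -r < slope g x z := h1.eventually (lt_mem_nhds (by linarith))
      have h3 : ∀ᶠ z in 𝓝[>] x, z ∈ Ioo x b := Ioo_mem_nhdsGT hx.2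
      refine Eventually.frequently ?_
      filter_upwards [h2, h3] with z hz hzm
      have h4 := hge z ⟨hx.1.trans hzm.1.le, hzm.2.le⟩
      have hp : 0 < z - x := by linarith [hzm.1]
      rw [slope_def_field, hg0, sub_zero, lt_div_iff₀ hp] at hz
      rw [slope_def_field, div_lt_iff₀ hp]
      linarith)
  have h := this (x := b) ⟨hab, le_rfl⟩
  simpa using h

lemma const_of_support {a b : ℝ} {e : ℝ → ℝ} (he : ContinuousOn e (Icc a b))
    (h : ∀ s ∈ Icc a b, ∃ g : ℝ → ℝ, HasDerivWithinAt g 0 (Icc a b) s ∧ g s = 0 ∧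
      ∀ t ∈ Icc a b, g t ≤ e t - e s) {x : ℝ} (hx : x ∈ Icc a b) : e x = e a := by
  have hsub : Icc a x ⊆ Icc a b := Icc_subset_Icc_right hx.2
  have hmaps : ∀ s ∈ Icc a x, a + x - s ∈ Icc a x := fun s hs =>
    ⟨by linarith [hs.2], by linarith [hs.1]⟩
  refine le_antisymm ?_ ?_
  · have := le_of_support hx.1 (e := fun s => e (a + x - s))
      ((he.mono hsub).comp (by fun_prop) hmaps) (by
        intro s hs
        obtain ⟨g, hg, hg0, hge⟩ := h (a + x - s) (hsub (hmaps s hs))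
        refine ⟨fun t => g (a + x - t), ?_, hg0, fun t ht => hge _ (hsub (hmaps t ht))⟩
        have h1 : HasDerivWithinAt (fun t => a + x - t) (-1) (Icc a x) s := by
          simpa using (hasDerivWithinAt_id s (Icc a x)).const_sub (a + x)
        have := HasDerivWithinAt.scomp (t' := Icc a x) s (hg.mono hsub) h1 hmaps
        simpa [Function.comp_def] using this)
    simpa using this
  · exact le_of_support hx.1 (he.mono hsub) (fun s hs => by
      obtain ⟨g, hg, hg0, hge⟩ := h s (hsub hs)
      exact ⟨g, hg.mono hsub, hg0, fun t ht => hge t (hsub ht)⟩)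

section Reg
variable {n : ℕ} {G : Evec n → Evec n → ℝ} {ℓ α : ℝ} {Φ : Evec n → ℝ} {a b δ : ℝ}

lemma regularity (hG : IsFinslerEnergy n G ℓ α) (hΦ : ContDiff ℝ 2 Φ) (hδ : 0 < δ)
    (hab : a < b) {p q : Evec n} (γ : H1Curve n a b) (hγ : MemC Φ δ a b p q γ)
    (hmin : ∀ y : H1Curve n a b, MemC Φ δ a b p q y → Jpen G Φ δ a b γ ≤ Jpen G Φ δ a b y) :
    ∃ v : ℝ → Evec n, ContinuousOn v (Icc a b) ∧
      (∀ᵐ s ∂(volume.restrict (Icc a b)), γ.deriv s = v s) ∧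
      (∀ t ∈ Icc a b, HasDerivWithinAt γ.toFun (v t) (Icc a b) t) ∧
      (∀ t ∈ Icc a b, HasDerivWithinAt (fun t => dvCLM G (γ.toFun t) (v t))
        ((2 : ℝ) • Qf G Φ δ (γ.toFun t) (v t)) (Icc a b) t) := by
  obtain ⟨c, hc⟩ := euler_lagrange hG hΦ hδ hab γ hγ hmin
  have hQ := integrable_Qf hG hΦ hδ hab.le γ hγ.1
  have hγc := γ.continuousOn hab.le
  set P : ℝ → (Evec n →L[ℝ] ℝ) := fun s =>
    (2 : ℝ) • (c + ∫ t in a..s, Qf G Φ δ (γ.toFun t) (γ.deriv t)) with hP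
  choose v hv using fun s => hG.dv_surj (γ.toFun s) (P s)
  have hPc : ContinuousOn P (Icc a b) := by
    have := intervalIntegral.continuousOn_primitive_interval (a := a) (b := b)
      (f := fun t => Qf G Φ δ (γ.toFun t) (γ.deriv t)) (μ := volume) (by rwa [uIcc_of_le hab.le])
    rw [uIcc_of_le hab.le] at this
    exact (continuousOn_const.add this).const_smul (2 : ℝ)
  have hvc : ContinuousOn v (Icc a b) := by
    intro s0 hs0
    have h1 : Tendsto (fun s => P s - dvCLM G (γ.toFun s) (v s0)) (𝓝[Icc a b] s0) (𝓝 0) := by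
      have h2 : ContinuousWithinAt (fun s => dvCLM G (γ.toFun s) (v s0)) (Icc a b) s0 :=
        hG.continuous_dv.continuousAt.comp_continuousWithinAt
          ((hγc s0 hs0).prodMk continuousWithinAt_const)
      have h3 := Filter.Tendsto.sub (hPc s0 hs0) h2
      simpa [hv] using h3
    rw [ContinuousWithinAt, tendsto_iff_norm_sub_tendsto_zero]
    refine squeeze_zero (fun _ => norm_nonneg _) (g := fun s =>
      α⁻¹ * ‖P s - dvCLM G (γ.toFun s) (v s0)‖) (fun s => ?_) ?_
    · have h4 := hG.dist_le (γ.toFun s) (v s) (v s0)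
      rw [hv] at h4
      rw [← div_eq_inv_mul, le_div_iff₀ hG.alpha_pos]
      linarith
    · simpa using h1.norm.const_mul α⁻¹
  have hae : ∀ᵐ s ∂(volume.restrict (Icc a b)), γ.deriv s = v s := by
    filter_upwards [hc] with s hs
    refine hG.dv_inj (γ.toFun s) _ _ ?_
    rw [hv, hP]
    simp only
    rw [← hs, smul_smul]
    norm_num
  have hae' : ∀ t ∈ Icc a b, ∀ᵐ s, s ∈ uIoc a t → γ.deriv s = v s := by
    intro t ht
    rw [ae_restrict_iff' measurableSet_Icc] at hae
    filter_upwards [hae] with s hs hsm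
    rw [uIoc_of_le ht.1] at hsm
    exact hs ⟨hsm.1.le, hsm.2.trans ht.2⟩
  refine ⟨v, hvc, hae, ?_, ?_⟩
  · intro t ht
    refine hasDerivWithinAt_primitive hab.le hvc (γ.toFun a) (fun t ht => ?_) ht
    rw [γ.eq_add_integral t ht]
    congr 1
    exact intervalIntegral.integral_congr_ae (hae' t ht)
  · intro t ht
    have hQc : ContinuousOn (fun t => (2 : ℝ) • Qf G Φ δ (γ.toFun t) (v t)) (Icc a b) := by
      refine ContinuousOn.const_smul ?_ (2 : ℝ)
      refine ContinuousOn.add ?_ (continuousOn_dchiΦ hΦ hδ hγc hγ.1)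
      exact (hG.continuous_dq.comp_continuousOn (hγc.prodMk hvc)).const_smul (1 / 2 : ℝ)
    refine hasDerivWithinAt_primitive hab.le hQc ((2 : ℝ) • c) (fun t ht => ?_) ht
    rw [hv, hP, intervalIntegral.integral_smul]
    simp only [smul_add]
    congr 2
    refine intervalIntegral.integral_congr_ae ?_
    filter_upwards [hae' t ht] with s hs hsm
    rw [hs hsm]

/-- Conservation of energy. -/
lemma energy_const (hG : IsFinslerEnergy n G ℓ α) (hΦ : ContDiff ℝ 2 Φ) (hδ : 0 < δ)
    {γ v : ℝ → Evec n} (hγ : ∀ s ∈ Icc a b, Φ (γ s) < δ)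
    (hvc : ContinuousOn v (Icc a b))
    (hγd : ∀ t ∈ Icc a b, HasDerivWithinAt γ (v t) (Icc a b) t)
    (hPd : ∀ t ∈ Icc a b, HasDerivWithinAt (fun t => dvCLM G (γ t) (v t))
        ((2 : ℝ) • Qf G Φ δ (γ t) (v t)) (Icc a b) t) {x : ℝ} (hx : x ∈ Icc a b) :
    (1 / 2) * G (γ x) (v x) - chi δ (Φ (γ x)) = (1 / 2) * G (γ a) (v a) - chi δ (Φ (γ a)) := by
  have hγc : ContinuousOn γ (Icc a b) := fun t ht => (hγd t ht).continuousWithinAt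
  refine const_of_support (e := fun x => (1 / 2) * G (γ x) (v x) - chi δ (Φ (γ x))) ?_ ?_ hx
  · exact (continuousOn_const.mul (hG.continuous.comp_continuousOn (hγc.prodMk hvc))).sub
      (continuousOn_chiΦ hΦ hδ hγc hγ)
  · intro s hs
    refine ⟨fun t => (1 / 2) * (dvCLM G (γ t) (v t) (v s) - dvCLM G (γ s) (v s) (v s))
      - (1 / 2) * (G (γ t) (v s) - G (γ s) (v s)) - (chi δ (Φ (γ t)) - chi δ (Φ (γ s))), ?_, ?_, ?_⟩
    · have d1 : HasDerivWithinAt (fun t => dvCLM G (γ t) (v t) (v s))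
          (((2 : ℝ) • Qf G Φ δ (γ s) (v s)) (v s)) (Icc a b) s := by
        simpa using (hPd s hs).clm_apply (hasDerivWithinAt_const s (Icc a b) (v s))
      have d2 : HasDerivWithinAt (fun t => G (γ t) (v s)) (dqCLM G (γ s) (v s) (v s)) (Icc a b) s :=
        (hG.hasFDerivAt_dq (γ s) (v s)).comp_hasDerivWithinAt s (hγd s hs)
      have d3 : HasDerivWithinAt (fun t => chi δ (Φ (γ t)))
          (dchi δ (Φ (γ s)) * fderiv ℝ Φ (γ s) (v s)) (Icc a b) s := by
        have h1 : HasDerivWithinAt (fun t => Φ (γ t)) (fderiv ℝ Φ (γ s) (v s)) (Icc a b) s :=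
          ((hΦ.differentiable (by norm_num)) _).hasFDerivAt.comp_hasDerivWithinAt s (hγd s hs)
        exact (hasDerivAt_chi hδ (hγ s hs)).comp_hasDerivWithinAt s h1
      refine ((((d1.sub_const _).const_mul (1 / 2)).sub ((d2.sub_const _).const_mul (1 / 2))).sub
        (d3.sub_const _)).congr_deriv ?_
      simp only [Qf, _root_.smul_apply, _root_.add_apply, smul_eq_mul]
      ring
    · simp
    · intro t ht
      have h1 := hG.convex_ineq (γ t) (v s) (v t)
      rw [map_sub, hG.euler] at h1
      rw [hG.euler]
      linarith

lemma vel_deriv (hG : IsFinslerEnergy n G ℓ α) {γ v : ℝ → Evec n} {s0 : ℝ} {w : Evec n}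
    {P' : Evec n →L[ℝ] ℝ} (hv0 : v s0 ≠ 0) (hγ : HasDerivAt γ w s0) (hv : ContinuousAt v s0)
    (hP : HasDerivAt (fun s => dvCLM G (γ s) (v s)) P' s0) :
    ∃ D : Evec n, HasDerivAt v D s0 ∧
      fderiv ℝ (fun p : Evec n × Evec n => dvCLM G p.1 p.2) (γ s0, v s0) (w, D) = P' ∧
      α * ‖D‖ ^ 2 ≤
        fderiv ℝ (fun p : Evec n × Evec n => dvCLM G p.1 p.2) (γ s0, v s0) (0, D) D := by
  set g : Evec n × Evec n → (Evec n →L[ℝ] ℝ) := fun p => dvCLM G p.1 p.2 with hg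
  have hcd : ContDiffAt ℝ 1 g (γ s0, v s0) :=
    hG.contDiffOn_dv.contDiffAt (IsFinslerEnergy.isOpen_ne.mem_nhds hv0)
  set B := fderiv ℝ g (γ s0, v s0) with hB
  have hgs : HasStrictFDerivAt g B (γ s0, v s0) := hcd.hasStrictFDerivAt (by norm_num)
  have hconv : ∀ D : Evec n, α * ‖D‖ ^ 2 ≤ B (0, D) D := by
    intro D
    have h1 := hG.vv_convex (γ s0) (v s0) hv0 D
    have h2 : HasFDerivAt (fun u => g (γ s0, u)) (B.comp (ContinuousLinearMap.inr ℝ _ _)) (v s0) :=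
      HasFDerivAt.comp (g := g) (f := fun u => (γ s0, u)) (v s0) hgs.hasFDerivAt
        (hasFDerivAt_prodMk_right (𝕜 := ℝ) (γ s0) (v s0))
    have h3 := h2.clm_apply (hasFDerivAt_const D (v s0))
    have h4 : fderiv ℝ (fun u => dvCLM G (γ s0) u D) (v s0) D = B (0, D) D := by
      rw [h3.fderiv]
      simp
    rwa [h4] at h1
  set F : Evec n × Evec n → Evec n × (Evec n →L[ℝ] ℝ) := fun p => (p.1, g p) with hF
  set F' : Evec n × Evec n →L[ℝ] Evec n × (Evec n →L[ℝ] ℝ) :=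
    (ContinuousLinearMap.fst ℝ _ _).prod B with hF'
  have hFs : HasStrictFDerivAt F F' (γ s0, v s0) := hasStrictFDerivAt_fst.prodMk hgs
  have hinj : Function.Injective F' := by
    rw [injective_iff_map_eq_zero]
    rintro ⟨x, y⟩ hxy
    simp only [hF', ContinuousLinearMap.prod_apply, ContinuousLinearMap.coe_fst', Prod.mk_eq_zero] at hxy
    obtain ⟨rfl, h2⟩ := hxy
    have h3 := hconv y
    rw [h2, _root_.zero_apply] at h3
    have h4 : ‖y‖ ^ 2 ≤ 0 := by
      by_contra h5
      push Not at h5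
      have := mul_pos hG.alpha_pos h5
      linarith
    have h5 : ‖y‖ = 0 := by nlinarith [norm_nonneg y]
    rw [norm_eq_zero.1 h5]
    rfl
  have hfr : Module.finrank ℝ (Evec n × Evec n) =
      Module.finrank ℝ (Evec n × (Evec n →L[ℝ] ℝ)) := by
    rw [Module.finrank_prod, Module.finrank_prod,
      (InnerProductSpace.toDual ℝ (Evec n)).toLinearEquiv.finrank_eq]
  set Le : (Evec n × Evec n) ≃L[ℝ] (Evec n × (Evec n →L[ℝ] ℝ)) :=
    (LinearEquiv.ofInjectiveOfFinrankEq (F' : Evec n × Evec n →ₗ[ℝ] Evec n × (Evec n →L[ℝ] ℝ)) hinj hfr).toContinuousLinearEquiv with hLe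
  have hLeF : (Le : Evec n × Evec n →L[ℝ] Evec n × (Evec n →L[ℝ] ℝ)) = F' := by
    exact ContinuousLinearMap.ext fun x => rfl
  have hFs' : HasStrictFDerivAt F (Le : Evec n × Evec n →L[ℝ] Evec n × (Evec n →L[ℝ] ℝ))
      (γ s0, v s0) := by rw [hLeF]; exact hFs
  have hleft := hFs'.eventually_left_inverse
  have hinv := hFs'.to_localInverse.hasFDerivAt
  have hcont : Tendsto (fun s => (γ s, v s)) (𝓝 s0) (𝓝 (γ s0, v s0)) :=
    hγ.continuousAt.prodMk hv
  have hcurve : HasDerivAt (fun s => F (γ s, v s)) (w, P') s0 := hγ.prodMk hP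
  have hcomp := hinv.comp_hasDerivAt s0 hcurve
  have hvd : ∃ D, HasDerivAt v D s0 := by
    have hsnd := (ContinuousLinearMap.snd ℝ (Evec n) (Evec n)).hasFDerivAt.comp_hasDerivAt s0 hcomp
    refine ⟨_, hsnd.congr_of_eventuallyEq ?_⟩
    filter_upwards [hcont.eventually hleft] with s hs
    simp only [Function.comp]
    rw [hs]
    rfl
  obtain ⟨D, hD⟩ := hvd
  refine ⟨D, hD, ?_, hconv D⟩
  have h1 : HasDerivAt (fun s => g (γ s, v s)) (B (w, D)) s0 :=
    HasFDerivAt.comp_hasDerivAt (l := g) (f := fun s => (γ s, v s)) s0 hgs.hasFDerivAt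
      (hγ.prodMk hD)
  exact h1.unique hP

/-- second derivative at a local max -/
lemma second_deriv_nonpos {f f' : ℝ → ℝ} {s0 D : ℝ} (hmax : IsLocalMax f s0)
    (hf : ∀ᶠ s in 𝓝 s0, HasDerivAt f (f' s) s) (hf' : HasDerivAt f' D s0) : D ≤ 0 := by
  by_contra hD
  push Not at hD
  have he : deriv f =ᶠ[𝓝 s0] f' := hf.mono fun s hs => hs.deriv
  have h1 : HasDerivAt (deriv f) D s0 := hf'.congr_of_eventuallyEq he
  have h2 : deriv f s0 = 0 := hmax.deriv_eq_zero
  have h3 : IsLocalMin f s0 := isLocalMin_of_deriv_deriv_pos (by rw [h1.deriv]; exact hD) h2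
    hf.self_of_nhds.continuousAt
  have h4 : f =ᶠ[𝓝 s0] fun _ => f s0 := by
    filter_upwards [hmax, h3] with s h5 h6 using le_antisymm h5 h6
  have h5 : deriv f =ᶠ[𝓝 s0] fun _ => 0 := by
    have := h4.deriv
    simpa using this
  have h6 : HasDerivAt (deriv f) 0 s0 := (hasDerivAt_const s0 (0 : ℝ)).congr_of_eventuallyEq h5
  exact hD.ne' (h1.unique h6)

end Reg


lemma alg_bound {D V X m H L k α : ℝ} (hD : 0 ≤ D) (hV : 0 ≤ V) (hm : 0 ≤ m)
    (hH : 0 ≤ H) (hL : 0 ≤ L) (hk : 0 ≤ k) (hα : 0 < α)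
    (h1 : α * D ^ 2 ≤ 2 * X * H * V + k * V * D) (h2 : 2 * X ≤ m * (L * D + k * V)) :
    X ≤ m * (L * (1 + ((m * H * L + k) + m * H * k) / α) + k) / 2 * V := by
  have hDV : D ≤ (1 + ((m * H * L + k) + m * H * k) / α) * V := by
    have hS : 0 ≤ ((m * H * L + k) + m * H * k) := by positivity
    rcases le_total D V with h | h
    · have : 0 ≤ ((m * H * L + k) + m * H * k) / α * V := by positivity
      linarith
    · rcases hD.eq_or_lt with h0 | h0
      · rw [← h0]; positivity
      have h3 : 2 * X * H * V ≤ m * (L * D + k * V) * (H * V) := by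
        have := mul_le_mul_of_nonneg_right h2 (mul_nonneg hH hV)
        linarith
      have h4 : m * H * k * V * V ≤ m * H * k * V * D :=
        mul_le_mul_of_nonneg_left h (by positivity)
      have h5 : (α * D) * D ≤ (((m * H * L + k) + m * H * k) * V) * D := by nlinarith
      have h6 := le_of_mul_le_mul_right h5 h0
      have h7 : D ≤ ((m * H * L + k) + m * H * k) / α * V := by
        rw [div_mul_eq_mul_div, le_div_iff₀ hα]; linarith
      linarith
  have h3 : m * (L * D) ≤ m * (L * ((1 + ((m * H * L + k) + m * H * k) / α) * V)) := by gcongr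
  linarith

section Fin
variable {n : ℕ} {G : Evec n → Evec n → ℝ} {ℓ α : ℝ} {Φ : Evec n → ℝ} {a b δ δ₀ : ℝ}

lemma consts (hΦ : IsRegularDomain n Φ δ₀) : ∃ H m : ℝ, 0 ≤ H ∧ 0 ≤ m ∧
    (∀ x, Φ x ≤ δ₀ → ‖fderiv ℝ (fderiv ℝ Φ) x‖ ≤ H) ∧
    (∀ x, |Φ x| ≤ δ₀ → 1 ≤ m * ‖fderiv ℝ Φ x‖) := by
  have hK := hΦ.sublevel_compact δ₀ ⟨hΦ.delta0_pos.le, le_rfl⟩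
  have c1 : ContDiff ℝ 1 (fderiv ℝ Φ) := hΦ.smooth.fderiv_right (by norm_num)
  have c2 : Continuous (fderiv ℝ (fderiv ℝ Φ)) := c1.continuous_fderiv (by norm_num)
  obtain ⟨H, hH⟩ := hK.exists_bound_of_continuousOn
    (f := fderiv ℝ (fderiv ℝ Φ)) c2.continuousOn
  have hK2 : IsCompact {x | |Φ x| ≤ δ₀} := by
    refine hK.of_isClosed_subset (isClosed_le hΦ.smooth.continuous.abs continuous_const) ?_
    intro x hx
    exact (le_abs_self (Φ x)).trans (by simpa using hx)
  have hne : ∀ x, |Φ x| ≤ δ₀ → ‖fderiv ℝ Φ x‖ ≠ 0 := by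
    intro x hx h0
    refine hΦ.grad_ne_zero x hx ?_
    rw [norm_eq_zero] at h0
    simp [gradient, h0]
  obtain ⟨m, hm⟩ := hK2.exists_bound_of_continuousOn (f := fun x => (‖fderiv ℝ Φ x‖)⁻¹)
    ((c1.continuous.norm.continuousOn).inv₀ hne)
  refine ⟨|H|, |m|, abs_nonneg _, abs_nonneg _, fun x hx => (hH x hx).trans (le_abs_self _), ?_⟩
  intro x hx
  have h1 := (hm x hx).trans (le_abs_self m)
  simp only [norm_inv, norm_norm] at h1
  have h2 : 0 < ‖fderiv ℝ Φ x‖ := lt_of_le_of_ne (norm_nonneg _) (hne x hx).symm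
  rwa [inv_le_iff_one_le_mul₀ h2] at h1

/-- The estimate at an interior maximum point. -/
lemma max_est (hG : IsFinslerEnergy n G ℓ α) (hΦ : ContDiff ℝ 2 Φ)
    {γ v : ℝ → Evec n} {s0 X L H m : ℝ} (hX : 0 ≤ X) (hL0 : 0 ≤ L) (hH0 : 0 ≤ H) (hm0 : 0 ≤ m)
    (hγ : ∀ᶠ s in 𝓝 s0, HasDerivAt γ (v s) s) (hv : ContinuousAt v s0) (hv0 : v s0 ≠ 0)
    (hP : HasDerivAt (fun s => dvCLM G (γ s) (v s))
      (dqCLM G (γ s0) (v s0) + (2 * X) • fderiv ℝ Φ (γ s0)) s0)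
    (hmax : IsLocalMax (fun s => Φ (γ s)) s0)
    (hL : ∀ ξ η, ‖fderiv ℝ (fun p : Evec n × Evec n => dvCLM G p.1 p.2) (γ s0, v s0) (ξ, η)‖
      ≤ L * (‖v s0‖ * ‖ξ‖ + ‖η‖))
    (hH : ‖fderiv ℝ (fderiv ℝ Φ) (γ s0)‖ ≤ H) (hm : 1 ≤ m * ‖fderiv ℝ Φ (γ s0)‖) :
    X ≤ m * (L * (1 + ((m * H * L + (ℓ + L)) + m * H * (ℓ + L)) / α) + (ℓ + L)) / 2
      * ‖v s0‖ ^ 2 := by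
  obtain ⟨D, hD, hB, hconv⟩ := vel_deriv hG hv0 hγ.self_of_nhds hv hP
  set B := fderiv ℝ (fun p : Evec n × Evec n => dvCLM G p.1 p.2) (γ s0, v s0) with hBdef
  set ν := fderiv ℝ Φ (γ s0) with hν
  have hdq := hG.dq_norm_le (γ s0) (v s0)
  have c1 : ContDiff ℝ 1 (fderiv ℝ Φ) := hΦ.fderiv_right (by norm_num)
  have hνD : ν D ≤ H * ‖v s0‖ ^ 2 := by
    have d1 : HasDerivAt (fun s => fderiv ℝ Φ (γ s))
        (fderiv ℝ (fderiv ℝ Φ) (γ s0) (v s0)) s0 :=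
      ((c1.differentiable (by norm_num)) _).hasFDerivAt.comp_hasDerivAt s0 hγ.self_of_nhds
    have d2 := d1.clm_apply hD
    have h := second_deriv_nonpos hmax (hγ.mono fun s hs =>
      ((hΦ.differentiable (by norm_num)) _).hasFDerivAt.comp_hasDerivAt s hs) d2
    have h2 : ‖fderiv ℝ (fderiv ℝ Φ) (γ s0) (v s0) (v s0)‖ ≤ H * ‖v s0‖ ^ 2 := by
      calc _ ≤ ‖fderiv ℝ (fderiv ℝ Φ) (γ s0)‖ * ‖v s0‖ * ‖v s0‖ :=
            ContinuousLinearMap.le_opNorm₂ _ _ _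
        _ ≤ H * ‖v s0‖ * ‖v s0‖ := by gcongr
        _ = _ := by ring
    rw [Real.norm_eq_abs] at h2
    have h3 := neg_abs_le (fderiv ℝ (fderiv ℝ Φ) (γ s0) (v s0) (v s0))
    linarith
  have hℓ := hG.ell_pos
  refine alg_bound (norm_nonneg D) (by positivity) hm0 hH0 hL0 (by positivity) hG.alpha_pos ?_ ?_
  · have e : B (0, D) = dqCLM G (γ s0) (v s0) + (2 * X) • ν - B (v s0, 0) := by
      rw [← hB, ← map_sub]; simp
    rw [e] at hconv
    simp only [_root_.sub_apply, _root_.add_apply, _root_.smul_apply, smul_eq_mul] at hconv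
    have e1 : dqCLM G (γ s0) (v s0) D ≤ ℓ * ‖v s0‖ ^ 2 * ‖D‖ :=
      (le_abs_self _).trans (((dqCLM G (γ s0) (v s0)).le_opNorm D).trans (by gcongr))
    have e2 : - B (v s0, 0) D ≤ L * ‖v s0‖ ^ 2 * ‖D‖ := by
      refine (neg_le_abs _).trans (((B (v s0, 0)).le_opNorm D).trans ?_)
      have := hL (v s0) 0
      rw [norm_zero, add_zero] at this
      gcongr
      linarith [sq (‖v s0‖)]
    have e3 : 2 * X * ν D ≤ 2 * X * (H * ‖v s0‖ ^ 2) := by gcongr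
    linarith
  · have e : (2 * X) • ν = B (v s0, D) - dqCLM G (γ s0) (v s0) := by rw [hB]; abel
    have e1 : 2 * X * ‖ν‖ ≤ L * ‖D‖ + (ℓ + L) * ‖v s0‖ ^ 2 := by
      have h1 : ‖(2 * X) • ν‖ = 2 * X * ‖ν‖ := by
        rw [norm_smul, Real.norm_of_nonneg (by positivity)]
      rw [← h1, e]
      refine (norm_sub_le _ _).trans ?_
      have := hL (v s0) D
      linarith [sq (‖v s0‖)]
    calc 2 * X ≤ 2 * X * (m * ‖ν‖) := le_mul_of_one_le_right (by positivity) hm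
      _ = m * (2 * X * ‖ν‖) := by ring
      _ ≤ _ := by gcongr

end Fin


lemma energy_le {n : ℕ} {G : Evec n → Evec n → ℝ} {ℓ α : ℝ} (hG : IsFinslerEnergy n G ℓ α)
    {Φ : Evec n → ℝ} {a b δ e : ℝ} (hΦ : ContDiff ℝ 2 Φ) (hδ : 0 < δ) (hab : a < b)
    (γ : H1Curve n a b) (h : ∀ s ∈ Icc a b, Φ (γ.toFun s) < δ) {v : ℝ → Evec n}
    (hae : ∀ᵐ s ∂(volume.restrict (Icc a b)), γ.deriv s = v s)
    (he : ∀ s ∈ Icc a b, (1 / 2) * G (γ.toFun s) (v s) - chi δ (Φ (γ.toFun s)) = e) :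
    (b - a) * e ≤ Jpen G Φ δ a b γ := by
  rw [Jpen_eq hG hΦ hδ hab.le γ h]
  have h1 : ∫ _ in Icc a b, e = (b - a) * e := by
    simp [hab.le]
  rw [← h1]
  refine integral_mono_ae (by simp) (((integrable_G hG hab.le γ).const_mul _).add
    (integrable_chi hΦ hδ hab.le γ h)) ?_
  filter_upwards [hae, ae_restrict_mem measurableSet_Icc] with s hs hsm
  have h2 := he s hsm
  have h3 := chi_nonneg δ (Φ (γ.toFun s))
  simp only [hs]
  linarith

lemma single_est {n : ℕ} {G : Evec n → Evec n → ℝ} {ℓ α : ℝ} (hG : IsFinslerEnergy n G ℓ α)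
    {Φ : Evec n → ℝ} {a b δ δ₀ H m L K₀ C : ℝ} (hΦ : ContDiff ℝ 2 Φ) (hδ : 0 < δ) (hδ₀ : δ < δ₀)
    (hab : a < b) {p q : Evec n} (γ : H1Curve n a b) (hγ : MemC Φ δ a b p q γ)
    (hmin : ∀ y : H1Curve n a b, MemC Φ δ a b p q y → Jpen G Φ δ a b γ ≤ Jpen G Φ δ a b y)
    (hp : Φ p ≤ 0) (hq : Φ q ≤ 0) (hJ : Jpen G Φ δ a b γ ≤ K₀)
    (hH0 : 0 ≤ H) (hm0 : 0 ≤ m) (hL0 : 0 ≤ L) (hC0 : 0 ≤ C)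
    (hH : ∀ x, Φ x ≤ δ₀ → ‖fderiv ℝ (fderiv ℝ Φ) x‖ ≤ H)
    (hm : ∀ x, |Φ x| ≤ δ₀ → 1 ≤ m * ‖fderiv ℝ Φ x‖)
    (hL : ∀ q ∈ Φ ⁻¹' Iic δ₀, ∀ v : Evec n, v ≠ 0 → ∀ ξ η : Evec n,
      ‖fderiv ℝ (fun p : Evec n × Evec n => dvCLM G p.1 p.2) (q, v) (ξ, η)‖
        ≤ L * (‖v‖ * ‖ξ‖ + ‖η‖))
    (hC : m * (L * (1 + ((m * H * L + (ℓ + L)) + m * H * (ℓ + L)) / α) + (ℓ + L)) / 2 ≤ C) :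
    ∃ t0 < δ, (∀ s ∈ Icc a b, Φ (γ.toFun s) ≤ t0) ∧
      dchi δ t0 ≤ 2 * ℓ * C * (|K₀| / (b - a) + chi δ t0) := by
  obtain ⟨v, hvc, hae, hγd, hPd⟩ := regularity hG hΦ hδ hab γ hγ hmin
  have hγc := γ.continuousOn hab.le
  obtain ⟨s0, hs0, hs0max⟩ := isCompact_Icc.exists_isMaxOn (nonempty_Icc.2 hab.le)
    (hΦ.continuous.comp_continuousOn hγc)
  have hs0max' : ∀ s ∈ Icc a b, Φ (γ.toFun s) ≤ Φ (γ.toFun s0) := fun s hs => hs0max hs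
  have hℓ := hG.ell_pos
  have hba : 0 < b - a := sub_pos.2 hab
  refine ⟨Φ (γ.toFun s0), hγ.1 s0 hs0, hs0max', ?_⟩
  have hX0 := dchi_nonneg hδ (hγ.1 s0 hs0)
  have hc0 := chi_nonneg δ (Φ (γ.toFun s0))
  rcases le_or_gt (Φ (γ.toFun s0)) 0 with ht | ht
  · have : dchi δ (Φ (γ.toFun s0)) = 0 := by simp [dchi, max_eq_right ht]
    rw [this]; positivity
  have hsa : s0 ≠ a := by rintro rfl; rw [hγ.2.1] at ht; linarith
  have hsb : s0 ≠ b := by rintro rfl; rw [hγ.2.2] at ht; linarith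
  have hs0' : s0 ∈ Ioo a b := ⟨lt_of_le_of_ne hs0.1 hsa.symm, lt_of_le_of_ne hs0.2 hsb⟩
  have hnhds : Icc a b ∈ 𝓝 s0 := Icc_mem_nhds hs0'.1 hs0'.2
  have hen : ∀ s ∈ Icc a b, (1 / 2) * G (γ.toFun s) (v s) - chi δ (Φ (γ.toFun s)) =
      (1 / 2) * G (γ.toFun s0) (v s0) - chi δ (Φ (γ.toFun s0)) := fun s hs =>
    (energy_const hG hΦ hδ hγ.1 hvc hγd hPd hs).trans
      (energy_const hG hΦ hδ hγ.1 hvc hγd hPd hs0).symm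
  have hv0 : v s0 ≠ 0 := by
    intro h0
    have hvz : ∀ s ∈ Icc a b, v s = 0 := by
      intro s hs
      have h1 := hen s hs
      have h2 := hG.upper (γ.toFun s0) (v s0)
      rw [h0, norm_zero] at h2
      rw [h0] at h1
      have h3 := chi_mono hδ (hγ.1 s0 hs0) (hs0max' s hs)
      have h4 := hG.lower (γ.toFun s) (v s)
      have h5 : (1 / ℓ) * ‖v s‖ ^ 2 ≤ 0 := by linarith
      have h6 : ‖v s‖ ^ 2 ≤ 0 := by
        by_contra h7
        push Not at h7
        have : 0 < (1 / ℓ) * ‖v s‖ ^ 2 := by positivity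
        linarith
      exact norm_eq_zero.1 (by nlinarith [norm_nonneg (v s)])
    have hc : γ.toFun s0 = γ.toFun a := by
      refine constant_of_has_deriv_right_zero hγc (fun s hs => ?_) s0 hs0
      have := hγd s (Ico_subset_Icc_self hs)
      rw [hvz s (Ico_subset_Icc_self hs)] at this
      exact this.mono_of_mem_nhdsWithin (Icc_mem_nhdsGE_of_mem hs)
    rw [hc, hγ.2.1] at ht
    linarith
  have key := max_est hG hΦ (γ := γ.toFun) (v := v) (s0 := s0) hX0 hL0 hH0 hm0
    (by
      filter_upwards [Ioo_mem_nhds hs0'.1 hs0'.2] with s hs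
      exact (hγd s (Ioo_subset_Icc_self hs)).hasDerivAt (Icc_mem_nhds hs.1 hs.2))
    ((hvc s0 hs0).continuousAt hnhds) hv0
    (by
      refine ((hPd s0 hs0).hasDerivAt hnhds).congr_deriv ?_
      rw [Qf, smul_add, smul_smul, smul_smul]
      norm_num)
    (by
      filter_upwards [hnhds] with s hs using hs0max' s hs)
    (hL _ ((hγ.1 s0 hs0).trans hδ₀).le _ hv0)
    (hH _ ((hγ.1 s0 hs0).trans hδ₀).le)
    (hm _ (by rw [abs_of_pos ht]; exact ((hγ.1 s0 hs0).trans hδ₀).le))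
  have he := energy_le hG hΦ hδ hab γ hγ.1 hae hen
  set e := (1 / 2) * G (γ.toFun s0) (v s0) - chi δ (Φ (γ.toFun s0)) with hedef
  have he2 : e ≤ |K₀| / (b - a) := by
    rw [le_div_iff₀ hba]
    linarith [le_abs_self K₀]
  have hV : ‖v s0‖ ^ 2 ≤ ℓ * G (γ.toFun s0) (v s0) := by
    have := hG.lower (γ.toFun s0) (v s0)
    rw [one_div, inv_mul_le_iff₀ hℓ] at this
    exact this
  have hV2 : ‖v s0‖ ^ 2 ≤ ℓ * (2 * (|K₀| / (b - a) + chi δ (Φ (γ.toFun s0)))) := by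
    refine hV.trans ?_
    gcongr
    linarith
  calc _ ≤ C * ‖v s0‖ ^ 2 := key.trans (by gcongr)
    _ ≤ C * (ℓ * (2 * (|K₀| / (b - a) + chi δ (Φ (γ.toFun s0))))) := by gcongr
    _ = _ := by ring


end Aux

/-- Uniform `L^∞` bound on the penalization multipliers `λ_δ = −χ'_δ(Φ(γ_δ))` of the
penalized minimizers `γ_δ`, for all `δ` below some `δ₁ ∈ (0,δ₀)`. -/
theorem stmt_9 {n : ℕ} (G : Evec n → Evec n → ℝ) (ℓ α : ℝ)
    (hG : IsFinslerEnergy n G ℓ α)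
    (Φ : Evec n → ℝ) (δ₀ : ℝ) (hΦ : IsRegularDomain n Φ δ₀)
    (a b : ℝ) (h0a : 0 ≤ a) (hab : a < b) (hb1 : b ≤ 1)
    (p q : Evec n)
    (hconn : ∃ γbar : H1Curve n a b,
      (∀ s ∈ Icc a b, Φ (γbar.toFun s) ≤ 0) ∧ γbar.toFun a = p ∧ γbar.toFun b = q)
    (γ : ℝ → H1Curve n a b)
    (hmin : ∀ δ ∈ Ioo (0:ℝ) δ₀, MemC Φ δ a b p q (γ δ) ∧
      ∀ y : H1Curve n a b, MemC Φ δ a b p q y → Jpen G Φ δ a b (γ δ) ≤ Jpen G Φ δ a b y) :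
    ∃ δ₁ ∈ Ioo (0:ℝ) δ₀, ∃ M : ℝ,
      ∀ δ ∈ Ioo (0:ℝ) δ₁, ∀ s ∈ Icc a b,
        |-(deriv (chi δ) (Φ ((γ δ).toFun s)))| ≤ M := by
  obtain ⟨γbar, hb0, hba, hbb⟩ := hconn
  obtain ⟨H, m, hH0, hm0, hH, hm⟩ := consts hΦ
  obtain ⟨L, hL0, hL⟩ := hG.hess_bound
    (hΦ.sublevel_compact δ₀ ⟨hΦ.delta0_pos.le, le_rfl⟩)
  have hℓ := hG.ell_pos
  have hα := hG.alpha_pos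
  have hδ₀ := hΦ.delta0_pos
  have hab' : 0 < b - a := sub_pos.2 hab
  have hp : Φ p ≤ 0 := by rw [← hba]; exact hb0 a ⟨le_rfl, hab.le⟩
  have hq : Φ q ≤ 0 := by rw [← hbb]; exact hb0 b ⟨hab.le, le_rfl⟩
  set C := m * (L * (1 + ((m * H * L + (ℓ + L)) + m * H * (ℓ + L)) / α) + (ℓ + L)) / 2 with hC
  have hC0 : 0 ≤ C := by positivity
  set K₀ := (1 / 2) * ∫ s in a..b, G (γbar.toFun s) (γbar.deriv s) with hK₀
  have hJbar : ∀ δ, Jpen G Φ δ a b γbar = K₀ := by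
    intro δ
    have : ∫ s in a..b, chi δ (Φ (γbar.toFun s)) = ∫ s in a..b, (0 : ℝ) := by
      refine intervalIntegral.integral_congr fun s hs => ?_
      rw [uIcc_of_le hab.le] at hs
      simp [chi, hb0 s hs]
    rw [Jpen, this]
    simp [hK₀]
  set C1 := 1 + 2 * ℓ * C * (1 + |K₀| / (b - a)) with hC1
  have hC1p : 0 < C1 := by positivity
  have hA : 0 ≤ 2 * ℓ * C := by positivity
  have hB : 0 ≤ |K₀| / (b - a) := by positivity
  refine ⟨min (δ₀ / 2) (1 / C1), ⟨lt_min (by linarith) (by positivity),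
    (min_le_left _ _).trans_lt (by linarith)⟩, 2 * C1, ?_⟩
  intro δ hδ s hs
  have hδ1 : δ < δ₀ := by
    have := hδ.2.trans_le (min_le_left _ _)
    linarith
  have hδ2 : δ * C1 ≤ 1 := by
    have := (hδ.2.trans_le (min_le_right _ _)).le
    rwa [le_div_iff₀ hC1p] at this
  obtain ⟨hmem, hmn⟩ := hmin δ ⟨hδ.1, hδ1⟩
  have hJ : Jpen G Φ δ a b (γ δ) ≤ K₀ := by
    rw [← hJbar δ]
    exact hmn γbar ⟨fun s hs => (hb0 s hs).trans_lt hδ.1, hba, hbb⟩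
  obtain ⟨t0, ht0, hle, hest⟩ := single_est hG hΦ.smooth hδ.1 hδ1 hab (γ δ) hmem hmn hp hq hJ
    hH0 hm0 hL0 hC0 hH hm hL le_rfl
  have hc0 := chi_nonneg δ t0
  have hcd := chi_le_dchi hδ.1 ht0
  have hX0 := dchi_nonneg hδ.1 ht0
  have h1 : dchi δ t0 ≤ C1 * (1 + chi δ t0) := by
    have e1 : 0 ≤ 2 * ℓ * C * (|K₀| / (b - a) * chi δ t0) := by positivity
    have e2 : C1 * (1 + chi δ t0) = 1 + chi δ t0 + 2 * ℓ * C +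
        2 * ℓ * C * (|K₀| / (b - a) * chi δ t0) +
        2 * ℓ * C * (|K₀| / (b - a) + chi δ t0) := by rw [hC1]; ring
    linarith
  have h2 : C1 * chi δ t0 ≤ dchi δ t0 / 2 := by
    calc C1 * chi δ t0 ≤ C1 * (δ / 2 * dchi δ t0) := by gcongr
      _ = (δ * C1) * (dchi δ t0 / 2) := by ring
      _ ≤ 1 * (dchi δ t0 / 2) := by gcongr
      _ = _ := one_mul _
  rw [abs_neg, (hasDerivAt_chi hδ.1 (hmem.1 s hs)).deriv,
    abs_of_nonneg (dchi_nonneg hδ.1 (hmem.1 s hs))]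
  have h3 := dchi_mono hδ.1 ht0 (hle s hs)
  linarith

end
end
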